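/- arXiv:2512.09129 — 9 statements merged into one kernel-verified Lean document; each statement's English description precedes it below -/
import Mathlib

section
/- Let σ ∈ (0,1), let u(q) = q^σ/σ, and consider the constant share mechanism t(q) = z·u(q) for z ∈ (0,1). For every marginal cost c > 0 (cost function q ↦ c·q), the seller's supply is q(c,z) = (z/c)^{1/(1−σ)}, the buyer surplus is U(c,z) = ((1−z)/σ)(z/c)^{σ/(1−σ)}, and the ratio U(c,z)/W(c) = (1−z)/((1−σ) z^{−σ/(1−σ)}) is independent of c. Consequently inf_{c > 0} U(c,z)/W(c) ≤ σ^{σ/(1−σ)}, with equality if and only if z = σ, in which case U(c,σ)/W(c) = σ^{σ/(1−σ)} for every c > 0. -/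
open Real Set

noncomputable section

/-- `q` is the smallest maximizer of `f` on the set `s`. -/
def IsSmallestArgmaxOn (f : ℝ → ℝ) (s : Set ℝ) (q : ℝ) : Prop :=
  q ∈ s ∧ (∀ x ∈ s, f x ≤ f q) ∧ ∀ x ∈ s, (∀ y ∈ s, f y ≤ f x) → q ≤ x

/-- The profit `w * q ^ σ / σ - c * q` at the candidate maximizer. -/
lemma profit_at_supply {σ w c : ℝ} (hσ : σ ∈ Ioo (0:ℝ) 1) (hw : 0 < w) (hc : 0 < c) :
    w * (((w / c) ^ (1 / (1 - σ))) ^ σ / σ) - c * (w / c) ^ (1 / (1 - σ))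
      = (1 - σ) / σ * w * (w / c) ^ (σ / (1 - σ)) := by
  obtain ⟨h0, h1⟩ := hσ
  have h2 : 1 - σ ≠ 0 := by linarith
  have hr : 0 < w / c := by positivity
  have e1 : ((w / c) ^ (1 / (1 - σ))) ^ σ = (w / c) ^ (σ / (1 - σ)) := by
    rw [← Real.rpow_mul hr.le]
    congr 1
    ring
  have e2 : (w / c) ^ (1 / (1 - σ)) = w / c * (w / c) ^ (σ / (1 - σ)) := by
    rw [← Real.rpow_one_add' hr.le (by have := sub_pos.2 h1; positivity)]
    congr 1
    field_simp
    ring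
  rw [e1, e2]
  field_simp

/-- The candidate maximizer is the unique maximizer of `w * q ^ σ / σ - c * q` on `[0, ∞)`. -/
lemma profit_lt_profit_at_supply {σ w c q : ℝ} (hσ : σ ∈ Ioo (0:ℝ) 1) (hw : 0 < w)
    (hc : 0 < c) (hq : 0 ≤ q) (hne : q ≠ (w / c) ^ (1 / (1 - σ))) :
    w * (q ^ σ / σ) - c * q
      < w * (((w / c) ^ (1 / (1 - σ))) ^ σ / σ) - c * (w / c) ^ (1 / (1 - σ)) := by
  obtain ⟨h0, h1⟩ := hσ
  have h2 : 1 - σ ≠ 0 := by linarith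
  have hr : 0 < w / c := by positivity
  set Q := (w / c) ^ (1 / (1 - σ)) with hQdef
  have hQ : 0 < Q := Real.rpow_pos_of_pos hr _
  have hwQ : w * Q ^ σ = c * Q := by
    have h3 : Q ^ (1 - σ) = w / c := by
      rw [hQdef, ← Real.rpow_mul hr.le, one_div_mul_cancel h2, Real.rpow_one]
    have h4 : Q ^ (1 - σ) * Q ^ σ = Q := by
      rw [← Real.rpow_add hQ, sub_add_cancel, Real.rpow_one]
    rw [h3] at h4
    field_simp at h4
    linarith
  have hB : (1 + (q / Q - 1)) ^ σ < 1 + σ * (q / Q - 1) := by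
    refine rpow_one_add_lt_one_add_mul_self ?_ ?_ h0 h1
    · have : 0 ≤ q / Q := by positivity
      linarith
    · rw [sub_ne_zero]
      intro h
      exact hne ((div_eq_one_iff_eq hQ.ne').1 h)
  rw [add_sub_cancel, Real.div_rpow hq hQ.le] at hB
  have hB' := mul_lt_mul_of_pos_left hB (by positivity : 0 < w * Q ^ σ / σ)
  have e1 : w * Q ^ σ / σ * (q ^ σ / Q ^ σ) = w * (q ^ σ / σ) := by
    have : Q ^ σ ≠ 0 := (Real.rpow_pos_of_pos hQ _).ne'
    field_simp
  have e2 : w * Q ^ σ / σ * (1 + σ * (q / Q - 1)) = w * (Q ^ σ / σ) + (c * q - c * Q) := by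
    rw [← mul_div_assoc w, hwQ]
    field_simp
  rw [e1, e2] at hB'
  linarith

/-- The share `z = σ` is the strict maximizer of the surplus ratio. -/
lemma surplus_ratio_lt {σ z : ℝ} (hσ : σ ∈ Ioo (0:ℝ) 1) (hz : z ∈ Ioo (0:ℝ) 1) (hne : z ≠ σ) :
    (1 - z) / ((1 - σ) * z ^ (-(σ / (1 - σ)))) < σ ^ (σ / (1 - σ)) := by
  obtain ⟨h0, h1⟩ := hσ
  obtain ⟨hz0, hz1⟩ := hz
  have h2 : 0 < 1 - σ := by linarith
  have h3 : 0 < 1 - z := by linarith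
  have hx : Real.log ((1 - z) / (1 - σ)) < (1 - z) / (1 - σ) - 1 :=
    Real.log_lt_sub_one_of_pos (by positivity) (by
      rw [Ne, div_eq_one_iff_eq h2.ne']
      intro h
      exact hne (by linarith))
  have hy : Real.log (z / σ) ≤ z / σ - 1 := Real.log_le_sub_one_of_pos (by positivity)
  have hy' := mul_le_mul_of_nonneg_left hy (by positivity : 0 ≤ σ / (1 - σ))
  have hs : (1 - z) / (1 - σ) - 1 + σ / (1 - σ) * (z / σ - 1) = 0 := by
    field_simp
    ring
  rw [Real.log_div hz0.ne' h0.ne'] at hy'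
  rw [Real.rpow_neg hz0.le, ← div_div, div_inv_eq_mul,
    ← Real.log_lt_log_iff (by positivity) (by positivity),
    Real.log_mul (by positivity) (by positivity), Real.log_rpow hz0, Real.log_rpow h0]
  linarith

/-- Proposition 1, linear cost, constant share mechanisms.
For `σ ∈ (0,1)`, `u(q) = q^σ/σ`, and the constant share mechanism `t(q) = z·u(q)` with
`z ∈ (0,1)`: for every marginal cost `c > 0` the seller's supply is `(z/c)^{1/(1-σ)}`,
the buyer surplus is `((1-z)/σ)(z/c)^{σ/(1-σ)}`, the ratio `U(c,z)/W(c)` equals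
`(1-z)/((1-σ) z^{-σ/(1-σ)})` independently of `c`, and consequently
`inf_{c>0} U(c,z)/W(c) ≤ σ^{σ/(1-σ)}` with equality iff `z = σ`, in which case the ratio
equals `σ^{σ/(1-σ)}` for every `c > 0`. -/
theorem stmt_0 (σ z : ℝ) (hσ : σ ∈ Ioo (0:ℝ) 1) (hz : z ∈ Ioo (0:ℝ) 1)
    (u : ℝ → ℝ) (hu : ∀ q, u q = q ^ σ / σ)
    (W : ℝ → ℝ) (hW : ∀ c, W c = sSup {x | ∃ q ≥ (0:ℝ), x = u q - c * q})
    (Q : ℝ → ℝ) (hQ : ∀ c, Q c = (z / c) ^ (1 / (1 - σ)))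
    (U : ℝ → ℝ) (hU : ∀ c, U c = ((1 - z) / σ) * (z / c) ^ (σ / (1 - σ))) :
    (∀ c > 0, IsSmallestArgmaxOn (fun q => z * u q - c * q) (Ici 0) (Q c)) ∧
    (∀ c > 0, U c = u (Q c) - z * u (Q c)) ∧
    (∀ c > 0, U c / W c = (1 - z) / ((1 - σ) * z ^ (-(σ / (1 - σ))))) ∧
    sInf {r | ∃ c > 0, r = U c / W c} ≤ σ ^ (σ / (1 - σ)) ∧
    (sInf {r | ∃ c > 0, r = U c / W c} = σ ^ (σ / (1 - σ)) ↔ z = σ) ∧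
    (z = σ → ∀ c > 0, U c / W c = σ ^ (σ / (1 - σ))) := by
  obtain ⟨h0, h1⟩ := id hσ
  obtain ⟨hz0, hz1⟩ := id hz
  have h2 : 0 < 1 - σ := by linarith
  have hWc : ∀ c > 0, W c = (1 - σ) / σ * (1 / c) ^ (σ / (1 - σ)) := by
    intro c hc
    have hv := profit_at_supply hσ one_pos hc
    rw [one_mul, mul_one] at hv
    rw [hW, ← hv]
    refine IsGreatest.csSup_eq ⟨⟨(1 / c) ^ (1 / (1 - σ)), by positivity, by rw [hu]⟩, ?_⟩
    rintro x ⟨q, hq, rfl⟩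
    rw [hu]
    rcases eq_or_ne q ((1 / c) ^ (1 / (1 - σ))) with rfl | hne
    · exact le_rfl
    · simpa only [one_mul] using (profit_lt_profit_at_supply hσ one_pos hc hq hne).le
  have hratio : ∀ c > 0, U c / W c = (1 - z) / ((1 - σ) * z ^ (-(σ / (1 - σ)))) := by
    intro c hc
    have h4 : (1 / c) ^ (σ / (1 - σ)) ≠ 0 := by positivity
    rw [hU, hWc c hc, div_eq_mul_one_div z c, Real.mul_rpow hz0.le (by positivity),
      Real.rpow_neg hz0.le]
    field_simp
  have hσratio : (1 - σ) / ((1 - σ) * σ ^ (-(σ / (1 - σ)))) = σ ^ (σ / (1 - σ)) := by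
    rw [Real.rpow_neg h0.le]
    field_simp
  have hInf : sInf {r | ∃ c > 0, r = U c / W c}
      = (1 - z) / ((1 - σ) * z ^ (-(σ / (1 - σ)))) := by
    have hset : {r | ∃ c > 0, r = U c / W c}
        = {(1 - z) / ((1 - σ) * z ^ (-(σ / (1 - σ))))} := by
      ext r
      simp only [Set.mem_ofPred_eq, mem_singleton_iff]
      constructor
      · rintro ⟨c, hc, rfl⟩
        exact hratio c hc
      · rintro rfl
        exact ⟨1, one_pos, (hratio 1 one_pos).symm⟩
    rw [hset, csInf_singleton]
  refine ⟨?_, ?_, hratio, ?_, ?_, ?_⟩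
  · intro c hc
    have hlt : ∀ x ∈ Ici (0:ℝ), x ≠ Q c → z * u x - c * x < z * u (Q c) - c * Q c := by
      intro x hx hne
      rw [hQ] at hne ⊢
      rw [hu, hu]
      exact profit_lt_profit_at_supply hσ hz0 hc hx hne
    have hmem : Q c ∈ Ici (0:ℝ) := by
      rw [hQ]
      exact Real.rpow_nonneg (by positivity) _
    refine ⟨hmem, fun x hx => ?_, fun x hx hmax => ?_⟩
    · rcases eq_or_ne x (Q c) with rfl | hne
      · exact le_rfl
      · exact (hlt x hx hne).le
    · by_contra h
      exact absurd (hmax _ hmem) (hlt x hx fun e => h e.ge).not_ge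
  · intro c hc
    rw [hU, hu, hQ, ← Real.rpow_mul (by positivity : (0:ℝ) ≤ z / c),
      show 1 / (1 - σ) * σ = σ / (1 - σ) by ring]
    ring
  · rw [hInf]
    rcases eq_or_ne z σ with rfl | hne
    · exact hσratio.le
    · exact (surplus_ratio_lt hσ hz hne).le
  · rw [hInf]
    constructor
    · intro h
      by_contra hne
      exact (surplus_ratio_lt hσ hz hne).ne h
    · rintro rfl
      exact hσratio
  · rintro rfl c hc
    rw [hratio c hc, hσratio]
end
end

section
/- Let σ ∈ (0,1) and u(q) = q^σ/σ. For every mechanism t, the infimum over all marginal costs c > 0 (cost functions q ↦ c·q) of the buyer surplus ratio U(c,t)/W(c) is at most σ^{σ/(1−σ)}; moreover this bound is attained (i.e., the infimum equals σ^{σ/(1−σ)}) if and only if t(q) = σ·u(q) for all q. -/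
open Real Set

noncomputable section

open Filter Topology in
/-- A continuous function that at each point is touched from below by a function with
nonpositive derivative there does not increase. -/
lemma le_of_lower_support {F : ℝ → ℝ} {l r : ℝ} (hlr : l ≤ r) (hF : ContinuousOn F (Icc l r))
    (h : ∀ x ∈ Ioc l r, ∃ (ψ : ℝ → ℝ) (ψ' : ℝ), HasDerivAt ψ ψ' x ∧ ψ' ≤ 0 ∧ ψ x = F x ∧
      ∀ w ∈ Icc l r, ψ w ≤ F w) : F r ≤ F l := by
  by_contra! hlt
  have hcont : ContinuousOn (fun y => -F (-y)) (Icc (-r) (-l)) := by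
    apply ContinuousOn.neg
    apply hF.comp continuousOn_neg
    intro y hy
    exact ⟨by linarith [hy.2], by linarith [hy.1]⟩
  have key := image_le_of_liminf_slope_right_le_deriv_boundary (f := fun y => -F (-y))
    (a := -r) (b := -l) hcont (B := fun _ => -F r) (B' := fun _ => 0) (by simp)
    continuousOn_const (fun x _ => hasDerivWithinAt_const ..) (by
      intro x hx ρ hρ
      obtain ⟨ψ, ψ', hd, hneg, heq, hle⟩ := h (-x) ⟨by linarith [hx.2], by linarith [hx.1]⟩
      have hd' : HasDerivAt (fun y => -ψ (-y)) ψ' x := by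
        have h : HasDerivAt (fun y => -ψ (-y)) (-(ψ' * -1)) x :=
          (hd.comp x (hasDerivAt_neg x)).neg
        rwa [mul_neg_one, neg_neg] at h
      have ht := (hasDerivAt_iff_tendsto_slope.1 hd').mono_left
        (nhdsWithin_mono x (fun z (hz : x < z) => hz.ne'))
      have hev := ht.eventually (gt_mem_nhds (hneg.trans_lt hρ))
      have hin : ∀ᶠ z in 𝓝[>] x, z ∈ Ioo x (-l) := Ioo_mem_nhdsGT hx.2
      apply Eventually.frequently
      filter_upwards [hev, hin] with z hz hzl
      refine lt_of_le_of_lt ?_ hz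
      have hw := hle (-z) ⟨by linarith [hzl.2], by linarith [hzl.1, hx.1]⟩
      rw [slope_def_field, slope_def_field]
      apply div_le_div_of_nonneg_right _ (by linarith [hzl.1])
      linarith)
  have := key (x := -l) ⟨by linarith, le_rfl⟩
  simp only [neg_neg] at this
  linarith

lemma convexOn_of_subgradient {p q : ℝ → ℝ}
    (hsub : ∀ c > 0, ∀ d > 0, p c - (d - c) * q c ≤ p d) : ConvexOn ℝ (Ioi 0) p := by
  refine ⟨convex_Ioi 0, fun x hx y hy α β hα hβ hαβ => ?_⟩
  have hm : 0 < α • x + β • y := (convex_Ioi (0:ℝ)) hx hy hα hβ hαβ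
  have h1 := mul_le_mul_of_nonneg_left (hsub _ hm x hx) hα
  have h2 := mul_le_mul_of_nonneg_left (hsub _ hm y hy) hβ
  simp only [smul_eq_mul] at *
  obtain rfl : β = 1 - α := by linarith
  nlinarith

/-- A weighted decay estimate for a function with subgradient `-q`. -/
lemma mul_rpow_add_log_le {p q : ℝ → ℝ} {a δ l r : ℝ}
    (hsub : ∀ c > 0, ∀ d > 0, p c - (d - c) * q c ≤ p d) (hl : 0 < l) (hlr : l ≤ r)
    (h : ∀ c ∈ Icc l r, δ ≤ c ^ a * (c * q c - a * p c)) :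
    p r * r ^ a + δ * log r ≤ p l * l ^ a + δ * log l := by
  have hpos : ∀ x ∈ Icc l r, 0 < x := fun x hx => hl.trans_le hx.1
  refine le_of_lower_support (F := fun c => p c * c ^ a + δ * log c) hlr ?_ ?_
  · apply ContinuousOn.add
    · apply ContinuousOn.mul
      · exact ((convexOn_of_subgradient hsub).continuousOn isOpen_Ioi).mono hpos
      · exact continuousOn_id.rpow_const fun x hx => Or.inl (hpos x hx).ne'
    · exact continuousOn_const.mul
        (continuousOn_id.log fun x hx => (hpos x hx).ne')
  · intro c hc
    have hc0 : 0 < c := hpos c ⟨hc.1.le, hc.2⟩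
    refine ⟨fun d => (p c - (d - c) * q c) * d ^ a + δ * log d, _,
      HasDerivAt.add (HasDerivAt.mul
        ((((hasDerivAt_id c).sub_const c).mul_const (q c)).const_sub (p c))
        (Real.hasDerivAt_rpow_const (Or.inl hc0.ne')))
        ((Real.hasDerivAt_log hc0.ne').const_mul δ), ?_, by simp, ?_⟩
    · have h1 := h c ⟨hc.1.le, hc.2⟩
      have h2 : c ^ a = c * c ^ (a - 1) := by
        rw [rpow_sub_one hc0.ne']; field_simp
      have h3 : δ * c⁻¹ ≤ c ^ (a - 1) * (c * q c - a * p c) := by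
        rw [← div_eq_mul_inv, div_le_iff₀ hc0]
        rw [h2] at h1
        linarith
      simp only [sub_self, zero_mul, sub_zero, one_mul]
      rw [h2]
      linarith
    · intro d hd
      have hd0 := hpos d hd
      have := mul_le_mul_of_nonneg_right (hsub c hc0 d hd0) (rpow_pos_of_pos hd0 a).le
      simp only
      linarith

/-- A bounded function on `(0, ∞)` whose logarithmic decay is driven by a gap
dominating a convex function vanishing only at `1` is identically `1`. -/
lemma eq_one_of_log_decay {z y k : ℝ → ℝ} {a C : ℝ} (ha : 0 < a)
    (hz : ∀ c > 0, 0 ≤ z c) (hzC : ∀ c > 0, z c ≤ C) (hy : ∀ c > 0, 0 ≤ y c)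
    (hk : ConvexOn ℝ (Ici 0) k) (hk1 : k 1 = 0) (hkpos : ∀ x ≥ 0, x ≠ 1 → 0 < k x)
    (hzy : ∀ c > 0, z c + k (y c) ≤ y c)
    (hdecay : ∀ δ l r, 0 < l → l ≤ r → (∀ c ∈ Icc l r, δ ≤ y c - z c) →
      z r + δ * a * log r ≤ z l + δ * a * log l) :
    ∀ c > 0, z c = 1 := by
  have hk0 : ∀ x ≥ 0, 0 ≤ k x := fun x hx => by
    by_cases h : x = 1
    · rw [h, hk1]
    · exact (hkpos x hx h).le
  have hanti : ∀ l r, 0 < l → l ≤ r → z r ≤ z l := fun l r hl hlr => by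
    have := hdecay 0 l r hl hlr fun c hc => by
      have hc0 : 0 < c := hl.trans_le hc.1
      linarith [hzy c hc0, hk0 _ (hy c hc0)]
    simpa using this
  have hkseg : ∀ m x, 0 ≤ m → 0 ≤ x → m ∈ segment ℝ x 1 → k m ≤ k x := fun m x _ hx hm => by
    have := hk.le_max_of_mem_segment (x := x) (y := 1) hx (by simp) hm
    rwa [hk1, max_eq_left (hk0 x hx)] at this
  intro c₀ hc₀
  rcases lt_trichotomy (z c₀) 1 with hlt | heq | hgt
  · exfalso
    obtain ⟨m, hm1, hm2⟩ := exists_between hlt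
    have hm0 : 0 ≤ m := (hz c₀ hc₀).trans hm1.le
    obtain ⟨δ, hδ, hδ'⟩ := exists_between (lt_min (sub_pos.2 hm1) (hkpos m hm0 hm2.ne))
    have hgap : ∀ c, c₀ ≤ c → δ ≤ y c - z c := fun c hc => by
      have hc0 : 0 < c := hc₀.trans_le hc
      have h1 := hanti c₀ c hc₀ hc
      rcases le_total m (y c) with h | h
      · linarith [hδ'.trans_le (min_le_left _ _)]
      · have := hkseg m (y c) hm0 (hy c hc0)
          (by rw [segment_eq_Icc (h.trans hm2.le)]; exact ⟨h, hm2.le⟩)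
        linarith [hδ'.trans_le (min_le_right _ _), hzy c hc0]
    have hM : 0 ≤ (z c₀ + 1) / (δ * a) := div_nonneg (by linarith [hz c₀ hc₀]) (mul_pos hδ ha).le
    have h2 : c₀ ≤ c₀ * exp ((z c₀ + 1) / (δ * a)) :=
      le_mul_of_one_le_right hc₀.le (one_le_exp hM)
    have h3 := hdecay δ _ _ hc₀ h2 fun c hc => hgap c hc.1
    rw [log_mul hc₀.ne' (exp_pos _).ne', log_exp, mul_add,
      mul_div_cancel₀ _ (mul_pos hδ ha).ne'] at h3
    linarith [hz _ (hc₀.trans_le h2)]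
  · exact heq
  · exfalso
    have hδ := hkpos (z c₀) (by linarith) hgt.ne'
    set δ := k (z c₀)
    have hgap : ∀ c, 0 < c → c ≤ c₀ → δ ≤ y c - z c := fun c hc0 hc => by
      have h1 := hanti c c₀ hc0 hc
      have h2 := hzy c hc0
      have h3 := hk0 _ (hy c hc0)
      have := hkseg (z c₀) (y c) (by linarith) (hy c hc0)
        (by rw [segment_symm, segment_eq_Icc (by linarith)]; exact ⟨hgt.le, by linarith⟩)
      linarith
    have hM : 0 ≤ C / (δ * a) := div_nonneg (by linarith [hzC c₀ hc₀]) (mul_pos hδ ha).le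
    have hpos : 0 < c₀ * exp (-(C / (δ * a))) := mul_pos hc₀ (exp_pos _)
    have h2 : c₀ * exp (-(C / (δ * a))) ≤ c₀ :=
      mul_le_of_le_one_right hc₀.le (exp_le_one_iff.2 (by linarith))
    have h3 := hdecay δ _ _ hpos h2 fun c hc => hgap c (hpos.trans_le hc.1) hc.2
    rw [log_mul hc₀.ne' (exp_pos _).ne', log_exp, mul_add, mul_neg,
      mul_div_cancel₀ _ (mul_pos hδ ha).ne'] at h3
    linarith [hzC _ hpos]

lemma rpow_lt_affine {σ x : ℝ} (hσ : σ ∈ Ioo (0:ℝ) 1) (hx : 0 ≤ x) (hx1 : x ≠ 1) :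
    x ^ σ < 1 - σ + σ * x := by
  have := rpow_one_add_lt_one_add_mul_self (s := x - 1) (by linarith)
    (sub_ne_zero.2 hx1) hσ.1 hσ.2
  rw [add_sub_cancel] at this
  linarith

lemma rpow_le_affine {σ x : ℝ} (hσ : σ ∈ Ioo (0:ℝ) 1) (hx : 0 ≤ x) :
    x ^ σ ≤ 1 - σ + σ * x := by
  by_cases hx1 : x = 1
  · simp [hx1]
  · exact (rpow_lt_affine hσ hx hx1).le

/-- The only subgradient system with buyer surplus at least the `σ^a` share of the efficient
surplus. -/
lemma eq_of_surplus_ge {σ a : ℝ} (hσ : σ ∈ Ioo (0:ℝ) 1) (ha : a = σ / (1 - σ)) {p q : ℝ → ℝ}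
    (hp : ∀ c > 0, 0 ≤ p c) (hq : ∀ c > 0, 0 ≤ q c)
    (hsub : ∀ c > 0, ∀ d > 0, p c - (d - c) * q c ≤ p d)
    (hU : ∀ c > 0, σ ^ a * ((1 - σ) / σ * c ^ (-a)) ≤ q c ^ σ / σ - c * q c - p c) :
    ∀ c > 0, p c = (1 - σ) * σ ^ a * c ^ (-a) := by
  obtain ⟨hσ0, hσ1⟩ := hσ
  have h1σ : 0 < 1 - σ := by linarith
  have ha0 : 0 < a := ha ▸ div_pos hσ0 h1σ
  have hS : 0 < σ ^ a := rpow_pos_of_pos hσ0 a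
  have haσ : (a + 1) * σ = a := by rw [ha]; field_simp; ring
  set S := σ ^ a with hSdef
  have hS' : (S * σ) ^ σ = S := by
    rw [hSdef, ← rpow_add_one hσ0.ne', ← rpow_mul hσ0.le, haσ]
  set y : ℝ → ℝ := fun c => q c * (c ^ a * c) / (S * σ) with hydef
  set z : ℝ → ℝ := fun c => p c * c ^ a / ((1 - σ) * S) with hzdef
  have hqy : ∀ c > 0, q c ^ σ = S * y c ^ σ / c ^ a := fun c hc => by
    have hC : 0 < c ^ a := rpow_pos_of_pos hc a
    have h1 : (c ^ a * c) ^ σ = c ^ a := by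
      rw [← rpow_add_one hc.ne', ← rpow_mul hc.le, haσ]
    simp only [hydef]
    rw [div_rpow (mul_nonneg (hq c hc) (by positivity)) (by positivity),
      mul_rpow (hq c hc) (by positivity), h1, hS']
    field_simp
  have hy : ∀ c > 0, 0 ≤ y c := fun c hc => by
    have := hq c hc; have := rpow_pos_of_pos hc a; positivity
  have hz : ∀ c > 0, 0 ≤ z c := fun c hc => by
    have := hp c hc; have := rpow_pos_of_pos hc a; positivity
  have hmain : ∀ c > 0, σ * (1 - σ) * z c + (1 - σ) + σ ^ 2 * y c - y c ^ σ ≤ 0 :=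
    fun c hc => by
    have hC : 0 < c ^ a := rpow_pos_of_pos hc a
    have h := hU c hc
    have hq' : c * q c = y c * S * σ / c ^ a := by simp only [hydef]; field_simp
    have hp' : p c = z c * (1 - σ) * S / c ^ a := by simp only [hzdef]; field_simp
    rw [hqy c hc, hq', hp', rpow_neg hc.le] at h
    have h2 : S * (y c ^ σ - σ ^ 2 * y c - σ * (1 - σ) * z c - (1 - σ)) / (σ * c ^ a) =
      S * y c ^ σ / c ^ a / σ - y c * S * σ / c ^ a - z c * (1 - σ) * S / c ^ a -
        S * ((1 - σ) / σ * (c ^ a)⁻¹) := by field_simp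
    have h3 : 0 ≤ S * (y c ^ σ - σ ^ 2 * y c - σ * (1 - σ) * z c - (1 - σ)) / (σ * c ^ a) := by
      rw [h2]; linarith
    by_contra! hcon
    have : S * (y c ^ σ - σ ^ 2 * y c - σ * (1 - σ) * z c - (1 - σ)) / (σ * c ^ a) < 0 :=
      div_neg_of_neg_of_pos (mul_neg_of_pos_of_neg hS (by linarith)) (by positivity)
    linarith
  have hz1 : ∀ c > 0, z c = 1 := by
    refine eq_one_of_log_decay ha0 (y := y)
      (k := fun x => (σ * (1 - σ))⁻¹ * ((1 - σ) + σ * x - x ^ σ))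
      (C := (1 - σ) / S / (σ * (1 - σ))) hz ?_ hy ?_ (by simp) ?_ ?_ ?_
    · intro c hc
      have hb := rpow_le_affine (x := S * σ * y c) ⟨hσ0, hσ1⟩ (mul_nonneg (by positivity) (hy c hc))
      rw [mul_rpow (by positivity) (hy c hc), hS'] at hb
      have hb' : y c ^ σ ≤ (1 - σ) / S + σ ^ 2 * y c := by
        rw [← sub_nonneg]
        have : (1 - σ) / S + σ ^ 2 * y c - y c ^ σ =
          (1 - σ + σ * (S * σ * y c) - S * y c ^ σ) / S := by field_simp
        rw [this]
        exact div_nonneg (by linarith) hS.le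
      rw [le_div_iff₀ (by positivity)]
      linarith [hmain c hc]
    · have hc : ConvexOn ℝ (Ici (0:ℝ)) (fun x => (1 - σ) + σ * x - x ^ σ) := by
        have h1 : ConvexOn ℝ (Ici (0:ℝ)) (fun x => (1 - σ) + σ * x) :=
          ⟨convex_Ici 0, fun x _ y _ α β _ _ h => by
            obtain rfl : β = 1 - α := by linarith
            simp only [smul_eq_mul]; apply le_of_eq; ring⟩
        exact h1.sub (Real.concaveOn_rpow hσ0.le hσ1.le)
      exact hc.smul (by positivity)
    · intro x hx hx1
      exact mul_pos (by positivity) (by linarith [rpow_lt_affine ⟨hσ0, hσ1⟩ hx hx1])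
    · intro c hc
      have h2 : y c - (z c + (σ * (1 - σ))⁻¹ * ((1 - σ) + σ * y c - y c ^ σ)) =
        -(σ * (1 - σ) * z c + (1 - σ) + σ ^ 2 * y c - y c ^ σ) / (σ * (1 - σ)) := by
        field_simp; ring
      rw [← sub_nonneg, h2]
      exact div_nonneg (by linarith [hmain c hc]) (by positivity)
    · intro δ l r hl hlr hδ
      have := mul_rpow_add_log_le (a := a) (δ := δ * (S * σ)) hsub hl hlr fun c hc => by
        have hc0 : 0 < c := hl.trans_le hc.1
        have h2 : c ^ a * (c * q c - a * p c) = (y c - z c) * (S * σ) := by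
          have hap : a * (1 - σ) = σ := by rw [ha]; field_simp
          simp only [hydef, hzdef]
          field_simp
          linear_combination (-p c) * hap
        rw [h2]
        exact mul_le_mul_of_nonneg_right (hδ c hc) (by positivity)
      have h5 : ∀ x, z x + δ * a * log x =
          (p x * x ^ a + δ * (S * σ) * log x) / ((1 - σ) * S) := fun x => by
        have hap : σ = a * (1 - σ) := by rw [ha]; field_simp
        simp only [hzdef]
        rw [add_div]
        congr 1
        rw [eq_div_iff (by positivity)]
        linear_combination (-δ * S * log x) * hap
      rw [h5, h5]
      exact div_le_div_of_nonneg_right this (by positivity)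
  intro c hc
  have hC : 0 < c ^ a := rpow_pos_of_pos hc a
  have := hz1 c hc
  simp only [hzdef] at this
  rw [div_eq_one_iff_eq (by positivity)] at this
  rw [rpow_neg hc.le, ← this]
  field_simp

lemma rpow_supply {σ a c : ℝ} (hσ : σ ∈ Ioo (0:ℝ) 1) (ha : a = σ / (1 - σ)) (hc : 0 < c) :
    (σ * σ ^ a * c ^ (-a - 1)) ^ σ = σ ^ a * c ^ (-a) := by
  obtain ⟨hσ0, hσ1⟩ := hσ
  have haσ : (1 + a) * σ = a := by
    have : 0 < 1 - σ := by linarith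
    rw [ha]; field_simp; ring
  rw [mul_rpow (by positivity) (by positivity), ← rpow_one_add' hσ0.le, ← rpow_mul hσ0.le, haσ,
    ← rpow_mul hc.le]
  · congr 2; linarith
  · have : 0 < a := ha ▸ div_pos hσ0 (by linarith)
    positivity

/-- The maximizer of `x ^ σ - c * x` over `x ≥ 0`. -/
lemma argmax_eq {σ a c q : ℝ} (hσ : σ ∈ Ioo (0:ℝ) 1) (ha : a = σ / (1 - σ)) (hc : 0 < c)
    (hq : 0 ≤ q) (hmax : ∀ x ∈ Ici (0:ℝ), x ^ σ - c * x ≤ q ^ σ - c * q) :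
    q = σ * σ ^ a * c ^ (-a - 1) := by
  have hσ0 := hσ.1
  have hs := rpow_supply hσ ha hc
  set s := σ * σ ^ a * c ^ (-a - 1) with hsdef
  have hs0 : 0 < s := by positivity
  have hcs : c * s = σ * s ^ σ := by
    rw [hs, hsdef, rpow_sub_one hc.ne']; field_simp
  by_contra hne
  have hv := rpow_lt_affine hσ (x := q / s) (by positivity)
    (by rwa [ne_eq, div_eq_one_iff_eq hs0.ne'])
  have hsσ : 0 < s ^ σ := rpow_pos_of_pos hs0 σ
  rw [div_rpow hq hs0.le, div_lt_iff₀ hsσ] at hv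
  have h1 := hmax s hs0.le
  have h2 : σ * (q / s) * s ^ σ = c * q := by
    rw [mul_right_comm, ← hcs]; field_simp
  rw [hcs] at h1
  linarith

/-- The indirect utility determines the payment rule. -/
lemma eq_of_indirect_utility {σ a : ℝ} (hσ : σ ∈ Ioo (0:ℝ) 1) (ha : a = σ / (1 - σ))
    {u t Q : ℝ → ℝ} (hu : ∀ q, u q = q ^ σ / σ) (ht0 : t 0 = 0)
    (hQ : ∀ c > (0:ℝ), IsSmallestArgmaxOn (fun q => t q - c * q) (Ici 0) (Q c))
    (hp : ∀ c > 0, t (Q c) - c * Q c = (1 - σ) * σ ^ a * c ^ (-a)) :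
    ∀ q ≥ (0:ℝ), t q = σ * u q := by
  obtain ⟨hσ0, hσ1⟩ := hσ
  have h1σ : 0 < 1 - σ := by linarith
  have hap : a * (1 - σ) = σ := by rw [ha]; field_simp
  have hQc : ∀ c > 0, Q c = σ * σ ^ a * c ^ (-a - 1) := fun c hc => by
    have hmin : IsLocalMin (fun d => (1 - σ) * σ ^ a * d ^ (-a) + d * Q c) c := by
      filter_upwards [lt_mem_nhds hc] with d hd
      have := (hQ d hd).2.1 (Q c) (hQ c hc).1
      simp only at this
      linarith [hp c hc, hp d hd]
    have := hmin.hasDerivAt_eq_zero (((Real.hasDerivAt_rpow_const (Or.inl hc.ne')).const_mul _).add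
      ((hasDerivAt_id c).mul_const (Q c)))
    linear_combination this + σ ^ a * c ^ (-a - 1) * hap
  intro q hq
  rcases hq.lt_or_eq with hq0 | rfl
  · have hc : 0 < σ * q ^ (σ - 1) := by positivity
    have e1 : (σ * q ^ (σ - 1)) ^ (-a) = (σ ^ a)⁻¹ * q ^ σ := by
      rw [mul_rpow hσ0.le (by positivity), rpow_neg hσ0.le, ← rpow_mul hq0.le]
      congr 2; linarith
    have hqs : q ^ σ = q * q ^ (σ - 1) := by rw [rpow_sub_one hq0.ne']; field_simp
    have h1 : Q (σ * q ^ (σ - 1)) = q := by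
      rw [hQc _ hc, rpow_sub_one hc.ne', e1, hqs]; field_simp
    have h2 := hp _ hc
    rw [h1, e1] at h2
    rw [hu, mul_div_cancel₀ _ hσ0.ne']
    have hS : σ ^ a * (σ ^ a)⁻¹ = 1 := mul_inv_cancel₀ (by positivity)
    linear_combination h2 + (1 - σ) * q ^ σ * hS - σ * hqs
  · rw [ht0, hu, zero_rpow hσ0.ne']; simp

/-- Proposition 2: competitive ratio, linear cost.
For `σ ∈ (0,1)` and `u(q) = q^σ/σ`, for every mechanism `t` (a nonnegative payment rule
with `t(0) = 0`, with supply `Q c` the smallest maximizer of `t(q) − c·q` over `q ≥ 0`),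
the infimum over all marginal costs `c > 0` of the buyer surplus ratio `U(c,t)/W(c)` is at
most `σ^{σ/(1−σ)}`, and this infimum equals `σ^{σ/(1−σ)}` iff `t(q) = σ·u(q)` for all
`q ≥ 0`. -/
theorem stmt_1 (σ : ℝ) (hσ : σ ∈ Ioo (0:ℝ) 1)
    (u : ℝ → ℝ) (hu : ∀ q, u q = q ^ σ / σ)
    (W : ℝ → ℝ) (hW : ∀ c, W c = ((1 - σ) / σ) * c ^ (-(σ / (1 - σ))))
    (t : ℝ → ℝ) (ht0 : t 0 = 0) (htpos : ∀ q ≥ (0:ℝ), 0 ≤ t q)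
    (Q : ℝ → ℝ)
    (hQ : ∀ c > (0:ℝ), IsSmallestArgmaxOn (fun q => t q - c * q) (Ici 0) (Q c))
    (U : ℝ → ℝ) (hU : ∀ c, U c = u (Q c) - t (Q c)) :
    sInf {r | ∃ c > (0:ℝ), r = U c / W c} ≤ σ ^ (σ / (1 - σ)) ∧
    (sInf {r | ∃ c > (0:ℝ), r = U c / W c} = σ ^ (σ / (1 - σ)) ↔
      ∀ q ≥ (0:ℝ), t q = σ * u q) := by
  obtain ⟨hσ0, hσ1⟩ := id hσ
  have h1σ : 0 < 1 - σ := by linarith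
  obtain ⟨a, ha⟩ : ∃ a, a = σ / (1 - σ) := ⟨_, rfl⟩
  rw [← ha] at hW ⊢
  have ha0 : 0 < a := ha ▸ div_pos hσ0 h1σ
  have hap : a * (1 - σ) = σ := by rw [ha]; field_simp
  have hS : 0 < σ ^ a := rpow_pos_of_pos hσ0 a
  have hWpos : ∀ c > 0, 0 < W c := fun c hc => by
    rw [hW]; have := rpow_pos_of_pos hc (-a); positivity
  have hrigid : (∀ c > 0, σ ^ a * W c ≤ U c) → ∀ q ≥ (0:ℝ), t q = σ * u q := by
    intro h
    have hp := eq_of_surplus_ge (p := fun c => t (Q c) - c * Q c) (q := Q) hσ ha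
      (fun c hc => by simpa [ht0] using (hQ c hc).2.1 0 (by simp))
      (fun c hc => (hQ c hc).1)
      (fun c hc d hd => by
        have := (hQ d hd).2.1 (Q c) (hQ c hc).1
        simp only at this ⊢
        linarith)
      (fun c hc => by
        have := h c hc
        rw [hW, hU, hu] at this
        linarith)
    exact eq_of_indirect_utility hσ ha hu ht0 hQ hp
  have hratio : (∀ q ≥ (0:ℝ), t q = σ * u q) → ∀ c > 0, U c = σ ^ a * W c := by
    intro h c hc
    rw [hU, h _ (hQ c hc).1, hu, hW, argmax_eq hσ ha hc (hQ c hc).1 fun x hx => ?_,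
      rpow_supply hσ ha hc]
    · field_simp
    · have := (hQ c hc).2.1 x hx
      simp only [h x hx, h _ (hQ c hc).1, hu] at this
      rwa [mul_div_cancel₀ _ hσ0.ne', mul_div_cancel₀ _ hσ0.ne'] at this
  have hsInf : (∀ q ≥ (0:ℝ), t q = σ * u q) →
      sInf {r | ∃ c > (0:ℝ), r = U c / W c} = σ ^ a := by
    intro h
    have : {r | ∃ c > (0:ℝ), r = U c / W c} = {σ ^ a} := by
      ext r
      simp only [mem_ofPred_eq, mem_singleton_iff]
      have hr : ∀ c > 0, U c / W c = σ ^ a := fun c hc => by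
        rw [hratio h c hc, mul_div_cancel_right₀ _ (hWpos c hc).ne']
      exact ⟨fun ⟨c, hc, hrc⟩ => hrc.trans (hr c hc),
        fun e => ⟨1, one_pos, e.trans (hr 1 one_pos).symm⟩⟩
    rw [this, csInf_singleton]
  have hge : σ ^ a ≤ sInf {r | ∃ c > (0:ℝ), r = U c / W c} → ∀ q ≥ (0:ℝ), t q = σ * u q := by
    intro h
    refine hrigid fun c hc => ?_
    have hbdd : BddBelow {r | ∃ c > (0:ℝ), r = U c / W c} := by
      by_contra hnb
      rw [Real.sInf_of_not_bddBelow hnb] at h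
      linarith
    exact (le_div_iff₀ (hWpos c hc)).1 (h.trans (csInf_le hbdd ⟨c, hc, rfl⟩))
  refine ⟨?_, fun h => hge h.ge, hsInf⟩
  by_contra! h
  exact h.ne' (hsInf (hge h.le))
end
end

section
/- Let σ ∈ (0,1), u(q) = q^σ/σ, c̄ > 0, and for α > σ/(1−σ) let F_α be the power distribution on [0,c̄] with CDF F_α(c) = (c/c̄)^α. Let V(α) = sup over all mechanisms t of ∫₀^{c̄} U(c,t) dF_α(c) be the Bayes-optimal expected buyer surplus. Then lim_{α ↓ σ/(1−σ)} V(α) / ∫₀^{c̄} W(c) dF_α(c) = σ^{σ/(1−σ)}. -/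
open Real Set MeasureTheory

noncomputable section

lemma isoelastic_surplus_scale {σ a : ℝ} (hσ : σ ∈ Ioo (0:ℝ) 1) (ha : 0 < a) (x : ℝ) (hx : 0 ≤ x) :
    (a ^ (-(1 / (1 - σ))) * x) ^ σ / σ - a * (a ^ (-(1 / (1 - σ))) * x) =
      a ^ (-(σ / (1 - σ))) * (x ^ σ / σ - x) := by
  have h1 : (1 - σ) ≠ 0 := (sub_pos.2 hσ.2).ne'
  rw [mul_rpow (rpow_nonneg ha.le _) hx, ← rpow_mul ha.le, ← mul_assoc]
  have e1 : -(1 / (1 - σ)) * σ = -(σ / (1 - σ)) := by ring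
  have e2 : a * a ^ (-(1 / (1 - σ))) = a ^ (-(σ / (1 - σ))) := by
    rw [← rpow_one_add' ha.le]
    · congr 1; field_simp; ring
    · have : 1 + -(1 / (1 - σ)) = -σ / (1 - σ) := by field_simp; ring
      rw [this]
      exact div_ne_zero (neg_ne_zero.2 hσ.1.ne') h1
  rw [e1, e2]; ring

/-- The isoelastic surplus `q ^ σ / σ - a * q` is uniquely maximized at `a ^ (-1 / (1 - σ))`. -/
lemma isoelastic_surplus_lt {σ a q : ℝ} (hσ : σ ∈ Ioo (0:ℝ) 1) (ha : 0 < a) (hq : 0 ≤ q)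
    (hne : q ≠ a ^ (-(1 / (1 - σ)))) :
    q ^ σ / σ - a * q < (1 - σ) / σ * a ^ (-(σ / (1 - σ))) := by
  have hp : 0 < a ^ (-(1 / (1 - σ))) := rpow_pos_of_pos ha _
  set x := q / a ^ (-(1 / (1 - σ))) with hx
  have hqx : q = a ^ (-(1 / (1 - σ))) * x := by rw [hx]; field_simp
  have hx0 : 0 ≤ x := div_nonneg hq hp.le
  have hx1 : x - 1 ≠ 0 := by
    intro h
    exact hne (by rw [hqx, sub_eq_zero.1 h, mul_one])
  have key := rpow_one_add_lt_one_add_mul_self (s := x - 1) (by linarith) hx1 hσ.1 hσ.2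
  rw [add_sub_cancel] at key
  rw [hqx, isoelastic_surplus_scale hσ ha x hx0, mul_comm]
  refine mul_lt_mul_of_pos_right ?_ (rpow_pos_of_pos ha _)
  have := hσ.1
  rw [lt_div_iff₀ this, sub_mul, div_mul_cancel₀ _ this.ne']
  linarith

lemma isoelastic_surplus_eq {σ a : ℝ} (hσ : σ ∈ Ioo (0:ℝ) 1) (ha : 0 < a) :
    (a ^ (-(1 / (1 - σ)))) ^ σ / σ - a * a ^ (-(1 / (1 - σ))) =
      (1 - σ) / σ * a ^ (-(σ / (1 - σ))) := by
  have h := isoelastic_surplus_scale hσ ha 1 zero_le_one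
  have := hσ.1
  rw [mul_one, one_rpow] at h
  rw [h]; field_simp

lemma isoelastic_surplus_le {σ a q : ℝ} (hσ : σ ∈ Ioo (0:ℝ) 1) (ha : 0 < a) (hq : 0 ≤ q) :
    q ^ σ / σ - a * q ≤ (1 - σ) / σ * a ^ (-(σ / (1 - σ))) := by
  by_cases h : q = a ^ (-(1 / (1 - σ)))
  · rw [h, isoelastic_surplus_eq hσ ha]
  · exact (isoelastic_surplus_lt hσ ha hq h).le

/-- The scaled form of the envelope inequality, weighted by a power. -/
lemma envelope_scaled {P Q : ℝ → ℝ} {α l c : ℝ} (hc : 0 < c) (hl : 1 < l)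
    (henv : ∀ c c', 0 < c → c < c' → P c' + (c' - c) * Q c' ≤ P c) :
    P (l * c) * (l * c) ^ (α - 1) + (1 - l⁻¹) * (Q (l * c) * (l * c) ^ α) ≤
      l ^ (α - 1) * (P c * c ^ (α - 1)) := by
  have hl0 : 0 < l := by linarith
  have h := henv c (l * c) hc (by nlinarith)
  have e : (l * c) ^ α = (l * c) * (l * c) ^ (α - 1) := by
    rw [rpow_sub_one (by positivity)]; field_simp
  rw [e, mul_rpow hl0.le hc.le]
  have hw : 0 < l ^ (α - 1) * c ^ (α - 1) := by positivity
  calc _ = (l ^ (α - 1) * c ^ (α - 1)) * (P (l * c) + (l * c - c) * Q (l * c)) := by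
        field_simp
    _ ≤ (l ^ (α - 1) * c ^ (α - 1)) * P c := by gcongr
    _ = _ := by ring

/-- Weighted comparison of a supply function with the rent it generates. -/
lemma integral_supply_le_rent_Ioi {P Q : ℝ → ℝ} {α : ℝ}
    (hP : ∀ c, 0 < c → 0 ≤ P c) (hQ : ∀ c, 0 < c → 0 ≤ Q c) (hanti : AntitoneOn Q (Ioi 0))
    (henv : ∀ c c', 0 < c → c < c' → P c' + (c' - c) * Q c' ≤ P c)
    (hint : IntegrableOn (fun c => P c * c ^ (α - 1)) (Ioi 0)) :
    IntegrableOn (fun c => Q c * c ^ α) (Ioi 0) ∧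
      ∫ c in Ioi 0, Q c * c ^ α ≤ α * ∫ c in Ioi 0, P c * c ^ (α - 1) := by
  have hQint : IntegrableOn (fun c => Q c * c ^ α) (Ioi 0) := by
    have h2 := integrableOn_Ioi_comp_mul_left_iff (fun c => Q c * c ^ α) 0 (zero_lt_two' ℝ)
    rw [mul_zero] at h2
    rw [← h2]
    refine Integrable.mono' ((hint.const_mul (2 ^ (α - 1))).const_mul 2) ?_ ?_
    · have : AntitoneOn (fun c => Q (2 * c)) (Ioi 0) := by
        intro a ha b hb hab
        simp only [mem_Ioi] at ha hb
        exact hanti (by simp [ha]) (by simp [hb]) (by linarith)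
      refine AEStronglyMeasurable.mul
        (aemeasurable_restrict_of_antitoneOn measurableSet_Ioi this).aestronglyMeasurable ?_
      exact (by fun_prop : Measurable fun c : ℝ => (2 * c) ^ α).aestronglyMeasurable
    · refine (ae_restrict_mem measurableSet_Ioi).mono fun c hc => ?_
      rw [mem_Ioi] at hc
      have h := envelope_scaled (α := α) hc one_lt_two henv
      have h1 := hP (2 * c) (by positivity)
      have h3 : 0 ≤ P (2 * c) * (2 * c) ^ (α - 1) := by positivity
      have h4 := hQ (2 * c) (by positivity)
      rw [norm_of_nonneg (by positivity)]
      norm_num at h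
      linarith
  refine ⟨hQint, ?_⟩
  set IP := ∫ c in Ioi 0, P c * c ^ (α - 1)
  set IQ := ∫ c in Ioi 0, Q c * c ^ α
  have key : ∀ l, 1 < l → IQ ≤ l * slope (fun x : ℝ => x ^ α) 1 l * IP := by
    intro l hl
    have hl0 : 0 < l := by linarith
    have hg : IntegrableOn
        (fun x => P x * x ^ (α - 1) + (1 - l⁻¹) * (Q x * x ^ α)) (Ioi 0) :=
      hint.add (hQint.const_mul _)
    have hgl := integrableOn_Ioi_comp_mul_left_iff
      (fun x => P x * x ^ (α - 1) + (1 - l⁻¹) * (Q x * x ^ α)) 0 hl0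
    have hs := integral_comp_mul_left_Ioi
      (fun x => P x * x ^ (α - 1) + (1 - l⁻¹) * (Q x * x ^ α)) 0 hl0
    rw [mul_zero] at hgl hs
    have hle := setIntegral_mono_on (hgl.2 hg) (hint.const_mul (l ^ (α - 1))) measurableSet_Ioi
      fun c hc => envelope_scaled (α := α) hc hl henv
    rw [hs, integral_add hint (hQint.const_mul _), integral_const_mul, integral_const_mul,
      smul_eq_mul, rpow_sub_one hl0.ne'] at hle
    change l⁻¹ * (IP + (1 - l⁻¹) * IQ) ≤ l ^ α / l * IP at hle
    rw [slope_def_field, one_rpow]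
    have h1 : 0 < l - 1 := by linarith
    have h2 : IP + (1 - l⁻¹) * IQ ≤ l ^ α * IP := by
      have := mul_le_mul_of_nonneg_left hle hl0.le
      field_simp at this
      field_simp
      linarith
    have h3 : (l - 1) * IQ ≤ l * (l ^ α - 1) * IP := by
      have := mul_le_mul_of_nonneg_left h2 hl0.le
      have e : l * (IP + (1 - l⁻¹) * IQ) = l * IP + (l - 1) * IQ := by field_simp
      linarith
    have e : l * ((l ^ α - 1) / (l - 1)) * IP = l * (l ^ α - 1) * IP / (l - 1) := by ring
    rw [e, le_div_iff₀ h1]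
    linarith
  have hd : HasDerivAt (fun x : ℝ => x ^ α) α 1 := by
    simpa using hasDerivAt_rpow_const (x := (1:ℝ)) (p := α) (Or.inl one_ne_zero)
  have ht : Filter.Tendsto (fun l => l * slope (fun x : ℝ => x ^ α) 1 l * IP)
      (nhdsWithin 1 (Ioi 1)) (nhds (1 * α * IP)) := by
    refine Filter.Tendsto.mul_const _ (Filter.Tendsto.mul ?_ ?_)
    · exact Filter.tendsto_id.mono_left nhdsWithin_le_nhds
    · exact (hasDerivAt_iff_tendsto_slope.1 hd).mono_left
        (nhdsWithin_mono _ fun x hx => (ne_of_gt hx : x ≠ 1))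
  rw [one_mul] at ht
  exact ge_of_tendsto ht (Filter.eventually_of_mem self_mem_nhdsWithin key)

lemma integral_supply_le_rent_Ioo {P Q : ℝ → ℝ} {α b : ℝ}
    (hP : ∀ c ∈ Ioo 0 b, 0 ≤ P c) (hQ : ∀ c ∈ Ioo 0 b, 0 ≤ Q c) (hanti : AntitoneOn Q (Ioo 0 b))
    (henv : ∀ c ∈ Ioo 0 b, ∀ c' ∈ Ioo 0 b, c < c' → P c' + (c' - c) * Q c' ≤ P c)
    (hint : IntegrableOn (fun c => P c * c ^ (α - 1)) (Ioo 0 b)) :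
    IntegrableOn (fun c => Q c * c ^ α) (Ioo 0 b) ∧
      ∫ c in Ioo 0 b, Q c * c ^ α ≤ α * ∫ c in Ioo 0 b, P c * c ^ (α - 1) := by
  have hP' : ∀ c, 0 ≤ (Ioo 0 b).indicator P c := fun c => indicator_nonneg hP c
  have hQ' : ∀ c, 0 ≤ (Ioo 0 b).indicator Q c := fun c => indicator_nonneg hQ c
  have hout : ∀ {c c' : ℝ}, 0 < c → c < c' → c' ∉ Ioo 0 b ∨ (c ∈ Ioo 0 b ∧ c' ∈ Ioo 0 b) := by
    intro c c' hc hcc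
    by_cases h : c' ∈ Ioo 0 b
    · exact Or.inr ⟨⟨hc, hcc.trans h.2⟩, h⟩
    · exact Or.inl h
  have e : ∀ (R : ℝ → ℝ) (β : ℝ), (fun c => (Ioo 0 b).indicator R c * c ^ β) =
      (Ioo 0 b).indicator (fun c => R c * c ^ β) := by
    intro R β
    ext c
    by_cases h : c ∈ Ioo 0 b <;> simp [h]
  have hsub : Ioo 0 b ∩ Ioi (0:ℝ) = Ioo 0 b := inter_eq_left.2 fun c hc => hc.1
  have hsub' : Ioi (0:ℝ) ∩ Ioo 0 b = Ioo 0 b := inter_eq_right.2 fun c hc => hc.1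
  have main := integral_supply_le_rent_Ioi (P := (Ioo 0 b).indicator P)
    (Q := (Ioo 0 b).indicator Q) (α := α) (fun c _ => hP' c) (fun c _ => hQ' c) ?_ ?_ ?_
  · rw [e, e, integrableOn_indicator_iff measurableSet_Ioo, hsub,
      setIntegral_indicator measurableSet_Ioo, setIntegral_indicator measurableSet_Ioo,
      hsub'] at main
    exact main
  · intro c hc c' _ hcc
    rcases hcc.eq_or_lt with rfl | hlt
    · exact le_rfl
    rcases hout hc hlt with h | ⟨h, h'⟩
    · rw [indicator_of_notMem h]; exact hQ' c
    · rw [indicator_of_mem h, indicator_of_mem h']; exact hanti h h' hcc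
  · intro c c' hc hlt
    rcases hout hc hlt with h | ⟨h, h'⟩
    · rw [indicator_of_notMem h, indicator_of_notMem h]; simpa using hP' c
    · simp only [indicator_of_mem h, indicator_of_mem h']; exact henv c h c' h' hlt
  · rw [e, integrableOn_indicator_iff measurableSet_Ioo, hsub]
    exact hint

lemma integrableOn_rpow_Ioo {r b : ℝ} (hb : 0 < b) (hr : -1 < r) :
    IntegrableOn (fun c : ℝ => c ^ r) (Ioo 0 b) :=
  (intervalIntegrable_iff_integrableOn_Ioo_of_le hb.le).1
    (intervalIntegral.intervalIntegrable_rpow' hr)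

/-- The expected buyer surplus is at most the expected efficient surplus at the virtual cost
`(1 + 1 / α) * c`. -/
lemma integral_buyer_surplus_le {P Q : ℝ → ℝ} {σ α b : ℝ} (hσ : σ ∈ Ioo (0:ℝ) 1) (hb : 0 < b)
    (hα : σ / (1 - σ) < α)
    (hP : ∀ c ∈ Ioo 0 b, 0 ≤ P c) (hQ : ∀ c ∈ Ioo 0 b, 0 ≤ Q c)
    (henv : ∀ c ∈ Ioo 0 b, ∀ c' ∈ Ioo 0 b, P c' + (c' - c) * Q c' ≤ P c)
    (hint : IntegrableOn (fun c => (Q c ^ σ / σ - c * Q c - P c) * c ^ (α - 1)) (Ioo 0 b)) :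
    ∫ c in Ioo 0 b, (Q c ^ σ / σ - c * Q c - P c) * c ^ (α - 1) ≤
      (1 - σ) / σ * (1 + 1 / α) ^ (-(σ / (1 - σ))) *
        ∫ c in Ioo 0 b, c ^ (α - 1 - σ / (1 - σ)) := by
  have hs : 0 < σ / (1 - σ) := div_pos hσ.1 (sub_pos.2 hσ.2)
  have hα0 : 0 < α := hs.trans hα
  have hanti : AntitoneOn Q (Ioo 0 b) := by
    intro c hc c' hc' hcc
    rcases hcc.eq_or_lt with rfl | hlt
    · exact le_rfl
    have h1 := henv c hc c' hc'
    have h2 := henv c' hc' c hc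
    nlinarith
  have hPanti : AntitoneOn P (Ioo 0 b) := by
    intro c hc c' hc' hcc
    have h1 := henv c hc c' hc'
    have h2 := mul_nonneg (sub_nonneg.2 hcc) (hQ c' hc')
    linarith
  have hpow : IntegrableOn (fun c : ℝ => c ^ (α - 1 - σ / (1 - σ))) (Ioo 0 b) :=
    integrableOn_rpow_Ioo hb (by linarith)
  have hsplit : ∀ c ∈ Ioo 0 b, c ^ (α - 1 - σ / (1 - σ)) =
      c ^ (-(σ / (1 - σ))) * c ^ (α - 1) := by
    intro c hc
    rw [← rpow_add hc.1]; congr 1; ring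
  have hPint : IntegrableOn (fun c => P c * c ^ (α - 1)) (Ioo 0 b) := by
    refine Integrable.mono' ((hpow.const_mul ((1 - σ) / σ)).sub hint) ?_ ?_
    · exact (aemeasurable_restrict_of_antitoneOn measurableSet_Ioo hPanti).aestronglyMeasurable.mul
        (by fun_prop : Measurable fun c : ℝ => c ^ (α - 1)).aestronglyMeasurable
    · refine (ae_restrict_mem measurableSet_Ioo).mono fun c hc => ?_
      have hw : 0 ≤ c ^ (α - 1) := rpow_nonneg hc.1.le _
      rw [norm_of_nonneg (mul_nonneg (hP c hc) hw)]
      simp only [Pi.sub_apply]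
      rw [hsplit c hc, ← mul_assoc, ← sub_mul]
      refine mul_le_mul_of_nonneg_right ?_ hw
      have := isoelastic_surplus_le hσ hc.1 (hQ c hc)
      linarith
  obtain ⟨hQint, hQP⟩ := integral_supply_le_rent_Ioo hP hQ hanti
    (fun c hc c' hc' _ => henv c hc c' hc') hPint
  have hD : IntegrableOn (fun c => P c * c ^ (α - 1) - 1 / α * (Q c * c ^ α)) (Ioo 0 b) :=
    hPint.sub (hQint.const_mul _)
  have hD0 : 0 ≤ ∫ c in Ioo 0 b, (P c * c ^ (α - 1) - 1 / α * (Q c * c ^ α)) := by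
    rw [integral_sub hPint (hQint.const_mul _), integral_const_mul, sub_nonneg, one_div,
      inv_mul_le_iff₀ hα0]
    exact hQP
  rw [← integral_const_mul]
  refine (le_add_of_nonneg_right hD0).trans ?_
  rw [← integral_add hint hD]
  refine setIntegral_mono_on (hint.add hD) (hpow.const_mul _) measurableSet_Ioo fun c hc => ?_
  have hk : 0 < 1 + 1 / α := by positivity
  have h := isoelastic_surplus_le hσ (mul_pos hk hc.1) (hQ c hc)
  have hw : 0 ≤ c ^ (α - 1) := rpow_nonneg hc.1.le _
  rw [mul_rpow hk.le hc.1.le] at h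
  have e : c ^ α = c * c ^ (α - 1) := by
    rw [rpow_sub_one hc.1.ne']; field_simp [hc.1.ne']
  rw [hsplit c hc, e]
  have := mul_le_mul_of_nonneg_right h hw
  calc _ = (Q c ^ σ / σ - (1 + 1 / α) * c * Q c) * c ^ (α - 1) := by ring
    _ ≤ _ := this
    _ = _ := by ring

/-- The tariff `max 0 (q ^ σ / (σ k) - A)`, with `A` leaving no rent at cost `b`, implements the
supply that is efficient at the inflated cost `k * c`. -/
lemma isSmallestArgmaxOn_tariff {σ k b c A : ℝ} (hσ : σ ∈ Ioo (0:ℝ) 1) (hk : 0 < k)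
    (hA : k * A = (1 - σ) / σ * (k * b) ^ (-(σ / (1 - σ)))) (hc : c ∈ Ioo 0 b) :
    max 0 (((k * c) ^ (-(1 / (1 - σ)))) ^ σ / σ / k - A) =
        ((k * c) ^ (-(1 / (1 - σ)))) ^ σ / σ / k - A ∧
      IsSmallestArgmaxOn (fun q => max 0 (q ^ σ / σ / k - A) - c * q) (Ici 0)
        ((k * c) ^ (-(1 / (1 - σ)))) := by
  have h1 := sub_pos.2 hσ.2
  have hs : 0 < σ / (1 - σ) := div_pos hσ.1 h1
  have hkc : 0 < k * c := mul_pos hk hc.1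
  set q₀ := (k * c) ^ (-(1 / (1 - σ))) with hq₀
  have hq₀pos : 0 < q₀ := rpow_pos_of_pos hkc _
  have heq : q₀ ^ σ / σ - k * c * q₀ = (1 - σ) / σ * (k * c) ^ (-(σ / (1 - σ))) :=
    isoelastic_surplus_eq hσ hkc
  have hgap : k * A < q₀ ^ σ / σ - k * c * q₀ := by
    rw [heq, hA]
    refine mul_lt_mul_of_pos_left ?_ (div_pos h1 hσ.1)
    exact rpow_lt_rpow_of_neg hkc (mul_lt_mul_of_pos_left hc.2 hk) (neg_neg_of_pos hs)
  have hprofit : ∀ q, k * (q ^ σ / σ / k - A - c * q) = q ^ σ / σ - k * c * q - k * A := by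
    intro q
    generalize q ^ σ / σ = y
    field_simp
    ring
  have hpos : 0 < q₀ ^ σ / σ / k - A - c * q₀ := by
    refine pos_of_mul_pos_right (a := k) ?_ hk.le
    rw [hprofit]; linarith
  have hmax : max 0 (q₀ ^ σ / σ / k - A) = q₀ ^ σ / σ / k - A :=
    max_eq_right (by nlinarith [mul_pos hc.1 hq₀pos])
  have hlt : ∀ q, 0 ≤ q → q ≠ q₀ →
      max 0 (q ^ σ / σ / k - A) - c * q < max 0 (q₀ ^ σ / σ / k - A) - c * q₀ := by
    intro q hq hne
    rw [hmax, sub_lt_iff_lt_add, max_lt_iff]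
    refine ⟨by nlinarith [mul_nonneg hc.1.le hq], ?_⟩
    have h := isoelastic_surplus_lt hσ hkc hq hne
    rw [← heq] at h
    have : k * (q ^ σ / σ / k - A - c * q) < k * (q₀ ^ σ / σ / k - A - c * q₀) := by
      rw [hprofit, hprofit]; linarith
    linarith [lt_of_mul_lt_mul_left this hk.le]
  refine ⟨hmax, hq₀pos.le, fun q hq => ?_, fun q hq hq' => ?_⟩
  · by_cases hne : q = q₀
    · rw [hne]
    · exact (hlt q hq hne).le
  · by_contra hn
    exact absurd (hq' q₀ hq₀pos.le) (not_le.2 (hlt q hq fun h => hn h.ge))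

lemma integral_rpow_Ioo {r b : ℝ} (hb : 0 < b) (hr : -1 < r) :
    ∫ c in Ioo 0 b, c ^ r = b ^ (r + 1) / (r + 1) := by
  rw [← integral_Ioc_eq_integral_Ioo, ← intervalIntegral.integral_of_le hb.le,
    integral_rpow (Or.inl hr), zero_rpow (by linarith), sub_zero]

/-- The value attained by the tariff of `isSmallestArgmaxOn_tariff` at `k = 1 + 1 / α`. -/
lemma integral_tariff_surplus {σ α b k A : ℝ} (hσ : σ ∈ Ioo (0:ℝ) 1) (hb : 0 < b)
    (hα : σ / (1 - σ) < α) (hk : k = 1 + 1 / α)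
    (hA : k * A = (1 - σ) / σ * (k * b) ^ (-(σ / (1 - σ)))) :
    ∫ c in Ioo 0 b, (((k * c) ^ (-(1 / (1 - σ)))) ^ σ / σ -
        (((k * c) ^ (-(1 / (1 - σ)))) ^ σ / σ / k - A)) * c ^ (α - 1) =
      (1 - σ) / σ * k ^ (-(σ / (1 - σ))) * ∫ c in Ioo 0 b, c ^ (α - 1 - σ / (1 - σ)) := by
  have h1 := sub_pos.2 hσ.2
  have hσ0 := hσ.1
  have hs : 0 < σ / (1 - σ) := div_pos hσ.1 h1
  have hα0 : 0 < α := hs.trans hα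
  have hk0 : 0 < k := by rw [hk]; positivity
  have hcong : ∀ c ∈ Ioo 0 b, (((k * c) ^ (-(1 / (1 - σ)))) ^ σ / σ -
        (((k * c) ^ (-(1 / (1 - σ)))) ^ σ / σ / k - A)) * c ^ (α - 1) =
      (1 - 1 / k) / σ * k ^ (-(σ / (1 - σ))) * c ^ (α - 1 - σ / (1 - σ)) +
        A * c ^ (α - 1) := by
    intro c hc
    have e : ((k * c) ^ (-(1 / (1 - σ)))) ^ σ = k ^ (-(σ / (1 - σ))) * c ^ (-(σ / (1 - σ))) := by
      rw [← rpow_mul (mul_pos hk0 hc.1).le, ← mul_rpow hk0.le hc.1.le]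
      congr 1; ring
    have e2 : c ^ (α - 1 - σ / (1 - σ)) = c ^ (-(σ / (1 - σ))) * c ^ (α - 1) := by
      rw [← rpow_add hc.1]; congr 1; ring
    rw [e, e2]; ring
  rw [setIntegral_congr_fun measurableSet_Ioo hcong,
    integral_add ((integrableOn_rpow_Ioo hb (by linarith)).const_mul _)
      ((integrableOn_rpow_Ioo hb (by linarith)).const_mul _),
    integral_const_mul, integral_const_mul, integral_rpow_Ioo hb (by linarith),
    integral_rpow_Ioo hb (by linarith)]
  have hA' : A = (1 - σ) / σ * (k ^ (-(σ / (1 - σ))) * b ^ (-(σ / (1 - σ)))) * (1 / k) := by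
    rw [← mul_rpow hk0.le hb.le, ← hA]; field_simp
  have eb : b ^ (α - 1 - σ / (1 - σ) + 1) = b ^ (-(σ / (1 - σ))) * b ^ (α - 1 + 1) := by
    rw [← rpow_add hb]; congr 1; ring
  rw [eb, hA']
  generalize b ^ (α - 1 + 1) = x
  generalize b ^ (-(σ / (1 - σ))) = y
  generalize k ^ (-(σ / (1 - σ))) = z
  have hne : α - 1 - σ / (1 - σ) + 1 ≠ 0 := by linarith
  have hne2 : α * (1 - σ) - σ ≠ 0 := by
    have := (div_lt_iff₀ h1).1 hα
    linarith
  have e3 : α - 1 - σ / (1 - σ) + 1 = (α * (1 - σ) - σ) / (1 - σ) := by field_simp; ring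
  have hα1 : α + 1 ≠ 0 := by linarith
  have e4 : 1 / k = α / (α + 1) := by rw [hk]; field_simp
  have e5 : α - 1 + 1 = α := by ring
  rw [e3, e4, e5]
  field_simp
  ring

/-- Proposition 3, first part.
For `σ ∈ (0,1)`, `u(q) = q^σ/σ`, `c̄ > 0`, and the power distribution `F_α` on `[0,c̄]`
with density `α c^{α−1}/c̄^α`, let `V(α)` be the supremum over mechanisms of the expected
buyer surplus. Then `V(α) / ∫ W dF_α → σ^{σ/(1−σ)}` as `α ↓ σ/(1−σ)`. -/
theorem stmt_2 (σ cbar : ℝ) (hσ : σ ∈ Ioo (0:ℝ) 1) (hcbar : 0 < cbar)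
    (u : ℝ → ℝ) (hu : ∀ q, u q = q ^ σ / σ)
    (W : ℝ → ℝ) (hW : ∀ c, W c = ((1 - σ) / σ) * c ^ (-(σ / (1 - σ))))
    (V : ℝ → ℝ)
    (hV : ∀ α, V α = sSup {v | ∃ t Q : ℝ → ℝ, t 0 = 0 ∧ (∀ q ≥ (0:ℝ), 0 ≤ t q) ∧
      (∀ c ∈ Ioo (0:ℝ) cbar, IsSmallestArgmaxOn (fun q => t q - c * q) (Ici 0) (Q c)) ∧
      v = ∫ c in (0:ℝ)..cbar, (u (Q c) - t (Q c)) * (α * c ^ (α - 1) / cbar ^ α)}) :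
    Filter.Tendsto
      (fun α => V α / ∫ c in (0:ℝ)..cbar, W c * (α * c ^ (α - 1) / cbar ^ α))
      (nhdsWithin (σ / (1 - σ)) (Ioi (σ / (1 - σ))))
      (nhds (σ ^ (σ / (1 - σ)))) := by
  have h1 := sub_pos.2 hσ.2
  have hσ0 := hσ.1
  have hs : 0 < σ / (1 - σ) := div_pos hσ.1 h1
  have hlim : Filter.Tendsto (fun α : ℝ => (1 + 1 / α) ^ (-(σ / (1 - σ))))
      (nhdsWithin (σ / (1 - σ)) (Ioi (σ / (1 - σ)))) (nhds (σ ^ (σ / (1 - σ)))) := by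
    have hcont : ContinuousAt (fun α : ℝ => (1 + 1 / α) ^ (-(σ / (1 - σ)))) (σ / (1 - σ)) := by
      refine ContinuousAt.rpow_const ?_ (Or.inl (by positivity))
      exact continuousAt_const.add (continuousAt_const.div continuousAt_id hs.ne')
    have hval : (1 + 1 / (σ / (1 - σ))) ^ (-(σ / (1 - σ))) = σ ^ (σ / (1 - σ)) := by
      have : 1 + 1 / (σ / (1 - σ)) = σ⁻¹ := by field_simp; ring
      rw [this, inv_rpow hσ0.le, rpow_neg hσ0.le, inv_inv]
    rw [← hval]
    exact hcont.tendsto.mono_left nhdsWithin_le_nhds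
  refine hlim.congr' (Filter.eventually_of_mem self_mem_nhdsWithin fun α hα => ?_)
  rw [mem_Ioi] at hα
  have hα0 : 0 < α := hs.trans hα
  have hk : 0 < 1 + 1 / α := by positivity
  have hw : 0 < α / cbar ^ α := div_pos hα0 (rpow_pos_of_pos hcbar _)
  have hconv : ∀ g : ℝ → ℝ, ∫ c in (0:ℝ)..cbar, g c * (α * c ^ (α - 1) / cbar ^ α) =
      (∫ c in Ioo 0 cbar, g c * c ^ (α - 1)) * (α / cbar ^ α) := by
    intro g
    rw [intervalIntegral.integral_of_le hcbar.le, integral_Ioc_eq_integral_Ioo,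
      ← integral_mul_const]
    congr 1; ext c; ring
  have hI : 0 < ∫ c in Ioo 0 cbar, c ^ (α - 1 - σ / (1 - σ)) := by
    rw [integral_rpow_Ioo hcbar (by linarith)]
    exact div_pos (rpow_pos_of_pos hcbar _) (by linarith)
  have hWint : ∫ c in (0:ℝ)..cbar, W c * (α * c ^ (α - 1) / cbar ^ α) =
      (1 - σ) / σ * (∫ c in Ioo 0 cbar, c ^ (α - 1 - σ / (1 - σ))) * (α / cbar ^ α) := by
    rw [hconv, ← integral_const_mul]
    congr 1
    refine setIntegral_congr_fun measurableSet_Ioo fun c hc => ?_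
    simp only [hW]
    rw [mul_assoc, ← rpow_add hc.1]
    congr 2; ring
  have hVα : V α = (1 - σ) / σ * (1 + 1 / α) ^ (-(σ / (1 - σ))) *
      (∫ c in Ioo 0 cbar, c ^ (α - 1 - σ / (1 - σ))) * (α / cbar ^ α) := by
    rw [hV]
    refine IsGreatest.csSup_eq ⟨?_, ?_⟩
    · obtain ⟨A, hA⟩ : ∃ A, (1 + 1 / α) * A =
          (1 - σ) / σ * ((1 + 1 / α) * cbar) ^ (-(σ / (1 - σ))) :=
        ⟨_, mul_div_cancel₀ _ hk.ne'⟩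
      have hA0 : 0 ≤ A := by
        refine (mul_nonneg_iff_of_pos_left hk).1 ?_
        rw [hA]; positivity
      refine ⟨fun q => max 0 (q ^ σ / σ / (1 + 1 / α) - A),
        fun c => ((1 + 1 / α) * c) ^ (-(1 / (1 - σ))), ?_, fun q _ => le_max_left _ _,
        fun c hc => (isSmallestArgmaxOn_tariff hσ hk hA hc).2, ?_⟩
      · simp [zero_rpow hσ0.ne', hA0]
      · rw [hconv, ← integral_tariff_surplus hσ hcbar hα rfl hA]
        congr 1
        refine setIntegral_congr_fun measurableSet_Ioo fun c hc => ?_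
        simp only [hu, (isSmallestArgmaxOn_tariff hσ hk hA hc).1]
    · rintro v ⟨t, Q, ht0, ht, hQ, rfl⟩
      rw [hconv]
      refine mul_le_mul_of_nonneg_right ?_ hw.le
      by_cases hint : IntegrableOn (fun c => (u (Q c) - t (Q c)) * c ^ (α - 1)) (Ioo 0 cbar)
      · have e : (fun c => (u (Q c) - t (Q c)) * c ^ (α - 1)) =
            fun c => (Q c ^ σ / σ - c * Q c - (t (Q c) - c * Q c)) * c ^ (α - 1) := by
          ext c; rw [hu]; ring
        rw [e] at hint ⊢
        refine integral_buyer_surplus_le hσ hcbar hα (fun c hc => ?_) (fun c hc => (hQ c hc).1)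
          (fun c hc c' hc' => ?_) hint
        · simpa [ht0] using (hQ c hc).2.1 0 self_mem_Ici
        · have := (hQ c hc).2.1 (Q c') (hQ c' hc').1
          simp only at this
          linarith
      · rw [integral_undef hint]
        have := rpow_pos_of_pos hk (-(σ / (1 - σ)))
        positivity
  simp only [hVα, hWint]
  have hW0 := mul_pos (mul_pos (div_pos h1 hσ0) hI) hw
  rw [eq_div_iff hW0.ne']
  ring
end
end

section
/- Let σ ∈ (0,1), u(q) = q^σ/σ, c̄ > 0, and α > σ/(1−σ), and let F_α be the power distribution on [0,c̄] with CDF F_α(c) = (c/c̄)^α. Define the mechanism t_α(q) = max{ (α/(1+α)) u(q) − K_α , 0 } where K_α = ((1−σ)/σ) (α/(1+α))^{1/(1−σ)} c̄^{−σ/(1−σ)}. Then t_α is Bayes-optimal: for every mechanism t, ∫₀^{c̄} U(c,t_α) dF_α(c) ≥ ∫₀^{c̄} U(c,t) dF_α(c). Moreover, as α ↓ σ/(1−σ) and c̄ → ∞, t_α(q) converges pointwise to σ·u(q). -/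
open Real Set MeasureTheory

noncomputable section

lemma optimal_quantity_rpow {σ c : ℝ} (hc : 0 < c) :
    (c ^ (-(1 / (1 - σ)))) ^ σ = c ^ (-(σ / (1 - σ))) := by
  rw [← rpow_mul hc.le]
  congr 1
  ring

lemma mul_optimal_quantity {σ c : ℝ} (hσ1 : σ < 1) (hc : 0 < c) :
    c * c ^ (-(1 / (1 - σ))) = c ^ (-(σ / (1 - σ))) := by
  nth_rewrite 1 [← rpow_one c]
  rw [← rpow_add hc]
  congr 1
  have : 1 - σ ≠ 0 := by linarith
  field_simp
  ring

lemma power_utility_sub_optimal_quantity {σ c : ℝ} (hσ : σ ∈ Ioo (0 : ℝ) 1) (hc : 0 < c) :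
    (c ^ (-(1 / (1 - σ)))) ^ σ / σ - c * c ^ (-(1 / (1 - σ))) =
      (1 - σ) / σ * c ^ (-(σ / (1 - σ))) := by
  rw [optimal_quantity_rpow hc, mul_optimal_quantity hσ.2 hc]
  have := hσ.1.ne'
  field_simp

lemma power_utility_sub_lt {σ c q : ℝ} (hσ : σ ∈ Ioo (0 : ℝ) 1) (hc : 0 < c) (hq : 0 ≤ q)
    (hne : q ≠ c ^ (-(1 / (1 - σ)))) :
    q ^ σ / σ - c * q < (1 - σ) / σ * c ^ (-(σ / (1 - σ))) := by
  rw [← power_utility_sub_optimal_quantity hσ hc]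
  have h1 := optimal_quantity_rpow (σ := σ) hc
  have h2 := mul_optimal_quantity hσ.2 hc
  have hq0 : 0 < c ^ (-(1 / (1 - σ))) := rpow_pos_of_pos hc _
  set q₀ := c ^ (-(1 / (1 - σ))) with hq₀
  have hσ0 := hσ.1
  have hb : (1 + (q / q₀ - 1)) ^ σ < 1 + σ * (q / q₀ - 1) := by
    apply rpow_one_add_lt_one_add_mul_self _ _ hσ.1 hσ.2
    · have : 0 ≤ q / q₀ := by positivity
      linarith
    · intro h
      apply hne
      field_simp at h
      linarith
  rw [add_sub_cancel, div_rpow hq hq0.le, div_lt_iff₀ (by positivity)] at hb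
  have h3 : (1 + σ * (q / q₀ - 1)) * q₀ ^ σ = q₀ ^ σ + σ * (c * q - c * q₀) := by
    rw [h1, ← h2]
    field_simp
  rw [h3] at hb
  have h4 : q ^ σ / σ < (q₀ ^ σ + σ * (c * q - c * q₀)) / σ := by gcongr
  rw [add_div, mul_div_cancel_left₀ _ hσ0.ne'] at h4
  linarith

lemma power_utility_sub_le {σ c q : ℝ} (hσ : σ ∈ Ioo (0 : ℝ) 1) (hc : 0 < c) (hq : 0 ≤ q) :
    q ^ σ / σ - c * q ≤ (1 - σ) / σ * c ^ (-(σ / (1 - σ))) := by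
  by_cases hne : q = c ^ (-(1 / (1 - σ)))
  · rw [hne, power_utility_sub_optimal_quantity hσ hc]
  · exact (power_utility_sub_lt hσ hc hq hne).le

section Envelope

variable {p Q : ℝ → ℝ} {B : ℝ}

lemma antitoneOn_of_subgradient {s : Set ℝ}
    (h : ∀ x ∈ s, ∀ y ∈ s, p y - Q y * (x - y) ≤ p x) : AntitoneOn Q s := by
  intro x hx y hy hxy
  rcases hxy.eq_or_lt with rfl | hlt
  · rfl
  · have h1 := h x hx y hy
    have h2 := h y hy x hx
    by_contra! hc
    nlinarith [mul_pos (sub_pos.2 hlt) (sub_pos.2 hc)]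

lemma convexOn_of_subgradient_s3 {s : Set ℝ} (hs : Convex ℝ s)
    (h : ∀ x ∈ s, ∀ y ∈ s, p y - Q y * (x - y) ≤ p x) : ConvexOn ℝ s p := by
  refine ⟨hs, fun x hx y hy a b ha hb hab => ?_⟩
  have hz := hs hx hy ha hb hab
  simp only [smul_eq_mul] at hz ⊢
  set z := a * x + b * y with hzdef
  have h1 := mul_le_mul_of_nonneg_left (h x hx z hz) ha
  have h2 := mul_le_mul_of_nonneg_left (h y hy z hz) hb
  have h3 : a * (p z - Q z * (x - z)) + b * (p z - Q z * (y - z)) = p z := by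
    have hb' : b = 1 - a := by linarith
    rw [hzdef]
    subst hb'
    ring
  linarith

lemma hasDerivAt_of_subgradient {s : Set ℝ} {x : ℝ} (hs : s ∈ nhds x)
    (h : ∀ x ∈ s, ∀ y ∈ s, p y - Q y * (x - y) ≤ p x) (hQ : ContinuousAt Q x) :
    HasDerivAt p (-Q x) x := by
  rw [hasDerivAt_iff_isLittleO, Asymptotics.isLittleO_iff]
  intro ε hε
  have hx := mem_of_mem_nhds hs
  filter_upwards [hs, Metric.continuousAt_iff'.1 hQ ε hε] with y hy hQy
  have h1 := h x hx y hy
  have h2 := h y hy x hx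
  rw [Real.dist_eq] at hQy
  have h3 : |p y - p x - (y - x) • -Q x| ≤ |(Q y - Q x) * (y - x)| := by
    rw [smul_eq_mul, abs_of_nonneg (by linarith)]
    refine le_trans ?_ (neg_le_abs _)
    linarith
  rw [abs_mul] at h3
  exact h3.trans (mul_le_mul_of_nonneg_right hQy.le (abs_nonneg _))

lemma continuousOn_of_subgradient {s : Set ℝ} (hs : Convex ℝ s) (hso : IsOpen s)
    (h : ∀ x ∈ s, ∀ y ∈ s, p y - Q y * (x - y) ≤ p x) : ContinuousOn p s :=
  (convexOn_of_subgradient_s3 hs h).continuousOn hso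

lemma intervalIntegrable_weighted_envelope {α a b : ℝ} (ha : 0 < a) (hab : a ≤ b) (hb : b < B)
    (h : ∀ x ∈ Ioo 0 B, ∀ y ∈ Ioo 0 B, p y - Q y * (x - y) ≤ p x) :
    IntervalIntegrable (fun c => α * c ^ (α - 1) * p c - c ^ α * Q c) volume a b := by
  have hsub : uIcc a b ⊆ Ioo 0 B := by
    rw [uIcc_of_le hab]
    exact fun x hx => ⟨ha.trans_le hx.1, hx.2.trans_lt hb⟩
  have hpow : ∀ e : ℝ, ContinuousOn (fun c : ℝ => c ^ e) (uIcc a b) := fun e =>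
    continuousOn_id.rpow_const fun x hx => Or.inl (hsub hx).1.ne'
  have hp : ContinuousOn p (uIcc a b) :=
    (continuousOn_of_subgradient (convex_Ioo 0 B) isOpen_Ioo h).mono hsub
  have hQ : IntervalIntegrable Q volume a b :=
    ((antitoneOn_of_subgradient h).mono hsub).intervalIntegrable
  exact ((continuousOn_const.mul (hpow _)).mul hp).intervalIntegrable.sub
    (hQ.continuousOn_mul (hpow _))

lemma integral_weighted_envelope {α a b : ℝ} (ha : 0 < a) (hab : a ≤ b) (hb : b < B)
    (h : ∀ x ∈ Ioo 0 B, ∀ y ∈ Ioo 0 B, p y - Q y * (x - y) ≤ p x) :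
    ∫ c in a..b, (α * c ^ (α - 1) * p c - c ^ α * Q c) = b ^ α * p b - a ^ α * p a := by
  have hsub : Icc a b ⊆ Ioo 0 B := fun x hx => ⟨ha.trans_le hx.1, hx.2.trans_lt hb⟩
  refine integral_eq_of_hasDerivAt_off_countable_of_le (fun c => c ^ α * p c) _ hab
    (antitoneOn_of_subgradient h).countable_not_continuousWithinAt ?_ ?_
    (intervalIntegrable_weighted_envelope ha hab hb h)
  · exact (continuousOn_id.rpow_const fun x hx => Or.inl (hsub hx).1.ne').mul
      ((continuousOn_of_subgradient (convex_Ioo 0 B) isOpen_Ioo h).mono hsub)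
  · rintro x ⟨hx, hxc⟩
    have hx' := hsub (Ioo_subset_Icc_self hx)
    have hnhds : Ioo 0 B ∈ nhds x := isOpen_Ioo.mem_nhds hx'
    have hQ : ContinuousAt Q x := by
      by_contra hcon
      exact hxc ⟨hx', fun hw => hcon (hw.continuousAt hnhds)⟩
    refine ((hasDerivAt_rpow_const (p := α) (Or.inl hx'.1.ne')).mul
      (hasDerivAt_of_subgradient hnhds h hQ)).congr_deriv ?_
    ring

end Envelope

lemma intervalIntegrable_rpow_mul_weight {α r k b : ℝ} (hα : r < α) (hb : 0 ≤ b) :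
    IntervalIntegrable (fun c : ℝ => k * c ^ (-r) * (α * c ^ (α - 1))) volume 0 b := by
  have h1 : IntervalIntegrable (fun c : ℝ => k * α * c ^ (α - 1 - r)) volume 0 b :=
    (intervalIntegral.intervalIntegrable_rpow' (by linarith)).const_mul _
  refine h1.congr fun c hc => ?_
  rw [uIoc_of_le hb] at hc
  rw [sub_eq_add_neg _ r, rpow_add hc.1]
  ring

lemma integral_rpow_mul_weight {α r k b : ℝ} (hα : r < α) (hb : 0 < b) :
    ∫ c in (0 : ℝ)..b, k * c ^ (-r) * (α * c ^ (α - 1)) =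
      k * α * (b ^ (α - r) / (α - r)) := by
  have h1 : ∫ c in (0 : ℝ)..b, k * c ^ (-r) * (α * c ^ (α - 1)) =
      ∫ c in (0 : ℝ)..b, k * α * c ^ (α - 1 - r) := by
    refine intervalIntegral.integral_congr_Ioo_of_le hb.le fun c hc => ?_
    rw [sub_eq_add_neg _ r, rpow_add hc.1]
    ring
  rw [h1, intervalIntegral.integral_const_mul, integral_rpow (Or.inl (by linarith)),
    show α - 1 - r + 1 = α - r by ring, zero_rpow (by linarith), sub_zero]

/-- The expected surplus under any incentive-compatible supply `Q` with profit `p` is at most the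
expected maximal virtual surplus. -/
lemma integral_surplus_le {σ α B : ℝ} (hσ : σ ∈ Ioo (0 : ℝ) 1) (hB : 0 < B)
    (hα : σ / (1 - σ) < α) {p Q U : ℝ → ℝ}
    (h : ∀ x ∈ Ioo 0 B, ∀ y ∈ Ioo 0 B, p y - Q y * (x - y) ≤ p x)
    (hp : ∀ c ∈ Ioo 0 B, 0 ≤ p c) (hQ : ∀ c ∈ Ioo 0 B, 0 ≤ Q c)
    (hU : ∀ c ∈ Ioo 0 B, U c = Q c ^ σ / σ - c * Q c - p c)
    (hint : IntervalIntegrable (fun c => U c * (α * c ^ (α - 1))) volume 0 B) :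
    ∫ c in (0 : ℝ)..B, U c * (α * c ^ (α - 1)) ≤
      ∫ c in (0 : ℝ)..B, (1 - σ) / σ * (α / (1 + α)) ^ (σ / (1 - σ)) * c ^ (-(σ / (1 - σ))) *
        (α * c ^ (α - 1)) := by
  set r := σ / (1 - σ) with hr
  have hr0 : 0 < r := div_pos hσ.1 (sub_pos.2 hσ.2)
  have hα0 : 0 < α := hr0.trans hα
  have hvirt : ∀ c ∈ Ioo 0 B, U c * (α * c ^ (α - 1)) ≤
      (1 - σ) / σ * (α / (1 + α)) ^ r * c ^ (-r) * (α * c ^ (α - 1)) -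
        (α * c ^ (α - 1) * p c - c ^ α * Q c) := by
    intro c hc
    have hc0 := hc.1
    have h1 := power_utility_sub_le hσ (c := c * (α / (1 + α))⁻¹) (by positivity) (hQ c hc)
    rw [← hr, mul_rpow hc.1.le (by positivity), inv_rpow (by positivity),
      ← rpow_neg (by positivity), neg_neg] at h1
    have h2 : c ^ α = c * c ^ (α - 1) := by
      rw [rpow_sub_one hc.1.ne']
      field_simp
    rw [hU c hc, h2]
    have h3 : (0 : ℝ) < α * c ^ (α - 1) := by positivity
    have h4 := mul_le_mul_of_nonneg_right h1 h3.le
    have h5 : (Q c ^ σ / σ - c * (α / (1 + α))⁻¹ * Q c) * (α * c ^ (α - 1)) =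
        (Q c ^ σ / σ - c * Q c) * (α * c ^ (α - 1)) - c * c ^ (α - 1) * Q c := by
      field_simp
      ring
    rw [h5] at h4
    linarith
  have hWint := intervalIntegrable_rpow_mul_weight (k := (1 - σ) / σ * (α / (1 + α)) ^ r) hα hB.le
  have hPint : IntervalIntegrable (fun c => p c * (α * c ^ (α - 1))) volume 0 B := by
    have hV := (intervalIntegrable_rpow_mul_weight (k := (1 - σ) / σ) hα hB.le).sub hint
    rw [intervalIntegrable_iff_integrableOn_Ioo_of_le hB.le] at hV ⊢
    refine Integrable.mono' hV ?_ ?_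
    · refine ContinuousOn.aestronglyMeasurable ?_ measurableSet_Ioo
      exact (continuousOn_of_subgradient (convex_Ioo 0 B) isOpen_Ioo h).mul
        (continuousOn_const.mul (continuousOn_id.rpow_const fun x hx => Or.inl hx.1.ne'))
    · refine (ae_restrict_iff' measurableSet_Ioo).2 (Filter.Eventually.of_forall fun c hc => ?_)
      have hc0 := hc.1
      have h3 : (0 : ℝ) < α * c ^ (α - 1) := by positivity
      rw [Real.norm_of_nonneg (mul_nonneg (hp c hc) h3.le)]
      have h1 := power_utility_sub_le hσ hc.1 (hQ c hc)
      rw [hU c hc, ← sub_mul]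
      exact mul_le_mul_of_nonneg_right (by linarith) h3.le
  have hsubint : ∀ {f : ℝ → ℝ} {a b : ℝ}, IntervalIntegrable f volume 0 B → 0 ≤ a → a ≤ b →
      b ≤ B → IntervalIntegrable f volume a b := by
    intro f a b hf ha hab hb
    refine hf.mono_set ?_
    rw [uIcc_of_le hab, uIcc_of_le hB.le]
    exact Icc_subset_Icc ha hb
  have hDint := hWint.sub hint
  have htail : ∀ a ∈ Ioo 0 B, a ^ α * p a ≤ ∫ c in (0 : ℝ)..a, p c * (α * c ^ (α - 1)) := by
    intro a ha
    have h1 : a ^ α * p a = ∫ c in (0 : ℝ)..a, p a * (α * c ^ (α - 1)) := by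
      have := integral_rpow_mul_weight (r := 0) (k := p a) hα0 ha.1
      simp only [neg_zero, rpow_zero, mul_one, sub_zero] at this
      rw [this]
      field_simp
    rw [h1]
    refine intervalIntegral.integral_mono_on_of_le_Ioo ha.1.le ?_
      (hsubint hPint le_rfl ha.1.le ha.2.le) fun c hc => ?_
    · simpa using intervalIntegrable_rpow_mul_weight (r := 0) (k := p a) hα0 ha.1.le
    · have hc' : c ∈ Ioo 0 B := ⟨hc.1, hc.2.trans ha.2⟩
      have hc0 := hc.1
      have h2 := h c hc' a ha
      have h3 := mul_nonneg (hQ a ha) (sub_nonneg.2 hc.2.le)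
      exact mul_le_mul_of_nonneg_right (by linarith) (by positivity)
  have hkey : ∀ a b, 0 < a → a ≤ b → b < B → 0 ≤
      (∫ c in a..b, ((1 - σ) / σ * (α / (1 + α)) ^ r * c ^ (-r) * (α * c ^ (α - 1)) -
        U c * (α * c ^ (α - 1)))) + ∫ c in (0 : ℝ)..a, p c * (α * c ^ (α - 1)) := by
    intro a b ha hab hb
    have h1 := integral_weighted_envelope (α := α) ha hab hb h
    have h2 := intervalIntegral.integral_mono_on_of_le_Ioo hab
      (intervalIntegrable_weighted_envelope (α := α) ha hab hb h)
      (hsubint hDint ha.le hab hb.le) fun c hc => by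
        have := hvirt c ⟨ha.trans hc.1, hc.2.trans hb⟩
        linarith
    have h3 := htail a ⟨ha, hab.trans_lt hb⟩
    have h4 : 0 ≤ b ^ α * p b :=
      mul_nonneg (rpow_nonneg (ha.le.trans hab) _) (hp b ⟨ha.trans_le hab, hb⟩)
    linarith
  have hprim : ∀ {f : ℝ → ℝ}, IntervalIntegrable f volume 0 B →
      ContinuousOn (fun x => ∫ c in (0 : ℝ)..x, f c) (Icc 0 B) := by
    intro f hf
    have := intervalIntegral.continuousOn_primitive_interval (μ := volume) (f := f) (a := 0)
      (b := B) (by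
        rw [uIcc_of_le hB.le]
        exact (intervalIntegrable_iff_integrableOn_Icc_of_le hB.le).1 hf)
    rwa [uIcc_of_le hB.le] at this
  rw [← sub_nonneg, ← intervalIntegral.integral_sub hWint hint]
  have hH := hprim hDint
  have hPi := hprim hPint
  have hright : ∀ a ∈ Ioo 0 B, 0 ≤
      (∫ c in (0 : ℝ)..B, ((1 - σ) / σ * (α / (1 + α)) ^ r * c ^ (-r) * (α * c ^ (α - 1)) -
        U c * (α * c ^ (α - 1)))) -
      (∫ c in (0 : ℝ)..a, ((1 - σ) / σ * (α / (1 + α)) ^ r * c ^ (-r) * (α * c ^ (α - 1)) -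
        U c * (α * c ^ (α - 1)))) + ∫ c in (0 : ℝ)..a, p c * (α * c ^ (α - 1)) := by
    intro a ha
    have hlim := ((hH B ⟨hB.le, le_rfl⟩).mono_left
      (nhdsWithin_mono B (show Ioo a B ⊆ Icc 0 B from
        fun x hx => ⟨ha.1.le.trans hx.1.le, hx.2.le⟩)))
    have : (nhdsWithin B (Ioo a B)).NeBot := by
      rw [nhdsWithin_Ioo_eq_nhdsLT ha.2]
      infer_instance
    refine ge_of_tendsto ((hlim.sub_const _).add_const _) ?_
    filter_upwards [self_mem_nhdsWithin] with b hb
    have h1 := hkey a b ha.1 hb.1.le hb.2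
    rwa [← intervalIntegral.integral_interval_sub_left
      (hsubint hDint le_rfl (ha.1.le.trans hb.1.le) hb.2.le)
      (hsubint hDint le_rfl ha.1.le ha.2.le)] at h1
  have hsub0 := nhdsWithin_mono (0 : ℝ) (Ioo_subset_Icc_self : Ioo 0 B ⊆ Icc 0 B)
  have hlim := (((hH 0 ⟨le_rfl, hB.le⟩).mono_left hsub0).const_sub
    (∫ c in (0 : ℝ)..B, ((1 - σ) / σ * (α / (1 + α)) ^ r * c ^ (-r) * (α * c ^ (α - 1)) -
        U c * (α * c ^ (α - 1))))).add ((hPi 0 ⟨le_rfl, hB.le⟩).mono_left hsub0)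
  have : (nhdsWithin (0 : ℝ) (Ioo 0 B)).NeBot := by
    rw [nhdsWithin_Ioo_eq_nhdsGT hB]
    infer_instance
  have hfin := ge_of_tendsto hlim (by
    filter_upwards [self_mem_nhdsWithin] with a ha
    exact hright a ha)
  simpa using hfin

lemma mul_inv_rpow_neg {β c r : ℝ} (hβ : 0 < β) (hc : 0 < c) :
    (c * β⁻¹) ^ (-r) = β ^ r * c ^ (-r) := by
  rw [mul_rpow hc.le (by positivity), inv_rpow hβ.le, ← rpow_neg hβ.le, neg_neg, mul_comm]

lemma rpow_one_div_one_sub {σ β : ℝ} (hσ : σ < 1) (hβ : 0 < β) :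
    β ^ (1 / (1 - σ)) = β * β ^ (σ / (1 - σ)) := by
  nth_rewrite 2 [← rpow_one β]
  rw [← rpow_add hβ]
  congr 1
  have : 1 - σ ≠ 0 := by linarith
  field_simp
  ring

/-- The supply induced by a truncated share of the buyer's utility, for costs below the cutoff. -/
lemma supply_of_truncated_share {σ β B c q : ℝ} (hσ : σ ∈ Ioo (0 : ℝ) 1) (hβ : 0 < β)
    (hc : c ∈ Ioo 0 B)
    (hq : IsSmallestArgmaxOn (fun q => max (β * (q ^ σ / σ) -
      (1 - σ) / σ * β ^ (1 / (1 - σ)) * B ^ (-(σ / (1 - σ)))) 0 - c * q) (Ici 0) q) :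
    q = (c * β⁻¹) ^ (-(1 / (1 - σ))) ∧
      0 ≤ β * (q ^ σ / σ) - (1 - σ) / σ * β ^ (1 / (1 - σ)) * B ^ (-(σ / (1 - σ))) := by
  have hc0 := hc.1
  have hcβ : 0 < c * β⁻¹ := by positivity
  have hr0 : 0 < σ / (1 - σ) := div_pos hσ.1 (sub_pos.2 hσ.2)
  obtain ⟨hq0, hmax, -⟩ := hq
  have h1 := power_utility_sub_optimal_quantity hσ hcβ
  have h2 := hmax ((c * β⁻¹) ^ (-(1 / (1 - σ)))) (rpow_nonneg hcβ.le _)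
  have hlt : B ^ (-(σ / (1 - σ))) < c ^ (-(σ / (1 - σ))) :=
    rpow_lt_rpow_of_neg hc.1 hc.2 (by linarith)
  have hcoef : 0 < (1 - σ) / σ * (β * β ^ (σ / (1 - σ))) := by
    have := div_pos (sub_pos.2 hσ.2) hσ.1
    positivity
  have h3 := mul_lt_mul_of_pos_left hlt hcoef
  rw [rpow_one_div_one_sub hσ.2 hβ] at h2 ⊢
  rw [mul_inv_rpow_neg (r := σ / (1 - σ)) hβ hc.1] at h1
  have h4 : β * (((c * β⁻¹) ^ (-(1 / (1 - σ)))) ^ σ / σ) - c * (c * β⁻¹) ^ (-(1 / (1 - σ))) =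
      (1 - σ) / σ * (β * β ^ (σ / (1 - σ))) * c ^ (-(σ / (1 - σ))) := by
    linear_combination β * h1 + c * (c * β⁻¹) ^ (-(1 / (1 - σ))) * mul_inv_cancel₀ hβ.ne'
  have h5 := le_max_left (β * (((c * β⁻¹) ^ (-(1 / (1 - σ)))) ^ σ / σ) -
    (1 - σ) / σ * (β * β ^ (σ / (1 - σ))) * B ^ (-(σ / (1 - σ)))) 0
  have hcq : 0 ≤ c * q := mul_nonneg hc.1.le hq0
  have hpos : 0 ≤ β * (q ^ σ / σ) -
      (1 - σ) / σ * (β * β ^ (σ / (1 - σ))) * B ^ (-(σ / (1 - σ))) := by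
    by_contra! hneg
    simp only [max_eq_right hneg.le] at h2
    linarith
  refine ⟨?_, hpos⟩
  by_contra hne
  have h6 := power_utility_sub_lt hσ hcβ hq0 hne
  rw [mul_inv_rpow_neg (r := σ / (1 - σ)) hβ hc.1] at h6
  have h7 := mul_lt_mul_of_pos_left h6 hβ
  have h8 : β * (q ^ σ / σ - c * β⁻¹ * q) = β * (q ^ σ / σ) - c * q := by
    field_simp
  simp only [max_eq_left hpos] at h2
  linarith

lemma tendsto_truncated_share {σ v : ℝ} (hσ : σ ∈ Ioo (0 : ℝ) 1) (hv : 0 ≤ v) :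
    Filter.Tendsto (fun x : ℝ × ℝ => max (x.1 / (1 + x.1) * v -
        (1 - σ) / σ * (x.1 / (1 + x.1)) ^ (1 / (1 - σ)) * x.2 ^ (-(σ / (1 - σ)))) 0)
      ((nhdsWithin (σ / (1 - σ)) (Ioi (σ / (1 - σ)))) ×ˢ Filter.atTop) (nhds (σ * v)) := by
  have h1σ : 0 < 1 - σ := sub_pos.2 hσ.2
  have hr0 : 0 < σ / (1 - σ) := div_pos hσ.1 h1σ
  have hshare : Filter.Tendsto (fun a : ℝ => a / (1 + a))
      (nhdsWithin (σ / (1 - σ)) (Ioi (σ / (1 - σ)))) (nhds σ) := by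
    have hc : ContinuousAt (fun a : ℝ => a / (1 + a)) (σ / (1 - σ)) :=
      continuousAt_id.div (continuousAt_const.add continuousAt_id) (by positivity)
    have hval : σ / (1 - σ) / (1 + σ / (1 - σ)) = σ := by
      field_simp
      ring
    have := hc.tendsto.mono_left (nhdsWithin_le_nhds (s := Ioi (σ / (1 - σ))))
    rwa [hval] at this
  have hfst := hshare.comp (Filter.tendsto_fst
    (f := nhdsWithin (σ / (1 - σ)) (Ioi (σ / (1 - σ)))) (g := (Filter.atTop : Filter ℝ)))
  have hsnd := (tendsto_rpow_neg_atTop hr0).comp (Filter.tendsto_snd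
    (f := nhdsWithin (σ / (1 - σ)) (Ioi (σ / (1 - σ)))) (g := (Filter.atTop : Filter ℝ)))
  have h := ((hfst.mul_const v).sub (((hfst.rpow_const (p := 1 / (1 - σ))
    (Or.inl hσ.1.ne')).const_mul ((1 - σ) / σ)).mul hsnd)).max
    (tendsto_const_nhds (x := (0 : ℝ)))
  rw [mul_zero, sub_zero, max_eq_left (mul_nonneg hσ.1.le hv)] at h
  exact h

/-- The expected surplus under the truncated share equals the maximal virtual surplus. -/
lemma integral_truncated_share_surplus {σ α B : ℝ} (hσ : σ ∈ Ioo (0 : ℝ) 1) (hB : 0 < B)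
    (hα : σ / (1 - σ) < α) :
    ∫ c in (0 : ℝ)..B, ((1 - α / (1 + α)) / σ * (α / (1 + α)) ^ (σ / (1 - σ)) *
        c ^ (-(σ / (1 - σ))) + (1 - σ) / σ * (α / (1 + α)) ^ (1 / (1 - σ)) *
        B ^ (-(σ / (1 - σ)))) * (α * c ^ (α - 1)) =
      ∫ c in (0 : ℝ)..B, (1 - σ) / σ * (α / (1 + α)) ^ (σ / (1 - σ)) * c ^ (-(σ / (1 - σ))) *
        (α * c ^ (α - 1)) := by
  have h1σ : 0 < 1 - σ := sub_pos.2 hσ.2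
  have hσ0 := hσ.1
  have hr0 : 0 < σ / (1 - σ) := div_pos hσ.1 h1σ
  have hα0 : 0 < α := hr0.trans hα
  set K := (1 - σ) / σ * (α / (1 + α)) ^ (1 / (1 - σ)) * B ^ (-(σ / (1 - σ))) with hK
  have hc := integral_rpow_mul_weight (r := 0) (k := K) hα0 hB
  have hci := intervalIntegrable_rpow_mul_weight (r := 0) (k := K) hα0 hB.le
  simp only [neg_zero, rpow_zero, mul_one, sub_zero] at hc hci
  simp only [add_mul]
  rw [intervalIntegral.integral_add (intervalIntegrable_rpow_mul_weight hα hB.le) hci, hc,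
    integral_rpow_mul_weight hα hB, integral_rpow_mul_weight hα hB, hK,
    rpow_one_div_one_sub hσ.2 (by positivity), rpow_sub hB, rpow_neg hB.le]
  have hαr : α - σ / (1 - σ) ≠ 0 := by linarith
  have hBα := (rpow_pos_of_pos hB α).ne'
  have hBr := (rpow_pos_of_pos hB (σ / (1 - σ))).ne'
  have hαr' : α * (1 - σ) - σ ≠ 0 := by
    intro h
    apply hαr
    field_simp
    linarith
  generalize B ^ (σ / (1 - σ)) = X at *
  generalize B ^ α = Y at *
  generalize (α / (1 + α)) ^ (σ / (1 - σ)) = Z at *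
  field_simp
  ring

/-- Proposition 3: the Bayes-optimal mechanism for the power
distribution `F_α` on `[0,c̄]`.  The mechanism
`t_α(q) = max{(α/(1+α)) u(q) − K_α, 0}` with
`K_α = ((1−σ)/σ)(α/(1+α))^{1/(1−σ)} c̄^{−σ/(1−σ)}` is Bayes-optimal: it yields a weakly
larger expected buyer surplus than any other mechanism; and as `α ↓ σ/(1−σ)` and
`c̄ → ∞` jointly, `t_α(q)` converges pointwise to `σ·u(q)`. -/
theorem stmt_3 (σ cbar α : ℝ) (hσ : σ ∈ Ioo (0:ℝ) 1) (hcbar : 0 < cbar)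
    (hα : σ / (1 - σ) < α)
    (u : ℝ → ℝ) (hu : ∀ q, u q = q ^ σ / σ)
    (tα : ℝ → ℝ → ℝ → ℝ)
    (htα : ∀ a cb q, tα a cb q =
      max ((a / (1 + a)) * u q -
        ((1 - σ) / σ) * (a / (1 + a)) ^ (1 / (1 - σ)) * cb ^ (-(σ / (1 - σ)))) 0)
    (Qα : ℝ → ℝ)
    (hQα : ∀ c ∈ Ioo (0:ℝ) cbar,
      IsSmallestArgmaxOn (fun q => tα α cbar q - c * q) (Ici 0) (Qα c)) :
    (∀ t Q : ℝ → ℝ, t 0 = 0 → (∀ q ≥ (0:ℝ), 0 ≤ t q) →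
      (∀ c ∈ Ioo (0:ℝ) cbar, IsSmallestArgmaxOn (fun q => t q - c * q) (Ici 0) (Q c)) →
      (∫ c in (0:ℝ)..cbar, (u (Q c) - t (Q c)) * (α * c ^ (α - 1) / cbar ^ α)) ≤
        ∫ c in (0:ℝ)..cbar, (u (Qα c) - tα α cbar (Qα c)) * (α * c ^ (α - 1) / cbar ^ α)) ∧
    (∀ q ≥ (0:ℝ), Filter.Tendsto (fun p : ℝ × ℝ => tα p.1 p.2 q)
      ((nhdsWithin (σ / (1 - σ)) (Ioi (σ / (1 - σ)))) ×ˢ Filter.atTop)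
      (nhds (σ * u q))) := by
  have h1σ : 0 < 1 - σ := sub_pos.2 hσ.2
  have hr0 : 0 < σ / (1 - σ) := div_pos hσ.1 h1σ
  have hα0 : 0 < α := hr0.trans hα
  have hσ0 := hσ.1
  have hopt : ∫ c in (0 : ℝ)..cbar,
        (u (Qα c) - tα α cbar (Qα c)) * (α * c ^ (α - 1) / cbar ^ α) =
      (∫ c in (0 : ℝ)..cbar, (1 - σ) / σ * (α / (1 + α)) ^ (σ / (1 - σ)) *
        c ^ (-(σ / (1 - σ))) * (α * c ^ (α - 1))) / cbar ^ α := by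
    rw [← integral_truncated_share_surplus hσ hcbar hα, ← intervalIntegral.integral_div]
    refine intervalIntegral.integral_congr_Ioo_of_le hcbar.le fun c hc => ?_
    have hq := hQα c hc
    simp only [htα, hu] at hq ⊢
    have hβ : 0 < α / (1 + α) := by positivity
    obtain ⟨hqc, hpos⟩ := supply_of_truncated_share hσ hβ hc hq
    have hc0 := hc.1
    have hqσ : Qα c ^ σ = (α / (1 + α)) ^ (σ / (1 - σ)) * c ^ (-(σ / (1 - σ))) := by
      rw [hqc, optimal_quantity_rpow (by positivity), mul_inv_rpow_neg hβ hc0]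
    rw [max_eq_left hpos, hqσ]
    ring
  refine ⟨fun t Q ht0 ht hQ => ?_, fun q hq => ?_⟩
  · rw [hopt]
    have hdiv : ∀ c, (u (Q c) - t (Q c)) * (α * c ^ (α - 1) / cbar ^ α) =
        (u (Q c) - t (Q c)) * (α * c ^ (α - 1)) / cbar ^ α := fun c => (mul_div_assoc _ _ _).symm
    simp only [hdiv]
    rw [intervalIntegral.integral_div]
    refine div_le_div_of_nonneg_right ?_ (rpow_nonneg hcbar.le _)
    by_cases hint : IntervalIntegrable
        (fun c => (u (Q c) - t (Q c)) * (α * c ^ (α - 1))) volume 0 cbar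
    · refine integral_surplus_le (p := fun c => t (Q c) - c * Q c) (Q := Q)
        hσ hcbar hα ?_ ?_ (fun c hc => (hQ c hc).1) ?_ hint
      · intro x hx y hy
        have := (hQ x hx).2.1 (Q y) (hQ y hy).1
        simp only at this ⊢
        linarith
      · intro c hc
        have := (hQ c hc).2.1 0 self_mem_Ici
        simpa [ht0] using this
      · intro c _
        rw [hu]
        ring
    · rw [intervalIntegral.integral_undef hint]
      refine intervalIntegral.integral_nonneg hcbar.le fun c hc => ?_
      have hc0 := hc.1
      positivity
  · simp only [htα]
    exact tendsto_truncated_share hσ (by rw [hu]; positivity)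
end
end

section
/- Let σ ∈ (0,1) and u(q) = q^σ/σ. For every mechanism t, the infimum over all cost functions c ∈ C_cx of the buyer surplus ratio U(c,t)/W(c) is at most B(σ); moreover this infimum equals B(σ) if and only if t(q) = z*(σ)·u(q) for all q. -/
open Real Set

noncomputable section

/-- The class `C_cx` of admissible cost functions: nonnegative on `[0,∞)`, nondecreasing,
convex, vanishing at `0`, and not identically zero. -/
def CostCcx (c : ℝ → ℝ) : Prop :=
  (∀ q ≥ (0:ℝ), 0 ≤ c q) ∧ MonotoneOn c (Ici 0) ∧ ConvexOn ℝ (Ici 0) c ∧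
    c 0 = 0 ∧ ∃ q ≥ (0:ℝ), c q ≠ 0

/-- The convex cost function that vanishes up to `a` and has slope `p` afterwards. -/
def kinkedCost (a p : ℝ) (x : ℝ) : ℝ := p * max (x - a) 0

lemma costCcx_kinkedCost {a p : ℝ} (ha : 0 ≤ a) (hp : 0 < p) : CostCcx (kinkedCost a p) := by
  refine ⟨fun q _ => ?_, fun x _ y _ hxy => ?_, ⟨convex_Ici 0, fun x _ y _ m n hm hn hmn => ?_⟩,
    ?_, a + 1, by linarith, ?_⟩
  · exact mul_nonneg hp.le (le_max_right _ _)
  · unfold kinkedCost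
    gcongr
  · simp only [kinkedCost, smul_eq_mul]
    have h : max (m * x + n * y - a) 0 ≤ m * max (x - a) 0 + n * max (y - a) 0 := by
      have h1 := mul_le_mul_of_nonneg_left (le_max_left (x - a) 0) hm
      have h2 := mul_le_mul_of_nonneg_left (le_max_left (y - a) 0) hn
      refine max_le ?_ (by positivity)
      have h3 : a = m * a + n * a := by rw [← add_mul, hmn, one_mul]
      linarith
    have h1 := mul_le_mul_of_nonneg_left h hp.le
    linarith
  · simp [kinkedCost, ha]
  · simp [kinkedCost, hp.ne']

/-- Young's inequality for the isoelastic utility, at the price `b ^ (σ - 1)`. -/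
lemma rpow_div_le_young {σ x b : ℝ} (hσ0 : 0 < σ) (hσ1 : σ < 1) (hx : 0 ≤ x) (hb : 0 < b) :
    x ^ σ / σ ≤ b ^ (σ - 1) * x + (1 - σ) / σ * b ^ σ := by
  have h := Real.geom_mean_le_arith_mean2_weighted hσ0.le (sub_nonneg.2 hσ1.le) hx hb.le
    (by ring)
  have h1 : b ^ (1 - σ) * b ^ (σ - 1) = 1 := by
    rw [← rpow_add hb]; simp
  have h2 : b * b ^ (σ - 1) = b ^ σ := by
    rw [mul_comm, ← rpow_add_one hb.ne']; simp
  have h3 := mul_le_mul_of_nonneg_right h (rpow_pos_of_pos hb (σ - 1)).le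
  rw [mul_assoc, h1, mul_one, add_mul, mul_assoc (1 - σ), h2] at h3
  rw [div_le_iff₀ hσ0]
  have h4 : (b ^ (σ - 1) * x + (1 - σ) / σ * b ^ σ) * σ =
      σ * x * b ^ (σ - 1) + (1 - σ) * b ^ σ := by
    field_simp
  rwa [h4]

lemma bddAbove_surplus_kinkedCost {σ a b : ℝ} (hσ0 : 0 < σ) (hσ1 : σ < 1) (hb : 0 < b) :
    BddAbove {x | ∃ q ≥ (0:ℝ), x = q ^ σ / σ - kinkedCost a (b ^ (σ - 1)) q} := by
  refine ⟨b ^ (σ - 1) * a + (1 - σ) / σ * b ^ σ, ?_⟩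
  rintro _ ⟨q, hq, rfl⟩
  have h := rpow_div_le_young hσ0 hσ1 hq hb
  have h1 := mul_le_mul_of_nonneg_left (le_max_left (q - a) 0) (rpow_pos_of_pos hb (σ - 1)).le
  unfold kinkedCost
  linarith

lemma le_surplus_kinkedCost_of_le {σ a b : ℝ} (hσ0 : 0 < σ) (hσ1 : σ < 1) (hb : 0 < b)
    (hab : a ≤ b) :
    (1 - σ) / σ * b ^ σ + b ^ (σ - 1) * a ≤
      sSup {x | ∃ q ≥ (0:ℝ), x = q ^ σ / σ - kinkedCost a (b ^ (σ - 1)) q} := by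
  refine le_csSup (bddAbove_surplus_kinkedCost hσ0 hσ1 hb) ⟨b, hb.le, ?_⟩
  have h2 : b ^ (σ - 1) * b = b ^ σ := by rw [← rpow_add_one hb.ne']; simp
  rw [kinkedCost, max_eq_left (by linarith), mul_sub, h2]
  field_simp
  ring

lemma utility_le_surplus_kinkedCost {σ a b : ℝ} (hσ0 : 0 < σ) (hσ1 : σ < 1) (ha : 0 ≤ a)
    (hb : 0 < b) :
    a ^ σ / σ ≤ sSup {x | ∃ q ≥ (0:ℝ), x = q ^ σ / σ - kinkedCost a (b ^ (σ - 1)) q} := by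
  refine le_csSup (bddAbove_surplus_kinkedCost hσ0 hσ1 hb) ⟨a, ha, ?_⟩
  simp [kinkedCost]

/-- If `a` is the smallest optimal supply at the linear cost of slope `p`, then it is also the
smallest optimal supply when all units up to `a` are free. -/
lemma eq_of_isSmallestArgmaxOn_kinkedCost {t : ℝ → ℝ} {a a' p : ℝ} (hp : 0 < p)
    (h : IsSmallestArgmaxOn (fun q => t q - kinkedCost 0 p q) (Ici 0) a)
    (h' : IsSmallestArgmaxOn (fun q => t q - kinkedCost a p q) (Ici 0) a') : a' = a := by
  obtain ⟨ha, hmax, -⟩ := h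
  obtain ⟨ha', hmax', hmin'⟩ := h'
  simp only [mem_Ici] at *
  have hlin : ∀ x, 0 ≤ x → t x - p * x ≤ t a - p * a := fun x hx => by
    simpa [kinkedCost, hx, ha] using hmax x hx
  have hle : ∀ x, 0 ≤ x → t x - kinkedCost a p x ≤ t a - kinkedCost a p a := fun x hx => by
    have h1 := mul_le_mul_of_nonneg_left (le_max_left (x - a) 0) hp.le
    have h2 := hlin x hx
    simp only [kinkedCost, sub_self, max_self]
    linarith
  have h1 := hmin' a ha hle
  refine le_antisymm h1 ?_
  have h2 := hmax' a ha
  have h3 := hlin a' ha'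
  rw [kinkedCost, kinkedCost, max_eq_right (by linarith : a' - a ≤ 0)] at h2
  simp only [sub_self, max_self] at h2
  exact le_of_mul_le_mul_left (by linarith) hp

lemma exists_growth_factor {σ s δ ε : ℝ} (hσ0 : 0 < σ) (hσ1 : σ < 1) (hs : s = σ / (1 - σ))
    (hδ : 0 < δ) (hε : 0 < ε) :
    ∃ κ > (1:ℝ), 0 < 1 + s * (1 - κ ^ (σ - 1)) * (1 + δ) - κ ^ σ ∧
      (1 - ε) * κ ^ σ ≤ 1 := by
  have h1σ : 0 < 1 - σ := by linarith
  have hd1 : HasDerivAt (fun κ : ℝ => κ ^ (σ - 1)) (σ - 1) 1 := by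
    simpa using Real.hasDerivAt_rpow_const (x := 1) (p := σ - 1) (Or.inl one_ne_zero)
  have hd2 : HasDerivAt (fun κ : ℝ => κ ^ σ) σ 1 := by
    simpa using Real.hasDerivAt_rpow_const (x := 1) (p := σ) (Or.inl one_ne_zero)
  have hd : HasDerivAt (fun κ : ℝ => 1 + s * (1 - κ ^ (σ - 1)) * (1 + δ) - κ ^ σ) (σ * δ) 1 := by
    have := ((((hd1.const_sub 1).const_mul s).mul_const (1 + δ)).const_add 1).sub hd2
    have h2 : s * (1 - σ) = σ := by rw [hs]; field_simp
    have h3 : s * -(σ - 1) * (1 + δ) - σ = σ * δ := by linear_combination (1 + δ) * h2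
    rwa [h3] at this
  have hev := hd.tendsto_slope.mono_left
    (nhdsWithin_mono (1:ℝ) (fun x (hx : x ∈ Ioi 1) => (mem_Ioi.1 hx).ne'))
  have hev1 := hev.eventually_const_lt (by positivity : 0 < σ * δ)
  have hcont : Filter.Tendsto (fun κ : ℝ => (1 - ε) * κ ^ σ) (nhdsWithin 1 (Ioi 1))
      (nhds (1 - ε)) := by
    have := (hd2.continuousAt.const_mul (1 - ε)).tendsto
    simp only [one_rpow, mul_one] at this
    exact this.mono_left nhdsWithin_le_nhds
  have hev2 := hcont.eventually_lt_const (by linarith : 1 - ε < 1)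
  have hev3 : ∀ᶠ κ in nhdsWithin (1:ℝ) (Ioi 1), 1 < κ := self_mem_nhdsWithin
  obtain ⟨κ, h1, h2, h3⟩ := (hev1.and (hev2.and hev3)).exists
  refine ⟨κ, h3, ?_, h2.le⟩
  rw [slope_def_field] at h1
  simp only [one_rpow, sub_self, mul_zero, zero_mul, add_zero, sub_zero] at h1
  have h4 : 0 < κ - 1 := sub_pos.2 h3
  exact (div_pos_iff_of_pos_right h4).1 h1

lemma eq_of_bounded_of_growth {σ s α : ℝ} {Y A : ℝ → ℝ} (hσ0 : 0 < σ) (hσ1 : σ < 1)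
    (hs : s = σ / (1 - σ)) (hα1 : α ≤ 1)
    (hY0 : ∀ b > 0, 0 ≤ Y b) (hY1 : ∀ b > 0, Y b ≤ 1) (hAY : ∀ b > 0, Y b ≤ A b)
    (hstep : ∀ b > 0, ∀ κ > 0, Y b + s * (1 - κ ^ (σ - 1)) * A b ≤ Y (κ * b) * κ ^ σ)
    (hgap : ∀ ε > 0, ∃ δ > 0, ∀ b > 0, ε ≤ |Y b - α| → Y b + δ ≤ A b) :
    ∀ b > 0, Y b = α := by
  have hs0 : 0 < s := hs ▸ div_pos hσ0 (by linarith)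
  have key : ∀ ε > 0, ∃ κ > 0, ∃ η > 0, ∀ b > 0,
      (ε ≤ |Y b - α| → Y b + η ≤ Y (κ * b)) ∧ (1 - ε) * Y b ≤ Y (κ * b) := by
    intro ε hε
    obtain ⟨δ, hδ, hgap⟩ := hgap ε hε
    obtain ⟨κ, hκ, hf, hκε⟩ := exists_growth_factor hσ0 hσ1 hs hδ hε
    have hκ0 : 0 < κ := by linarith
    have hτ : 0 < s * (1 - κ ^ (σ - 1)) :=
      mul_pos hs0 (sub_pos.2 (rpow_lt_one_of_one_lt_of_neg hκ (by linarith)))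
    have hP : 0 < κ ^ σ := rpow_pos_of_pos hκ0 _
    set τ := s * (1 - κ ^ (σ - 1)) with hτdef
    set P := κ ^ σ with hPdef
    refine ⟨κ, hκ0, min (1 + τ * (1 + δ) - P) (τ * δ) / P, by positivity, fun b hb => ⟨?_, ?_⟩⟩
    · intro hb'
      have h1 := mul_le_mul_of_nonneg_left (hgap b hb hb') hτ.le
      have h2 := hstep b hb κ hκ0
      have h3 := mul_le_mul_of_nonneg_left (min_le_left (1 + τ * (1 + δ) - P) (τ * δ)) (hY0 b hb)
      have h4 := mul_le_mul_of_nonneg_left (min_le_right (1 + τ * (1 + δ) - P) (τ * δ))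
        (sub_nonneg.2 (hY1 b hb))
      refine le_of_mul_le_mul_right ?_ hP
      rw [add_mul, div_mul_cancel₀ _ hP.ne']
      rw [← hτdef, ← hPdef] at h2
      nlinarith
    · refine le_of_mul_le_mul_right (le_trans ?_ (hstep b hb κ hκ0)) hP
      have h1 : 0 ≤ τ * A b := mul_nonneg hτ.le ((hY0 b hb).trans (hAY b hb))
      have h2 := mul_le_mul_of_nonneg_right hκε (hY0 b hb)
      nlinarith
  have hne : (Y '' Ioi 0).Nonempty := ⟨Y 1, 1, by simp, rfl⟩
  have hba : BddAbove (Y '' Ioi 0) := ⟨1, by rintro _ ⟨b, hb, rfl⟩; exact hY1 b hb⟩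
  have hbb : BddBelow (Y '' Ioi 0) := ⟨0, by rintro _ ⟨b, hb, rfl⟩; exact hY0 b hb⟩
  have hsup : sSup (Y '' Ioi 0) ≤ α := by
    refine le_of_forall_pos_le_add fun ε hε => ?_
    obtain ⟨κ, hκ, η, hη, h⟩ := key ε hε
    by_contra! hlt
    obtain ⟨_, ⟨b, hb, rfl⟩, hb'⟩ := exists_lt_of_lt_csSup hne
      (max_lt hlt (sub_lt_self (sSup (Y '' Ioi 0)) hη))
    rw [max_lt_iff] at hb'
    have h1 := (h b hb).1 (le_trans (by linarith) (le_abs_self _))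
    have h2 := le_csSup hba ⟨κ * b, mul_pos hκ hb, rfl⟩
    linarith
  have hinf : α ≤ sInf (Y '' Ioi 0) := by
    refine le_of_forall_pos_le_add fun ε' hε' => ?_
    set ε := min (ε' / 2) 1 with hεdef
    have hε : 0 < ε := by positivity
    have hε1 : ε ≤ 1 := min_le_right _ _
    have hε2 : ε ≤ ε' / 2 := min_le_left _ _
    obtain ⟨κ, hκ, η, hη, h⟩ := key ε hε
    suffices (1 - ε) * (α - ε) ≤ sInf (Y '' Ioi 0) by nlinarith
    by_contra! hlt
    obtain ⟨_, ⟨b, hb, rfl⟩, hb'⟩ := exists_lt_of_csInf_lt hne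
      (lt_min hlt (lt_add_of_pos_right (sInf (Y '' Ioi 0)) hη))
    rw [lt_min_iff] at hb'
    have hbκ : 0 < b / κ := div_pos hb hκ
    obtain ⟨h1, h2⟩ := h (b / κ) hbκ
    rw [mul_div_cancel₀ _ hκ.ne'] at h1 h2
    have h3 := csInf_le hbb ⟨b / κ, hbκ, rfl⟩
    by_cases h4 : ε ≤ |Y (b / κ) - α|
    · linarith [h1 h4]
    · have h5 := (abs_lt.1 (not_le.1 h4)).1
      have h6 := mul_le_mul_of_nonneg_left (by linarith : α - ε ≤ Y (b / κ)) (sub_nonneg.2 hε1)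
      linarith
  intro b hb
  exact le_antisymm ((le_csSup hba ⟨b, hb, rfl⟩).trans hsup)
    (hinf.trans (csInf_le hbb ⟨b, hb, rfl⟩))

/-- In the steady state the marginal condition pins down the supply. -/
lemma eq_of_steady_state {σ s α β : ℝ} (hσ1 : σ < 1) (hs : s = σ / (1 - σ))
    (h : ∀ κ > 0, α + s * (1 - κ ^ (σ - 1)) * β ≤ α * κ ^ σ) (hσ0 : 0 < σ) : β = α := by
  have h1σ : 0 < 1 - σ := by linarith
  have hd1 : HasDerivAt (fun κ : ℝ => κ ^ (σ - 1)) (σ - 1) 1 := by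
    simpa using Real.hasDerivAt_rpow_const (x := 1) (p := σ - 1) (Or.inl one_ne_zero)
  have hd2 : HasDerivAt (fun κ : ℝ => κ ^ σ) σ 1 := by
    simpa using Real.hasDerivAt_rpow_const (x := 1) (p := σ) (Or.inl one_ne_zero)
  have hd := (hd2.const_mul α).sub (((hd1.const_sub 1).const_mul s).mul_const β)
  have hmin : IsLocalMin (fun κ : ℝ => α * κ ^ σ - s * (1 - κ ^ (σ - 1)) * β) 1 := by
    filter_upwards [Ioi_mem_nhds (zero_lt_one' ℝ)] with κ hκ
    have := h κ hκ
    simp only [one_rpow, sub_self, mul_zero, zero_mul, mul_one, sub_zero]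
    linarith
  have h0 := hmin.hasDerivAt_eq_zero hd
  have h2 : s * (1 - σ) = σ := by rw [hs]; field_simp
  have h3 : σ * (α - β) = 0 := by
    linear_combination h0 + β * h2
  linarith [(mul_eq_zero.1 h3).resolve_left hσ0.ne']

/-- A positive power eventually dominates a linear function near zero. -/
lemma exists_linear_lt_rpow {σ m k : ℝ} (hσ1 : σ < 1) (hk : 0 < k) :
    ∃ x, 0 < x ∧ x < 1 ∧ x * m < k * x ^ σ := by
  have h1σ : 0 < 1 - σ := by linarith
  have hc : Filter.Tendsto (fun x : ℝ => x ^ (1 - σ) * m) (nhdsWithin 0 (Ioi 0)) (nhds 0) := by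
    have := ((Real.continuousAt_rpow_const 0 (1 - σ) (Or.inr h1σ.le)).mul_const m).tendsto
    rw [zero_rpow h1σ.ne', zero_mul] at this
    exact this.mono_left nhdsWithin_le_nhds
  obtain ⟨x, h1, h2⟩ := ((hc.eventually_lt_const hk).and
    (Ioo_mem_nhdsGT (zero_lt_one' ℝ))).exists
  refine ⟨x, h2.1, h2.2, ?_⟩
  have h3 := mul_lt_mul_of_pos_right h1 (rpow_pos_of_pos h2.1 σ)
  have h4 : x ^ (1 - σ) * x ^ σ = x := by rw [← rpow_add h2.1]; simp
  calc x * m = x ^ (1 - σ) * m * x ^ σ := by linear_combination -m * h4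
    _ < _ := h3

lemma excess_supply_eq {σ B α : ℝ} (hσ1 : σ < 1) (hα : 0 < α) :
    α * (1 + σ / (1 - σ) * (1 + B)) - α ^ σ / (1 - σ) + B =
      α ^ σ / (1 - σ) * (B * ((1 - σ) * (α ^ (1 - σ)) ^ (-(σ / (1 - σ))) + σ * α ^ (1 - σ)) -
        (1 - α ^ (1 - σ))) := by
  have h1σ : 1 - σ ≠ 0 := by linarith
  have h1 : (α ^ (1 - σ)) ^ (-(σ / (1 - σ))) = α ^ (-σ) := by
    rw [← rpow_mul hα.le]
    congr 1
    field_simp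
  have h2 : α ^ σ * α ^ (-σ) = 1 := by rw [← rpow_add hα]; simp
  have h3 : α ^ σ * α ^ (1 - σ) = α := by rw [← rpow_add hα]; simp
  rw [h1]
  field_simp
  linear_combination (-(1 + B * σ)) * h3 - B * (1 - σ) * h2

/-- At prices where the buyer's guarantee holds, supply exceeds its steady state level, by an
amount bounded below away from the optimum. -/
lemma exists_excess_supply {σ B z : ℝ} (hσ0 : 0 < σ) (hσ1 : σ < 1) (hB : 0 < B)
    (hlt : ∀ w ∈ Ioo (0:ℝ) 1, w ≠ z → 1 - w < B * ((1 - σ) * w ^ (-(σ / (1 - σ))) + σ * w))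
    {ε : ℝ} (hε : 0 < ε) :
    ∃ δ > 0, ∀ α ∈ Icc (0:ℝ) 1, ε ≤ |α - z ^ (1 / (1 - σ))| →
      δ ≤ α * (1 + σ / (1 - σ) * (1 + B)) - α ^ σ / (1 - σ) + B := by
  have h1σ : 0 < 1 - σ := by linarith
  have hcont : Continuous
      fun α : ℝ => α * (1 + σ / (1 - σ) * (1 + B)) - α ^ σ / (1 - σ) + B := by
    have := Real.continuous_rpow_const hσ0.le
    fun_prop
  have hpos : ∀ α ∈ Icc (0:ℝ) 1, ε ≤ |α - z ^ (1 / (1 - σ))| →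
      0 < α * (1 + σ / (1 - σ) * (1 + B)) - α ^ σ / (1 - σ) + B := by
    rintro α ⟨hα0, hα1⟩ hαε
    rcases hα0.eq_or_lt with rfl | hα0
    · simpa [zero_rpow hσ0.ne'] using hB
    rcases hα1.eq_or_lt with rfl | hα1
    · have : 1 * (1 + σ / (1 - σ) * (1 + B)) - 1 ^ σ / (1 - σ) + B = B / (1 - σ) := by
        rw [one_rpow]
        field_simp
        ring
      rw [this]
      positivity
    rw [excess_supply_eq hσ1 hα0]
    have hw : α ^ (1 - σ) ∈ Ioo (0:ℝ) 1 := ⟨by positivity, rpow_lt_one hα0.le hα1 h1σ⟩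
    have hne : α ^ (1 - σ) ≠ z := by
      rintro rfl
      rw [← rpow_mul hα0.le, mul_one_div_cancel h1σ.ne', rpow_one, sub_self, abs_zero] at hαε
      linarith
    have := sub_pos.2 (hlt _ hw hne)
    positivity
  have hcpt : IsCompact (Icc (0:ℝ) 1 ∩ {α | ε ≤ |α - z ^ (1 / (1 - σ))|}) :=
    isCompact_Icc.inter_right (isClosed_le (by fun_prop) (by fun_prop))
  rcases (Icc (0:ℝ) 1 ∩ {α | ε ≤ |α - z ^ (1 / (1 - σ))|}).eq_empty_or_nonempty with he | hne
  · refine ⟨1, one_pos, fun α hα hαε => ?_⟩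
    have : α ∈ Icc (0:ℝ) 1 ∩ {α | ε ≤ |α - z ^ (1 / (1 - σ))|} := ⟨hα, hαε⟩
    rw [he] at this
    exact this.elim
  · obtain ⟨α₀, h₀, hmin⟩ := hcpt.exists_isMinOn hne hcont.continuousOn
    exact ⟨_, hpos α₀ h₀.1 h₀.2, fun α hα hαε => hmin ⟨hα, hαε⟩⟩

lemma excess_supply_nonneg {σ B z α : ℝ} (hσ0 : 0 < σ) (hσ1 : σ < 1) (hB : 0 < B)
    (hz : z ∈ Ioo (0:ℝ) 1)
    (heq : 1 - z = B * ((1 - σ) * z ^ (-(σ / (1 - σ))) + σ * z))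
    (hlt : ∀ w ∈ Ioo (0:ℝ) 1, w ≠ z → 1 - w < B * ((1 - σ) * w ^ (-(σ / (1 - σ))) + σ * w))
    (hα : α ∈ Icc (0:ℝ) 1) :
    0 ≤ α * (1 + σ / (1 - σ) * (1 + B)) - α ^ σ / (1 - σ) + B := by
  have h1σ : 0 < 1 - σ := by linarith
  by_cases h : α = z ^ (1 / (1 - σ))
  · have hα0 : 0 < α := h ▸ rpow_pos_of_pos hz.1 _
    have : α ^ (1 - σ) = z := by
      rw [h, ← rpow_mul hz.1.le, one_div_mul_cancel h1σ.ne', rpow_one]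
    rw [excess_supply_eq hσ1 hα0, this, ← heq]
    simp
  · obtain ⟨δ, hδ, h'⟩ := exists_excess_supply hσ0 hσ1 hB hlt (abs_pos.2 (sub_ne_zero.2 h))
    exact hδ.le.trans (h' α hα le_rfl)

/-- A mechanism that guarantees the buyer the share `B` of the surplus is proportional to the
buyer's utility. -/
lemma eq_mul_utility_of_guarantee {σ B z : ℝ} (hσ0 : 0 < σ) (hσ1 : σ < 1) (hB : 0 < B)
    (hz : z ∈ Ioo (0:ℝ) 1)
    (heq : 1 - z = B * ((1 - σ) * z ^ (-(σ / (1 - σ))) + σ * z))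
    (hlt : ∀ w ∈ Ioo (0:ℝ) 1, w ≠ z → 1 - w < B * ((1 - σ) * w ^ (-(σ / (1 - σ))) + σ * w))
    {t : ℝ → ℝ} (ht0 : t 0 = 0) {Q : (ℝ → ℝ) → ℝ}
    (hQ : ∀ c, CostCcx c → IsSmallestArgmaxOn (fun q => t q - c q) (Ici 0) (Q c))
    (hG : ∀ c, CostCcx c →
      B ≤ ((Q c) ^ σ / σ - t (Q c)) / sSup {x | ∃ q ≥ (0:ℝ), x = q ^ σ / σ - c q}) :
    ∀ q ≥ (0:ℝ), t q = z * (q ^ σ / σ) := by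
  have h1σ : 0 < 1 - σ := by linarith
  obtain ⟨s, hs⟩ : ∃ s, s = σ / (1 - σ) := ⟨_, rfl⟩
  have hs0 : 0 < s := by rw [hs]; positivity
  have hsσ : s * (1 - σ) = σ := by rw [hs]; field_simp
  obtain ⟨α, hα⟩ : ∃ α, α = z ^ (1 / (1 - σ)) := ⟨_, rfl⟩
  have hα0 : 0 < α := hα ▸ rpow_pos_of_pos hz.1 _
  have hα1 : α ≤ 1 := hα ▸ (rpow_lt_one hz.1.le hz.2 (by positivity)).le
  have hαz : α ^ (1 - σ) = z := by
    rw [hα, ← rpow_mul hz.1.le, one_div_mul_cancel h1σ.ne', rpow_one]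
  set a : ℝ → ℝ := fun b => Q (kinkedCost 0 (b ^ (σ - 1))) with ha_def
  set A : ℝ → ℝ := fun b => a b / b with hA_def
  set Y : ℝ → ℝ := fun b => s * (t (a b) - b ^ (σ - 1) * a b) / b ^ σ with hY_def
  have hp : ∀ b > (0:ℝ), 0 < b ^ (σ - 1) := fun b hb => rpow_pos_of_pos hb _
  have hP : ∀ b > (0:ℝ), 0 < b ^ σ := fun b hb => rpow_pos_of_pos hb _
  have hpb : ∀ b > (0:ℝ), b ^ (σ - 1) * b = b ^ σ := fun b hb => by
    rw [← rpow_add_one hb.ne']; simp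
  have hopt : ∀ b > 0, IsSmallestArgmaxOn (fun q => t q - kinkedCost 0 (b ^ (σ - 1)) q)
      (Ici 0) (a b) := fun b hb => hQ _ (costCcx_kinkedCost le_rfl (hp b hb))
  have ha0 : ∀ b > 0, 0 ≤ a b := fun b hb => (hopt b hb).1
  have hlin : ∀ b > 0, ∀ x ≥ 0, t x - b ^ (σ - 1) * x ≤ t (a b) - b ^ (σ - 1) * a b :=
    fun b hb x hx => by
      have h := (hopt b hb).2.1 x hx
      have h' := ha0 b hb
      simpa only [kinkedCost, sub_zero, max_eq_left hx, max_eq_left h'] using h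
  have hA0 : ∀ b > 0, 0 ≤ A b := fun b hb => div_nonneg (ha0 b hb) hb.le
  have haA : ∀ b > 0, a b = A b * b := fun b hb => (div_mul_cancel₀ _ hb.ne').symm
  have haσ : ∀ b > 0, a b ^ σ = A b ^ σ * b ^ σ := fun b hb => by
    rw [haA b hb, mul_rpow (hA0 b hb) hb.le]
  have hpa : ∀ b > 0, b ^ (σ - 1) * a b = A b * b ^ σ := fun b hb => by
    rw [haA b hb, ← hpb b hb]; ring
  have htY : ∀ b > 0, s * t (a b) = (Y b + s * A b) * b ^ σ := fun b hb => by
    have : Y b * b ^ σ = s * (t (a b) - b ^ (σ - 1) * a b) := div_mul_cancel₀ _ (hP b hb).ne'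
    rw [hpa b hb] at this
    linear_combination -this
  have hsu : ∀ b > 0, s * (a b ^ σ / σ) = A b ^ σ / (1 - σ) * b ^ σ := fun b hb => by
    rw [haσ b hb, hs]; field_simp
  have hW : ∀ b > 0, ∀ w > 0,
      w ≤ sSup {x | ∃ q ≥ (0:ℝ), x = q ^ σ / σ - kinkedCost (a b) (b ^ (σ - 1)) q} →
      B * w ≤ a b ^ σ / σ - t (a b) := by
    intro b hb w hw hle
    have hc := costCcx_kinkedCost (ha0 b hb) (hp b hb)
    have h1 := hG _ hc
    rw [eq_of_isSmallestArgmaxOn_kinkedCost (hp b hb) (hopt b hb) (hQ _ hc),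
      le_div_iff₀ (hw.trans_le hle)] at h1
    exact (mul_le_mul_of_nonneg_left hle hB.le).trans h1
  have hlow : ∀ b > 0, A b ≤ 1 → Y b ≤ A b ^ σ / (1 - σ) - s * (1 + B) * A b - B := by
    intro b hb hAb
    have hab : a b ≤ b := by rw [haA b hb]; nlinarith
    have h0 : 0 ≤ b ^ (σ - 1) * a b := mul_nonneg (hp b hb).le (ha0 b hb)
    have h00 : 0 < (1 - σ) / σ * b ^ σ := mul_pos (by positivity) (hP b hb)
    have h1 := hW b hb _ (by linarith) (le_surplus_kinkedCost_of_le hσ0 hσ1 hb hab)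
    have h2 := mul_le_mul_of_nonneg_left h1 hs0.le
    rw [mul_sub, hsu b hb, htY b hb, hpa b hb] at h2
    have h3 : s * (B * ((1 - σ) / σ * b ^ σ + A b * b ^ σ)) = (B + B * s * A b) * b ^ σ := by
      rw [hs]; field_simp
    rw [h3, ← sub_mul] at h2
    have h4 := le_of_mul_le_mul_right h2 (hP b hb)
    linarith
  have hhigh : ∀ b > 0, 1 < A b → Y b + B ≤ A b := by
    intro b hb hAb
    have hAσ : 1 ≤ A b ^ σ := one_le_rpow hAb.le hσ0.le
    have hAσ' : A b ^ σ ≤ A b := by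
      simpa using rpow_le_rpow_of_exponent_le hAb.le hσ1.le
    have h00 : 0 < a b ^ σ / σ := by
      rw [haσ b hb]
      have := hP b hb
      positivity
    have h1 := hW b hb _ h00 (utility_le_surplus_kinkedCost hσ0 hσ1 (ha0 b hb) hb)
    have h2 := mul_le_mul_of_nonneg_left h1 hs0.le
    rw [mul_sub, mul_left_comm, hsu b hb, htY b hb, ← mul_assoc, ← sub_mul] at h2
    have h4 := le_of_mul_le_mul_right h2 (hP b hb)
    have h5 : (1 - σ) * (A b ^ σ / (1 - σ)) = A b ^ σ := by field_simp
    have h6 := mul_le_mul_of_nonneg_left h4 h1σ.le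
    have h7 : B ≤ B * A b ^ σ := le_mul_of_one_le_right hB.le hAσ
    refine le_of_mul_le_mul_left ?_ h1σ
    have h8 : 0 < B * σ := by positivity
    linear_combination h6 + h7 + hAσ' + h8.le + (1 - B) * h5 - A b * hsσ
  have hY0 : ∀ b > 0, 0 ≤ Y b := fun b hb => by
    have h := hlin b hb 0 le_rfl
    rw [ht0, mul_zero, sub_zero] at h
    exact div_nonneg (mul_nonneg hs0.le h) (hP b hb).le
  have hAY : ∀ b > 0, Y b ≤ A b := fun b hb => by
    rcases le_or_gt (A b) 1 with h | h
    · have h1 := hlow b hb h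
      have h2 := excess_supply_nonneg hσ0 hσ1 hB hz heq hlt ⟨hA0 b hb, h⟩
      rw [← hs] at h2
      linarith
    · linarith [hhigh b hb h]
  have hY1 : ∀ b > 0, Y b ≤ 1 := fun b hb => by
    rcases le_or_gt (A b) 1 with h | h
    · exact (hAY b hb).trans h
    have h00 : 0 < a b ^ σ / σ := by
      rw [haσ b hb]
      have := hP b hb
      positivity
    have h1 := hW b hb _ h00 (utility_le_surplus_kinkedCost hσ0 hσ1 (ha0 b hb) hb)
    have h2 := rpow_div_le_young hσ0 hσ1 (ha0 b hb) hb
    rw [div_le_one (hP b hb)]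
    have h3 : t (a b) - b ^ (σ - 1) * a b ≤ (1 - σ) / σ * b ^ σ := by
      linarith [mul_pos hB h00]
    calc _ ≤ s * ((1 - σ) / σ * b ^ σ) := mul_le_mul_of_nonneg_left h3 hs0.le
      _ = b ^ σ := by rw [hs]; field_simp
  have hstep : ∀ b > 0, ∀ κ > 0,
      Y b + s * (1 - κ ^ (σ - 1)) * A b ≤ Y (κ * b) * κ ^ σ := by
    intro b hb κ hκ
    have hκb : 0 < κ * b := mul_pos hκ hb
    have h1 := mul_le_mul_of_nonneg_left (hlin (κ * b) hκb (a b) (ha0 b hb)) hs0.le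
    have h2 : Y (κ * b) * (κ * b) ^ σ =
      s * (t (a (κ * b)) - (κ * b) ^ (σ - 1) * a (κ * b)) := div_mul_cancel₀ _ (hP _ hκb).ne'
    rw [← h2, mul_rpow hκ.le hb.le, mul_rpow hκ.le hb.le, mul_sub, htY b hb, mul_assoc,
      hpa b hb] at h1
    refine le_of_mul_le_mul_right ?_ (hP b hb)
    linarith
  have hgap : ∀ ε > 0, ∃ δ > 0, ∀ b > 0, ε ≤ |Y b - α| → Y b + δ ≤ A b := by
    intro ε hε
    obtain ⟨δ, hδ, h⟩ := exists_excess_supply hσ0 hσ1 hB hlt (half_pos hε)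
    refine ⟨min δ (min B (ε / 2)), by positivity, fun b hb hYb => ?_⟩
    have hm1 := min_le_left δ (min B (ε / 2))
    have hm2 := (min_le_right δ (min B (ε / 2))).trans (min_le_left _ _)
    have hm3 := (min_le_right δ (min B (ε / 2))).trans (min_le_right _ _)
    rcases le_or_gt (A b) 1 with h1 | h1
    · by_cases h2 : ε / 2 ≤ |A b - α|
      · have h3 := h (A b) ⟨hA0 b hb, h1⟩ (hα ▸ h2)
        have h4 := hlow b hb h1
        rw [← hs] at h3
        linarith
      · have h3 := abs_sub_le (Y b) (A b) α
        have h4 : |Y b - A b| = A b - Y b := by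
          rw [abs_sub_comm, abs_of_nonneg (sub_nonneg.2 (hAY b hb))]
        linarith
    · linarith [hhigh b hb h1]
  have hYα := eq_of_bounded_of_growth hσ0 hσ1 hs hα1 hY0 hY1 hAY hstep hgap
  have hAα : ∀ b > 0, A b = α := fun b hb => by
    refine eq_of_steady_state hσ1 hs (fun κ hκ => ?_) hσ0
    have := hstep b hb κ hκ
    rwa [hYα b hb, hYα _ (mul_pos hκ hb)] at this
  intro q hq
  rcases hq.lt_or_eq with hq | rfl
  · have hb : 0 < q / α := div_pos hq hα0
    have hab : a (q / α) = q := by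
      rw [haA _ hb, hAα _ hb, mul_div_cancel₀ _ hα0.ne']
    have h1 := htY _ hb
    rw [hab, hYα _ hb, hAα _ hb, div_rpow hq.le hα0.le] at h1
    have h2 : α ^ σ * z = α := by rw [← hαz, ← rpow_add hα0]; simp
    have hασ : α ^ σ ≠ 0 := (rpow_pos_of_pos hα0 σ).ne'
    have h3 : s * t q = s * (z * (q ^ σ / σ)) := by
      rw [h1, hs]
      nth_rewrite 1 2 [← h2]
      field_simp
      ring
    exact mul_left_cancel₀ hs0.ne' h3
  · simp [ht0, zero_rpow hσ0.ne']

/-- The supporting line of the cost at the supply chosen under a proportional mechanism. -/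
lemma add_mul_sub_le_of_isMaxOn {σ z q x : ℝ} {c : ℝ → ℝ} (hc : ConvexOn ℝ (Ici 0) c)
    (hq : 0 < q) (hx : 0 ≤ x)
    (hmax : ∀ y ≥ (0:ℝ), z * (y ^ σ / σ) - c y ≤ z * (q ^ σ / σ) - c q) (hσ0 : 0 < σ) :
    c q + z * q ^ (σ - 1) * (x - q) ≤ c x := by
  have hd : HasDerivAt (fun l : ℝ => z * ((q + l * (x - q)) ^ σ / σ))
      (z * q ^ (σ - 1) * (x - q)) 0 := by
    have h1 : HasDerivAt (fun l : ℝ => q + l * (x - q)) (x - q) 0 := by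
      simpa using ((hasDerivAt_id (0:ℝ)).mul_const (x - q)).const_add q
    have h2 := ((h1.rpow_const (p := σ) (Or.inl (by simpa using hq.ne'))).div_const σ).const_mul z
    have h3 : z * ((x - q) * σ * (q + 0 * (x - q)) ^ (σ - 1) / σ) =
        z * q ^ (σ - 1) * (x - q) := by
      rw [zero_mul, add_zero]; field_simp
    rwa [h3] at h2
  have hlim := hd.tendsto_slope_zero_right
  have hle : ∀ᶠ l : ℝ in nhdsWithin 0 (Ioi 0),
      l⁻¹ • (z * ((q + (0 + l) * (x - q)) ^ σ / σ) - z * ((q + 0 * (x - q)) ^ σ / σ)) ≤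
        c x - c q := by
    filter_upwards [Ioo_mem_nhdsGT (zero_lt_one' ℝ)] with l hl
    have hcl := hc.2 (mem_Ici.2 hq.le) (mem_Ici.2 hx) (sub_nonneg.2 hl.2.le) hl.1.le (by ring)
    have harg : (1 - l) • q + l • x = q + l * (x - q) := by simp only [smul_eq_mul]; ring
    have hy : 0 ≤ q + l * (x - q) := by
      rw [← harg]
      have := hl.2
      have := hl.1
      simp only [smul_eq_mul]
      nlinarith
    rw [harg] at hcl
    have hm := hmax _ hy
    simp only [smul_eq_mul] at hcl ⊢
    rw [zero_add, zero_mul, add_zero, inv_mul_le_iff₀ hl.1]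
    linarith
  have := le_of_tendsto hlim hle
  linarith

lemma le_surplus_ratio {σ B z : ℝ} (hσ0 : 0 < σ) (hσ1 : σ < 1) (hB : 0 < B)
    (hz : z ∈ Ioo (0:ℝ) 1)
    (heq : 1 - z = B * ((1 - σ) * z ^ (-(σ / (1 - σ))) + σ * z))
    {c : ℝ → ℝ} (hc : CostCcx c) {q : ℝ}
    (hq : IsSmallestArgmaxOn (fun q => z * (q ^ σ / σ) - c q) (Ici 0) q) :
    B ≤ (q ^ σ / σ - z * (q ^ σ / σ)) / sSup {x | ∃ y ≥ (0:ℝ), x = y ^ σ / σ - c y} := by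
  have h1σ : 0 < 1 - σ := by linarith
  obtain ⟨hc0, -, hcv, hc00, -⟩ := hc
  obtain ⟨hq0, hmax, -⟩ := hq
  obtain ⟨x, hx0, hx1, hx⟩ := exists_linear_lt_rpow (σ := σ) (m := c 1) hσ1
    (div_pos hz.1 hσ0)
  have hcx : c x < z * (x ^ σ / σ) := by
    have := hcv.2 (mem_Ici.2 le_rfl) (mem_Ici.2 zero_le_one) (sub_nonneg.2 hx1.le) hx0.le (by ring)
    simp only [smul_eq_mul, mul_zero, mul_one, zero_add, hc00] at this
    calc c x ≤ x * c 1 := this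
      _ < _ := hx
      _ = _ := by ring
  have hq : 0 < q := by
    refine lt_of_le_of_ne hq0 fun h => ?_
    have := hmax x hx0.le
    simp only [← h, zero_rpow hσ0.ne', zero_div, mul_zero, hc00] at this
    linarith
  have hbound : ∀ y ≥ (0:ℝ), y ^ σ / σ - c y ≤ (q ^ σ / σ - z * (q ^ σ / σ)) / B := by
    intro y hy
    obtain ⟨b, hbdef⟩ : ∃ b, b = q * z ^ (-(1 / (1 - σ))) := ⟨_, rfl⟩
    have hb : 0 < b := hbdef ▸ mul_pos hq (rpow_pos_of_pos hz.1 _)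
    have hbp : b ^ (σ - 1) = z * q ^ (σ - 1) := by
      rw [hbdef, mul_rpow hq.le (rpow_pos_of_pos hz.1 _).le, ← rpow_mul hz.1.le]
      have : -(1 / (1 - σ)) * (σ - 1) = 1 := by field_simp; ring
      rw [this, rpow_one, mul_comm]
    have hbσ : b ^ σ = q ^ σ * z ^ (-(σ / (1 - σ))) := by
      rw [hbdef, mul_rpow hq.le (rpow_pos_of_pos hz.1 _).le, ← rpow_mul hz.1.le]
      congr 2
      ring
    have h1 := rpow_div_le_young hσ0 hσ1 hy hb
    have h2 := add_mul_sub_le_of_isMaxOn hcv hq hy (fun y hy => hmax y hy) hσ0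
    have h3 := hc0 q hq.le
    have h4 : z * q ^ (σ - 1) * q = z * q ^ σ := by
      rw [mul_assoc, ← rpow_add_one hq.ne']; simp
    rw [hbp, hbσ] at h1
    have h5 : (q ^ σ / σ - z * (q ^ σ / σ)) / B =
        (1 - σ) / σ * (q ^ σ * z ^ (-(σ / (1 - σ)))) + z * q ^ σ := by
      rw [div_eq_iff hB.ne']
      field_simp
      linear_combination heq
    rw [h5]
    linarith
  have hS : (0:ℝ) < sSup {x | ∃ y ≥ (0:ℝ), x = y ^ σ / σ - c y} := by
    refine lt_of_lt_of_le ?_ (le_csSup ⟨(q ^ σ / σ - z * (q ^ σ / σ)) / B, ?_⟩ ⟨x, hx0.le, rfl⟩)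
    · have : 0 < x ^ σ / σ := div_pos (rpow_pos_of_pos hx0 _) hσ0
      have := mul_lt_of_lt_one_left this hz.2
      linarith
    · rintro _ ⟨y, hy, rfl⟩
      exact hbound y hy
  rw [le_div_iff₀ hS, ← le_div_iff₀' hB]
  refine csSup_le ⟨_, 0, le_rfl, rfl⟩ ?_
  rintro _ ⟨y, hy, rfl⟩
  exact hbound y hy

/-- Under a proportional mechanism, one free unit followed by slope `z` is a worst-case cost. -/
lemma surplus_ratio_kinkedCost_le {σ B z : ℝ} (hσ0 : 0 < σ) (hσ1 : σ < 1) (hB : 0 < B)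
    (hz : z ∈ Ioo (0:ℝ) 1)
    (heq : 1 - z = B * ((1 - σ) * z ^ (-(σ / (1 - σ))) + σ * z)) {q : ℝ}
    (hq : IsSmallestArgmaxOn (fun q => z * (q ^ σ / σ) - kinkedCost 1 z q) (Ici 0) q) :
    (q ^ σ / σ - z * (q ^ σ / σ)) / sSup {x | ∃ y ≥ (0:ℝ), x = y ^ σ / σ - kinkedCost 1 z y}
      ≤ B := by
  have h1σ : 0 < 1 - σ := by linarith
  obtain ⟨hq0, hmax, hmin⟩ := hq
  have hq1 : q = 1 := by
    refine le_antisymm (hmin 1 (mem_Ici.2 zero_le_one) fun y hy => ?_) ?_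
    · have hy : 0 ≤ y := hy
      have h1 := rpow_div_le_young hσ0 hσ1 hy one_pos
      simp only [one_rpow, mul_one, one_mul] at h1
      have h2 := le_max_left (y - 1) 0
      have h3 : 1 + (1 - σ) / σ = 1 / σ := by field_simp; ring
      have h4 : y ^ σ / σ - max (y - 1) 0 ≤ 1 / σ := by linarith
      have h5 := mul_le_mul_of_nonneg_left h4 hz.1.le
      simp only [kinkedCost, one_rpow, sub_self, max_self]
      linarith
    · by_contra! hlt
      have h1 := hmax 1 (mem_Ici.2 zero_le_one)
      have h2 := rpow_lt_one hq0 hlt hσ0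
      have h3 := mul_lt_mul_of_pos_left (div_lt_div_of_pos_right h2 hσ0) hz.1
      simp only [kinkedCost, one_rpow, sub_self, max_self,
        max_eq_right (by linarith : q - 1 ≤ 0)] at h1
      linarith
  obtain ⟨b, hbdef⟩ : ∃ b, b = z ^ (-(1 / (1 - σ))) := ⟨_, rfl⟩
  have hb : 0 < b := hbdef ▸ rpow_pos_of_pos hz.1 _
  have hb1 : 1 ≤ b := hbdef ▸ one_le_rpow_of_pos_of_le_one_of_nonpos hz.1 hz.2.le
    (neg_nonpos.2 (by positivity))
  have hbp : b ^ (σ - 1) = z := by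
    rw [hbdef, ← rpow_mul hz.1.le]
    have : -(1 / (1 - σ)) * (σ - 1) = 1 := by field_simp; ring
    rw [this, rpow_one]
  have hbσ : b ^ σ = z ^ (-(σ / (1 - σ))) := by
    rw [hbdef, ← rpow_mul hz.1.le]
    congr 1
    ring
  have h := le_surplus_kinkedCost_of_le hσ0 hσ1 hb hb1
  rw [hbp, hbσ, mul_one] at h
  have hpos : 0 < (1 - σ) / σ * z ^ (-(σ / (1 - σ))) + z :=
    add_pos (mul_pos (by positivity) (rpow_pos_of_pos hz.1 _)) hz.1
  rw [div_le_iff₀ (hpos.trans_le h), hq1, one_rpow]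
  refine le_trans (le_of_eq ?_) (mul_le_mul_of_nonneg_left h hB.le)
  field_simp
  linear_combination heq

/-- Theorem 1: buyer surplus guarantee with convex costs.
For `σ ∈ (0,1)`, `u(q) = q^σ/σ`, and every mechanism `t`, the infimum over all convex
cost functions `c ∈ C_cx` of `U(c,t)/W(c)` is at most `B(σ) = φ_σ(z*(σ))`, and equals
`B(σ)` iff `t(q) = z*(σ)·u(q)` for all `q ≥ 0`.  Here `z*(σ)` is the unique maximizer on
`(0,1)` of `φ_σ(z) = (1−z)/((1−σ) z^{−σ/(1−σ)} + σ z)`. -/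
theorem stmt_5 (σ : ℝ) (hσ : σ ∈ Ioo (0:ℝ) 1)
    (u : ℝ → ℝ) (hu : ∀ q, u q = q ^ σ / σ)
    (φ : ℝ → ℝ) (hφ : ∀ z, φ z = (1 - z) / ((1 - σ) * z ^ (-(σ / (1 - σ))) + σ * z))
    (zstar B : ℝ) (hzs : zstar ∈ Ioo (0:ℝ) 1)
    (hmax : ∀ z ∈ Ioo (0:ℝ) 1, φ z ≤ φ zstar)
    (huniq : ∀ z ∈ Ioo (0:ℝ) 1, (∀ w ∈ Ioo (0:ℝ) 1, φ w ≤ φ z) → z = zstar)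
    (hB : B = φ zstar)
    (W : (ℝ → ℝ) → ℝ) (hW : ∀ c, W c = sSup {x | ∃ q ≥ (0:ℝ), x = u q - c q})
    (t : ℝ → ℝ) (ht0 : t 0 = 0) (htpos : ∀ q ≥ (0:ℝ), 0 ≤ t q)
    (Q : (ℝ → ℝ) → ℝ)
    (hQ : ∀ c, CostCcx c → IsSmallestArgmaxOn (fun q => t q - c q) (Ici 0) (Q c)) :
    sInf {r | ∃ c, CostCcx c ∧ r = (u (Q c) - t (Q c)) / W c} ≤ B ∧
    (sInf {r | ∃ c, CostCcx c ∧ r = (u (Q c) - t (Q c)) / W c} = B ↔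
      ∀ q ≥ (0:ℝ), t q = zstar * u q) := by
  obtain ⟨hσ0, hσ1⟩ := hσ
  obtain rfl : u = fun q => q ^ σ / σ := funext hu
  obtain rfl : W = fun c => sSup {x | ∃ q ≥ (0:ℝ), x = q ^ σ / σ - c q} := funext hW
  have h1σ : 0 < 1 - σ := by linarith
  have hD : ∀ z ∈ Ioo (0:ℝ) 1, 0 < (1 - σ) * z ^ (-(σ / (1 - σ))) + σ * z := fun z hz =>
    add_pos (mul_pos h1σ (rpow_pos_of_pos hz.1 _)) (mul_pos hσ0 hz.1)
  have heq : 1 - zstar = B * ((1 - σ) * zstar ^ (-(σ / (1 - σ))) + σ * zstar) := by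
    rw [hB, hφ, div_mul_cancel₀ _ (hD _ hzs).ne']
  have hBpos : 0 < B := by
    rw [hB, hφ]
    exact div_pos (sub_pos.2 hzs.2) (hD _ hzs)
  have hlt : ∀ w ∈ Ioo (0:ℝ) 1, w ≠ zstar →
      1 - w < B * ((1 - σ) * w ^ (-(σ / (1 - σ))) + σ * w) := by
    intro w hw hne
    have : φ w < φ zstar := by
      by_contra! hle
      exact hne (huniq w hw fun v hv => (hmax v hv).trans hle)
    rwa [← hB, hφ, div_lt_iff₀ (hD w hw)] at this
  set S := {r | ∃ c, CostCcx c ∧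
    r = ((Q c) ^ σ / σ - t (Q c)) / sSup {x | ∃ q ≥ (0:ℝ), x = q ^ σ / σ - c q}} with hS
  change sInf S ≤ B ∧ (sInf S = B ↔ ∀ q ≥ (0:ℝ), t q = zstar * (q ^ σ / σ))
  have hforward : B ≤ sInf S → ∀ q ≥ (0:ℝ), t q = zstar * (q ^ σ / σ) := by
    intro hle
    have hbdd : BddBelow S := by
      by_contra hnb
      rw [Real.sInf_of_not_bddBelow hnb] at hle
      linarith
    exact eq_mul_utility_of_guarantee hσ0 hσ1 hBpos hzs heq hlt ht0 hQ
      fun c hc => hle.trans (csInf_le hbdd ⟨c, hc, rfl⟩)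
  have hbackward : (∀ q ≥ (0:ℝ), t q = zstar * (q ^ σ / σ)) → sInf S = B := by
    intro ht
    have hQ' : ∀ c, CostCcx c →
        IsSmallestArgmaxOn (fun q => zstar * (q ^ σ / σ) - c q) (Ici 0) (Q c) := by
      intro c hc
      obtain ⟨h0, h1, h2⟩ := hQ c hc
      refine ⟨h0, fun x hx => ?_, fun x hx h => h2 x hx fun y hy => ?_⟩
      · simpa only [ht x hx, ht _ h0] using h1 x hx
      · simpa only [ht x hx, ht y hy] using h y hy
    have hlow : ∀ r ∈ S, B ≤ r := by
      rintro _ ⟨c, hc, rfl⟩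
      rw [ht _ (hQ c hc).1]
      exact le_surplus_ratio hσ0 hσ1 hBpos hzs heq hc (hQ' c hc)
    have hc := costCcx_kinkedCost zero_le_one hzs.1
    refine le_antisymm ((csInf_le ⟨B, hlow⟩ ⟨_, hc, rfl⟩).trans ?_) (le_csInf ⟨_, _, hc, rfl⟩ hlow)
    rw [ht _ (hQ _ hc).1]
    exact surplus_ratio_kinkedCost_le hσ0 hσ1 hBpos hzs heq (hQ' _ hc)
  refine ⟨?_, fun h => hforward h.ge, hbackward⟩
  by_contra! h
  exact h.ne' (hbackward (hforward h.le))
end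
end

section
/- Let σ ∈ (0,1), u(q) = q^σ/σ, and z ∈ (0,1). For every cost function c ∈ C_cx, the buyer surplus under the constant share mechanism t(q) = z·u(q) satisfies U(c,t)/W(c) ≥ φ_σ(z) = (1 − z)/((1 − σ) z^{−σ/(1−σ)} + σ z). In particular, the mechanism t(q) = z*(σ)·u(q) guarantees buyer surplus at least B(σ)·W(c) for every c ∈ C_cx. -/
open Real Set

noncomputable section

/-- Tangent bound `x ^ σ ≤ σ z x + (1 - σ) z ^ (-σ / (1 - σ))` from weighted AM-GM. -/
theorem rpow_le_tangent {σ z x : ℝ} (hσ : σ ∈ Ioo (0:ℝ) 1) (hz : 0 < z) (hx : 0 ≤ x) :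
    x ^ σ ≤ σ * (z * x) + (1 - σ) * z ^ (-(σ / (1 - σ))) := by
  have h1 : 0 < 1 - σ := sub_pos.2 hσ.2
  have h := Real.geom_mean_le_arith_mean2_weighted hσ.1.le h1.le (mul_nonneg hz.le hx)
    (rpow_nonneg hz.le (-(σ / (1 - σ)))) (by ring)
  have e : (z * x) ^ σ * (z ^ (-(σ / (1 - σ)))) ^ (1 - σ) = x ^ σ := by
    rw [← rpow_mul hz.le, neg_mul, div_mul_cancel₀ _ h1.ne', mul_rpow hz.le hx, mul_right_comm,
      ← rpow_add hz]
    simp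
  rwa [e] at h

/-- A derivative at `0` is nonpositive when the function is maximal at `0` on `[0, 1]`. -/
theorem HasDerivAt.nonpos_of_forall_le {f : ℝ → ℝ} {f' : ℝ} (hf : HasDerivAt f f' 0)
    (h : ∀ e ∈ Ioo (0:ℝ) 1, f e ≤ f 0) : f' ≤ 0 := by
  have ht := (hasDerivAt_iff_tendsto_slope_zero.1 hf).mono_left
    (nhdsWithin_mono 0 (fun x (hx : x ∈ Ioi (0:ℝ)) => (ne_of_gt hx : x ≠ 0)))
  refine le_of_tendsto ht ?_
  filter_upwards [Ioo_mem_nhdsGT (zero_lt_one' ℝ)] with e he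
  have := h e he
  rw [zero_add, smul_eq_mul]
  exact mul_nonpos_of_nonneg_of_nonpos (inv_nonneg.2 he.1.le) (by linarith)

/-- Under a power reward, a maximizer of profit with convex cost is positive. -/
theorem argmax_pos {σ z q₀ : ℝ} {c : ℝ → ℝ} (hσ : σ ∈ Ioo (0:ℝ) 1) (hz : 0 < z)
    (hc : ConvexOn ℝ (Ici 0) c) (c0 : c 0 = 0) (h0 : 0 ≤ q₀)
    (hm : ∀ x ∈ Ici (0:ℝ), z * (x ^ σ / σ) - c x ≤ z * (q₀ ^ σ / σ) - c q₀) : 0 < q₀ := by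
  rcases h0.eq_or_lt with rfl | h
  swap
  · exact h
  exfalso
  have hzσ : 0 < z / σ := div_pos hz hσ.1
  have ht : Filter.Tendsto (fun e : ℝ => e ^ (1 - σ) * c 1) (nhdsWithin 0 (Ioi 0)) (nhds 0) := by
    have h1 : ContinuousAt (fun e : ℝ => e ^ (1 - σ) * c 1) 0 :=
      (continuousAt_id.rpow_const (Or.inr (sub_pos.2 hσ.2).le)).mul_const _
    have h2 := h1.tendsto
    rw [zero_rpow (sub_pos.2 hσ.2).ne', zero_mul] at h2
    exact h2.mono_left nhdsWithin_le_nhds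
  have : z / σ ≤ 0 := by
    refine ge_of_tendsto ht ?_
    filter_upwards [Ioo_mem_nhdsGT (zero_lt_one' ℝ)] with e he
    have h1 := hm e he.1.le
    have h2 := hc.2 (mem_Ici.2 le_rfl) (mem_Ici.2 zero_le_one) (sub_nonneg.2 he.2.le) he.1.le
      (by ring)
    simp only [smul_eq_mul, mul_zero, mul_one, zero_add, c0] at h2
    rw [zero_rpow hσ.1.ne', c0] at h1
    have h3 : e ^ σ * (z / σ) ≤ e ^ σ * (e ^ (1 - σ) * c 1) := by
      rw [← mul_assoc, ← rpow_add he.1]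
      have : e ^ σ * (z / σ) = z * (e ^ σ / σ) := by ring
      rw [this, show σ + (1 - σ) = 1 by ring, rpow_one]
      simp only [zero_div, mul_zero, sub_zero] at h1
      linarith
    exact le_of_mul_le_mul_left h3 (rpow_pos_of_pos he.1 _)
  linarith

/-- First-order condition: the marginal reward at a maximizer is a subgradient of the cost. -/
theorem subgradient_of_argmax {σ z q₀ : ℝ} {c : ℝ → ℝ} (hσ : σ ∈ Ioo (0:ℝ) 1)
    (hc : ConvexOn ℝ (Ici 0) c) (h0 : 0 < q₀)
    (hm : ∀ x ∈ Ici (0:ℝ), z * (x ^ σ / σ) - c x ≤ z * (q₀ ^ σ / σ) - c q₀)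
    {q : ℝ} (hq : 0 ≤ q) : c q₀ + z * q₀ ^ (σ - 1) * (q - q₀) ≤ c q := by
  have hd : HasDerivAt (fun e : ℝ => z * ((q₀ + e * (q - q₀)) ^ σ / σ) - e * (c q - c q₀))
      (z * (((q - q₀) * σ * q₀ ^ (σ - 1)) / σ) - (c q - c q₀)) 0 := by
    have h1 : HasDerivAt (fun e : ℝ => q₀ + e * (q - q₀)) (q - q₀) 0 := by
      simpa using ((hasDerivAt_id (0:ℝ)).mul_const (q - q₀)).const_add q₀
    have h2 := h1.rpow_const (p := σ) (Or.inl (by simpa using h0.ne'))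
    have h3 : HasDerivAt (fun e : ℝ => e * (c q - c q₀)) (c q - c q₀) 0 := by
      simpa using (hasDerivAt_id (0:ℝ)).mul_const (c q - c q₀)
    have h4 := ((h2.div_const σ).const_mul z).sub h3
    rw [zero_mul, add_zero] at h4
    exact h4
  have hle := hd.nonpos_of_forall_le (by
    intro e he
    have hx : (1 - e) * q₀ + e * q = q₀ + e * (q - q₀) := by ring
    have h2 := hc.2 (mem_Ici.2 h0.le) (mem_Ici.2 hq) (sub_nonneg.2 he.2.le) he.1.le (by ring)
    simp only [smul_eq_mul, hx] at h2
    have hn : 0 ≤ q₀ + e * (q - q₀) := by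
      rw [← hx]
      exact add_nonneg (mul_nonneg (sub_nonneg.2 he.2.le) h0.le) (mul_nonneg he.1.le hq)
    have h3 := hm _ hn
    simp only [zero_mul, add_zero, sub_zero]
    linarith)
  have hσ0 := hσ.1.ne'
  have e : z * (((q - q₀) * σ * q₀ ^ (σ - 1)) / σ) = z * q₀ ^ (σ - 1) * (q - q₀) := by
    field_simp
  linarith

/-- Upper bound on the surplus at any quantity in terms of the quantity supplied. -/
theorem surplus_le_of_argmax {σ z q₀ : ℝ} {c : ℝ → ℝ} (hσ : σ ∈ Ioo (0:ℝ) 1) (hz : 0 < z)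
    (hc : ConvexOn ℝ (Ici 0) c) (h0 : 0 < q₀) (hc₀ : 0 ≤ c q₀)
    (hm : ∀ x ∈ Ici (0:ℝ), z * (x ^ σ / σ) - c x ≤ z * (q₀ ^ σ / σ) - c q₀)
    {q : ℝ} (hq : 0 ≤ q) :
    q ^ σ / σ - c q ≤ q₀ ^ σ / σ * ((1 - σ) * z ^ (-(σ / (1 - σ))) + σ * z) := by
  have h1 := subgradient_of_argmax hσ hc h0 hm hq
  have h2 := mul_le_mul_of_nonneg_left (rpow_le_tangent hσ hz (div_nonneg hq h0.le))
    (div_nonneg (rpow_nonneg h0.le σ) hσ.1.le)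
  have hσ0 := hσ.1.ne'
  have e1 : q₀ ^ σ / σ * (q / q₀) ^ σ = q ^ σ / σ := by
    rw [div_rpow hq h0.le]
    have := (rpow_pos_of_pos h0 σ).ne'
    field_simp
  rw [e1] at h2
  rw [rpow_sub_one h0.ne'] at h1
  have e2 : z * (q₀ ^ σ / q₀) * (q - q₀) = q₀ ^ σ / σ * (σ * (z * (q / q₀)) - σ * z) := by
    field_simp
  rw [e2] at h1
  linarith

/-- lower bound attained by constant share mechanisms.
For `σ ∈ (0,1)`, `u(q) = q^σ/σ`, and `z ∈ (0,1)`, under the constant share mechanism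
`t(q) = z·u(q)` with supply `Q c z` the smallest maximizer of `z·u(q) − c(q)` over
`q ≥ 0`, the buyer surplus ratio satisfies `U(c,z)/W(c) ≥ φ_σ(z)` for every `c ∈ C_cx`;
in particular `z = z*(σ)` guarantees buyer surplus at least `B(σ)·W(c)`. -/
theorem stmt_6 (σ : ℝ) (hσ : σ ∈ Ioo (0:ℝ) 1)
    (u : ℝ → ℝ) (hu : ∀ q, u q = q ^ σ / σ)
    (φ : ℝ → ℝ) (hφ : ∀ z, φ z = (1 - z) / ((1 - σ) * z ^ (-(σ / (1 - σ))) + σ * z))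
    (zstar B : ℝ) (hzs : zstar ∈ Ioo (0:ℝ) 1)
    (hmax : ∀ z ∈ Ioo (0:ℝ) 1, φ z ≤ φ zstar)
    (hB : B = φ zstar)
    (W : (ℝ → ℝ) → ℝ) (hW : ∀ c, W c = sSup {x | ∃ q ≥ (0:ℝ), x = u q - c q})
    (Q : (ℝ → ℝ) → ℝ → ℝ)
    (hQ : ∀ c, CostCcx c → ∀ z ∈ Ioo (0:ℝ) 1,
      IsSmallestArgmaxOn (fun q => z * u q - c q) (Ici 0) (Q c z)) :
    (∀ z ∈ Ioo (0:ℝ) 1, ∀ c, CostCcx c →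
      φ z ≤ (u (Q c z) - z * u (Q c z)) / W c) ∧
    (∀ c, CostCcx c → B * W c ≤ u (Q c zstar) - zstar * u (Q c zstar)) := by
  have hden : ∀ z ∈ Ioo (0:ℝ) 1, 0 < (1 - σ) * z ^ (-(σ / (1 - σ))) + σ * z := fun z hz =>
    add_pos (mul_pos (sub_pos.2 hσ.2) (rpow_pos_of_pos hz.1 _)) (mul_pos hσ.1 hz.1)
  have key : ∀ z ∈ Ioo (0:ℝ) 1, ∀ c, CostCcx c →
      0 < W c ∧ φ z * W c ≤ u (Q c z) - z * u (Q c z) := by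
    intro z hz c hC
    obtain ⟨hmem, hm, -⟩ := hQ c hC z hz
    obtain ⟨hnn, -, hc, c0, -⟩ := hC
    simp only [hu] at hm
    have h0 : 0 < Q c z := argmax_pos hσ hz.1 hc c0 hmem hm
    have hub : ∀ x ∈ {x | ∃ q ≥ (0:ℝ), x = u q - c q},
        x ≤ Q c z ^ σ / σ * ((1 - σ) * z ^ (-(σ / (1 - σ))) + σ * z) := by
      rintro x ⟨q, hq, rfl⟩
      rw [hu]
      exact surplus_le_of_argmax hσ hz.1 hc h0 (hnn _ hmem) hm hq
    have hWle : W c ≤ Q c z ^ σ / σ * ((1 - σ) * z ^ (-(σ / (1 - σ))) + σ * z) := by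
      rw [hW]
      exact csSup_le ⟨_, 0, le_rfl, rfl⟩ hub
    have huQ : 0 < Q c z ^ σ / σ := div_pos (rpow_pos_of_pos h0 σ) hσ.1
    have hWpos : 0 < W c := by
      have h1 : u (Q c z) - c (Q c z) ≤ W c := by
        rw [hW]
        exact le_csSup ⟨_, hub⟩ ⟨_, hmem, rfl⟩
      have h2 := hm 0 (mem_Ici.2 le_rfl)
      rw [zero_rpow hσ.1.ne', c0, zero_div, mul_zero, sub_zero] at h2
      rw [hu] at h1
      have h3 := mul_pos (sub_pos.2 hz.2) huQ
      linarith
    refine ⟨hWpos, ?_⟩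
    rw [hφ, hu, div_mul_eq_mul_div, div_le_iff₀ (hden z hz)]
    have := mul_le_mul_of_nonneg_left hWle (sub_pos.2 hz.2).le
    linarith
  refine ⟨fun z hz c hC => ?_, fun c hC => ?_⟩
  · obtain ⟨hpos, hle⟩ := key z hz c hC
    exact (le_div_iff₀ hpos).2 hle
  · rw [hB]
    exact (key zstar hzs c hC).2
end
end

section
/- For every σ ∈ (0,1), the function φ_σ(z) = (1 − z)/((1 − σ) z^{−σ/(1−σ)} + σ z) is strictly quasi-concave on (0,1) and attains its maximum over (0,1) at a unique point z*(σ) ∈ (0,1). -/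
open Real Set

noncomputable section

lemma strictConvexOn_rpow_of_neg {q : ℝ} (hq : q < 0) :
    StrictConvexOn ℝ (Ioi (0 : ℝ)) fun x => x ^ q := by
  refine ⟨convex_Ioi 0, fun x hx y hy hxy a b ha hb hab => ?_⟩
  have hz : a • x + b • y ∈ Ioi (0 : ℝ) := convex_Ioi 0 hx hy ha.le hb.le hab
  have hlog := mul_lt_mul_of_neg_right (strictConcaveOn_log_Ioi.2 hx hy hxy ha hb hab) hq
  have hexp := convexOn_exp.2 (mem_univ (log x * q)) (mem_univ (log y * q)) ha.le hb.le hab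
  simp only [rpow_def_of_pos hz, rpow_def_of_pos hx, rpow_def_of_pos hy]
  refine lt_of_lt_of_le (exp_lt_exp.2 ?_) hexp
  simp only [smul_eq_mul] at hlog ⊢
  linarith

/-- The quotient of a positive concave function by a positive strictly convex function is strictly
quasi-concave. -/
lemma min_div_lt_div_of_concaveOn_of_strictConvexOn {s : Set ℝ} {f g : ℝ → ℝ}
    (hf : ConcaveOn ℝ s f) (hg : StrictConvexOn ℝ s g)
    (hf0 : ∀ x ∈ s, 0 < f x) (hg0 : ∀ x ∈ s, 0 < g x) {x y l : ℝ} (hx : x ∈ s) (hy : y ∈ s)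
    (hxy : x ≠ y) (hl : l ∈ Ioo (0 : ℝ) 1) :
    min (f x / g x) (f y / g y) < f (l * x + (1 - l) * y) / g (l * x + (1 - l) * y) := by
  have hl' : 0 < 1 - l := sub_pos.2 hl.2
  set m := min (f x / g x) (f y / g y)
  have hm : 0 < m := lt_min (div_pos (hf0 x hx) (hg0 x hx)) (div_pos (hf0 y hy) (hg0 y hy))
  have hmx : m * g x ≤ f x := (le_div_iff₀ (hg0 x hx)).1 (min_le_left _ _)
  have hmy : m * g y ≤ f y := (le_div_iff₀ (hg0 y hy)).1 (min_le_right _ _)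
  have hz : l * x + (1 - l) * y ∈ s := hf.1 hx hy hl.1.le hl'.le (by ring)
  have hfz : l * f x + (1 - l) * f y ≤ f (l * x + (1 - l) * y) :=
    hf.2 hx hy hl.1.le hl'.le (by ring)
  have hgz : g (l * x + (1 - l) * y) < l * g x + (1 - l) * g y :=
    hg.2 hx hy hxy hl.1 hl' (by ring)
  rw [lt_div_iff₀ (hg0 _ hz)]
  calc m * g (l * x + (1 - l) * y) < m * (l * g x + (1 - l) * g y) := by gcongr
    _ = l * (m * g x) + (1 - l) * (m * g y) := by ring
    _ ≤ l * f x + (1 - l) * f y :=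
      add_le_add (mul_le_mul_of_nonneg_left hmx hl.1.le) (mul_le_mul_of_nonneg_left hmy hl'.le)
    _ ≤ _ := hfz

/-- strict quasi-concavity of `φ_σ` and uniqueness of its maximizer.
For every `σ ∈ (0,1)`, `φ_σ(z) = (1−z)/((1−σ) z^{−σ/(1−σ)} + σ z)` is strictly
quasi-concave on `(0,1)` and attains its maximum over `(0,1)` at a unique point. -/
theorem stmt_7 (σ : ℝ) (hσ : σ ∈ Ioo (0:ℝ) 1)
    (φ : ℝ → ℝ) (hφ : ∀ z, φ z = (1 - z) / ((1 - σ) * z ^ (-(σ / (1 - σ))) + σ * z)) :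
    (∀ x ∈ Ioo (0:ℝ) 1, ∀ y ∈ Ioo (0:ℝ) 1, x < y → ∀ l ∈ Ioo (0:ℝ) 1,
      min (φ x) (φ y) < φ (l * x + (1 - l) * y)) ∧
    (∃! z, z ∈ Ioo (0:ℝ) 1 ∧ ∀ w ∈ Ioo (0:ℝ) 1, φ w ≤ φ z) := by
  obtain ⟨hσ0, hσ1⟩ := hσ
  have hτ : 0 < 1 - σ := sub_pos.2 hσ1
  have hp : 0 < σ / (1 - σ) := div_pos hσ0 hτ
  set p := σ / (1 - σ)
  have hden : ∀ z ∈ Ioo (0 : ℝ) 1, 0 < (1 - σ) * z ^ (-p) + σ * z := fun z hz => by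
    have := hz.1
    positivity
  have hconv : StrictConvexOn ℝ (Ioo (0 : ℝ) 1) fun z => (1 - σ) * z ^ (-p) + σ * z := by
    have hpow : StrictConvexOn ℝ (Ioi (0 : ℝ)) fun z : ℝ => z ^ (-p) :=
      strictConvexOn_rpow_of_neg (neg_lt_zero.2 hp)
    refine ⟨convex_Ioo 0 1, fun x hx y hy hxy a b ha hb hab => ?_⟩
    have h := mul_lt_mul_of_pos_left (hpow.2 hx.1 hy.1 hxy ha hb hab) hτ
    simp only [smul_eq_mul] at h ⊢
    linarith
  have hconc : ConcaveOn ℝ (Ioo (0 : ℝ) 1) fun z => 1 - z :=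
    (concaveOn_const 1 (convex_Ioo 0 1)).sub (convexOn_id (convex_Ioo 0 1))
  have hqc : ∀ x ∈ Ioo (0:ℝ) 1, ∀ y ∈ Ioo (0:ℝ) 1, x ≠ y → ∀ l ∈ Ioo (0:ℝ) 1,
      min (φ x) (φ y) < φ (l * x + (1 - l) * y) := fun x hx y hy hxy l hl => by
    simp only [hφ]
    exact min_div_lt_div_of_concaveOn_of_strictConvexOn hconc hconv
      (fun z hz => sub_pos.2 hz.2) hden hx hy hxy hl
  refine ⟨fun x hx y hy hxy => hqc x hx y hy hxy.ne, ?_⟩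
  have hex : ∃ z ∈ Ioo (0 : ℝ) 1, ∀ w ∈ Ioo (0 : ℝ) 1, φ w ≤ φ z := by
    -- Clearing the negative power extends `φ` continuously to `[0, 1]`.
    set g : ℝ → ℝ := fun z => (1 - z) * z ^ p / ((1 - σ) + σ * (z * z ^ p)) with hg
    have hgφ : ∀ z ∈ Ioo (0 : ℝ) 1, φ z = g z := fun z hz => by
      have hz0 := hz.1
      have hzp : 0 < z ^ p := rpow_pos_of_pos hz0 p
      have hd : 0 < 1 - σ + σ * (z * z ^ p) := by positivity
      rw [hφ, rpow_neg hz0.le, hg, div_eq_div_iff (by positivity) hd.ne']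
      field_simp
    have hcont : ContinuousOn g (Icc 0 1) := by
      have hpow : Continuous fun z : ℝ => z ^ p := continuous_rpow_const hp.le
      refine ContinuousOn.div (by fun_prop) (by fun_prop) fun z hz => ?_
      have := hz.1
      positivity
    obtain ⟨z, hz, hmax⟩ := isCompact_Icc.exists_isMaxOn (nonempty_Icc.2 zero_le_one) hcont
    have hhalf : (1 / 2 : ℝ) ∈ Ioo (0 : ℝ) 1 := by norm_num
    have hpos : 0 < g z := by
      refine lt_of_lt_of_le ?_ (hmax (Ioo_subset_Icc_self hhalf))
      rw [← hgφ _ hhalf, hφ]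
      exact div_pos (sub_pos.2 hhalf.2) (hden _ hhalf)
    have hz' : z ∈ Ioo (0 : ℝ) 1 := by
      refine ⟨hz.1.lt_of_ne ?_, hz.2.lt_of_ne ?_⟩
      · rintro rfl
        simp [hg, zero_rpow hp.ne'] at hpos
      · rintro rfl
        simp [hg] at hpos
    refine ⟨z, hz', fun w hw => ?_⟩
    rw [hgφ w hw, hgφ z hz']
    exact hmax (Ioo_subset_Icc_self hw)
  obtain ⟨z, hz, hmax⟩ := hex
  refine ⟨z, ⟨hz, hmax⟩, fun y ⟨hy, hymax⟩ => by_contra fun hne => ?_⟩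
  have hhalf : (1 / 2 : ℝ) ∈ Ioo (0 : ℝ) 1 := by norm_num
  have hmid : 1 / 2 * y + (1 - 1 / 2) * z ∈ Ioo (0 : ℝ) 1 :=
    convex_Ioo (0 : ℝ) 1 hy hz hhalf.1.le (sub_nonneg.2 hhalf.2.le) (by ring)
  exact (hqc y hy z hz hne _ hhalf).not_ge (le_min (hymax _ hmid) (hmax _ hmid))
end
end

section
/- Let u : (0,∞) → (0,∞) be twice differentiable and strictly increasing with u' > 0, u(q) → 0 as q → 0⁺, and u(q) → ∞ as q → ∞, and let C be a class of twice differentiable, strictly increasing cost functions c with c' > 0. For q > 0 and c ∈ C define δ(q,c) = (u(q)/(q u'(q))) · ( q c''(q)/c'(q) − q u''(q)/u'(q) ) and let δ̲ = inf over q > 0 and c ∈ C of δ(q,c); assume δ̲ > 0. For σ ∈ (0,1), define the transformed cost ĉ(x) = c( u⁻¹( x^σ/σ ) ) for x > 0. Then ĉ is convex on (0,∞) for every c ∈ C if and only if σ ≥ 1/(1 + δ̲). -/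
open Real Set

noncomputable section

/-- A twice differentiable function on `(0,∞)` is convex there iff its second derivative is
nonnegative. -/
theorem convexOn_Ioi_iff_of_hasDerivAt {f f' f'' : ℝ → ℝ}
    (h1 : ∀ x > (0:ℝ), HasDerivAt f (f' x) x) (h2 : ∀ x > (0:ℝ), HasDerivAt f' (f'' x) x) :
    ConvexOn ℝ (Ioi 0) f ↔ ∀ x > (0:ℝ), 0 ≤ f'' x := by
  constructor
  · intro hf x hx
    have hmono : MonotoneOn f' (Ioi 0) := by
      have h := hf.monotoneOn_deriv fun y hy => (h1 y hy).differentiableAt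
      intro a ha b hb hab
      simpa only [(h1 a ha).deriv, (h1 b hb).deriv] using h ha hb hab
    have h := hmono.derivWithin_nonneg (x := x)
    rwa [(h2 x hx).hasDerivWithinAt.derivWithin (isOpen_Ioi.uniqueDiffWithinAt hx)] at h
  · intro h
    refine convexOn_of_hasDerivWithinAt2_nonneg (f' := f') (f'' := f'') (convex_Ioi 0)
      (fun x hx => (h1 x hx).continuousAt.continuousWithinAt) ?_ ?_ ?_ <;>
      rw [interior_Ioi]
    · exact fun x hx => (h1 x hx).hasDerivWithinAt
    · exact fun x hx => (h2 x hx).hasDerivWithinAt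
    · exact h

/-- A continuous function on `(0,∞)` tending to `0` at `0⁺` and to `∞` at `∞` takes every
positive value. -/
theorem exists_pos_eq_of_tendsto {u : ℝ → ℝ} (hu : ContinuousOn u (Ioi 0))
    (hu0 : Filter.Tendsto u (nhdsWithin 0 (Ioi 0)) (nhds 0))
    (huinf : Filter.Tendsto u Filter.atTop Filter.atTop) {y : ℝ} (hy : 0 < y) :
    ∃ q > 0, u q = y := by
  obtain ⟨a, hay, ha⟩ := ((hu0.eventually (gt_mem_nhds hy)).and self_mem_nhdsWithin).exists
  obtain ⟨b, hby, hb⟩ :=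
    ((huinf.eventually_ge_atTop y).and (Filter.eventually_gt_atTop 0)).exists
  exact isPreconnected_Ioi.intermediate_value ha hb hu ⟨hay.le, hby⟩

/-- The derivative of the inverse of a differentiable bijection of `(0,∞)` with positive
derivative. -/
theorem hasDerivAt_inverse_Ioi {u uinv u' : ℝ → ℝ} (hu : ∀ q > (0:ℝ), HasDerivAt u (u' q) q)
    (hu' : ∀ q > (0:ℝ), 0 < u' q) (hpos : ∀ q > (0:ℝ), 0 < u q)
    (hinvpos : ∀ y > (0:ℝ), 0 < uinv y) (huinv : ∀ q > (0:ℝ), uinv (u q) = q)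
    (huinv' : ∀ y > (0:ℝ), u (uinv y) = y) {y : ℝ} (hy : 0 < y) :
    HasDerivAt uinv (u' (uinv y))⁻¹ y := by
  have hmono : StrictMonoOn u (Ioi 0) := by
    refine strictMonoOn_of_deriv_pos (convex_Ioi 0)
      (fun q hq => (hu q hq).continuousAt.continuousWithinAt) fun q hq => ?_
    rw [interior_Ioi] at hq
    rw [(hu q hq).deriv]
    exact hu' q hq
  have hinv : MonotoneOn uinv (Ioi 0) := by
    intro a ha b hb hab
    rwa [← hmono.le_iff_le (hinvpos a ha) (hinvpos b hb), huinv' a ha, huinv' b hb]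
  have himage : Ioi 0 ⊆ uinv '' Ioi 0 := fun q hq => ⟨u q, hpos q hq, huinv q hq⟩
  have hcont : ContinuousAt uinv y :=
    continuousAt_of_monotoneOn_of_image_mem_nhds hinv (Ioi_mem_nhds hy)
      (Filter.mem_of_superset (Ioi_mem_nhds (hinvpos y hy)) himage)
  exact (hu _ (hinvpos y hy)).of_local_left_inverse hcont (hu' _ (hinvpos y hy)).ne'
    (Filter.eventually_of_mem (Ioi_mem_nhds hy) huinv')

/-- Lemma 1: convexity of the transformed cost.
Let `u` be twice differentiable and strictly increasing on `(0,∞)` with `u' > 0`,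
`u → 0` at `0⁺` and `u → ∞` at `∞` (so `u` has an inverse `uinv` on `(0,∞)`), and let
`C` be a class of twice differentiable strictly increasing cost functions with `c' > 0`.
With `δ(q,c) = (u/(q u'))·(q c''/c' − q u''/u')` and `δ̲ = inf δ > 0`, for `σ ∈ (0,1)`
the transformed cost `x ↦ c(uinv(x^σ/σ))` is convex on `(0,∞)` for every `c ∈ C` if and
only if `σ ≥ 1/(1+δ̲)`. -/
theorem stmt_9
    (u uinv : ℝ → ℝ)
    (hu1 : ∀ q > (0:ℝ), HasDerivAt u (deriv u q) q)
    (hu2 : ∀ q > (0:ℝ), HasDerivAt (deriv u) (deriv (deriv u) q) q)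
    (hupos : ∀ q > (0:ℝ), 0 < u q)
    (hu' : ∀ q > (0:ℝ), 0 < deriv u q)
    (hu0 : Filter.Tendsto u (nhdsWithin 0 (Ioi 0)) (nhds 0))
    (huinf : Filter.Tendsto u Filter.atTop Filter.atTop)
    (huinv : ∀ q > (0:ℝ), uinv (u q) = q)
    (huinv' : ∀ y > (0:ℝ), u (uinv y) = y)
    (C : Set (ℝ → ℝ))
    (hC : ∀ c ∈ C, (∀ q > (0:ℝ), HasDerivAt c (deriv c q) q) ∧
      (∀ q > (0:ℝ), HasDerivAt (deriv c) (deriv (deriv c) q) q) ∧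
      (∀ q > (0:ℝ), 0 < c q) ∧ (∀ q > (0:ℝ), 0 < deriv c q))
    (δ : ℝ → (ℝ → ℝ) → ℝ)
    (hδ : ∀ q c, δ q c = (u q / (q * deriv u q)) *
      (q * deriv (deriv c) q / deriv c q - q * deriv (deriv u) q / deriv u q))
    (δlow : ℝ) (hδlow : δlow = sInf {d | ∃ q > (0:ℝ), ∃ c ∈ C, d = δ q c})
    (hδpos : 0 < δlow)
    (σ : ℝ) (hσ : σ ∈ Ioo (0:ℝ) 1) :
    (∀ c ∈ C, ConvexOn ℝ (Ioi 0) (fun x => c (uinv (x ^ σ / σ)))) ↔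
      1 / (1 + δlow) ≤ σ := by
  obtain ⟨hσ0, hσ1⟩ := hσ
  have hinvpos : ∀ y > (0:ℝ), 0 < uinv y := by
    intro y hy
    obtain ⟨q, hq, rfl⟩ := exists_pos_eq_of_tendsto
      (fun q hq => (hu1 q hq).continuousAt.continuousWithinAt) hu0 huinf hy
    rwa [huinv q hq]
  have hypos : ∀ x > (0:ℝ), 0 < x ^ σ / σ := fun x hx => div_pos (rpow_pos_of_pos hx σ) hσ0
  have hy : ∀ x > (0:ℝ), HasDerivAt (fun x : ℝ => x ^ σ / σ) (x ^ (σ - 1)) x := by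
    intro x hx
    have h := (hasDerivAt_rpow_const (p := σ) (Or.inl hx.ne')).div_const σ
    rwa [mul_div_cancel_left₀ _ hσ0.ne'] at h
  have hq : ∀ x > (0:ℝ), HasDerivAt (fun x : ℝ => uinv (x ^ σ / σ))
      ((deriv u (uinv (x ^ σ / σ)))⁻¹ * x ^ (σ - 1)) x := fun x hx =>
    (hasDerivAt_inverse_Ioi hu1 hu' hupos hinvpos huinv huinv' (hypos x hx)).comp x (hy x hx)
  have hconv : ∀ c ∈ C, ConvexOn ℝ (Ioi 0) (fun x => c (uinv (x ^ σ / σ))) ↔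
      ∀ q > (0:ℝ), 1 / σ - 1 ≤ δ q c := by
    intro c hc
    obtain ⟨hc1, hc2, -, hc'⟩ := hC c hc
    have h1 : ∀ x > (0:ℝ), HasDerivAt (fun x => c (uinv (x ^ σ / σ)))
        (deriv c (uinv (x ^ σ / σ)) / deriv u (uinv (x ^ σ / σ)) * x ^ (σ - 1)) x := by
      intro x hx
      refine ((hc1 _ (hinvpos _ (hypos x hx))).comp x (hq x hx)).congr_deriv ?_
      ring
    have h2 : ∀ x > (0:ℝ), HasDerivAt
        (fun x => deriv c (uinv (x ^ σ / σ)) / deriv u (uinv (x ^ σ / σ)) * x ^ (σ - 1))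
        (deriv c (uinv (x ^ σ / σ)) / deriv u (uinv (x ^ σ / σ)) * x ^ (σ - 2) * σ *
          (δ (uinv (x ^ σ / σ)) c - (1 / σ - 1))) x := by
      intro x hx
      have hQ := hinvpos _ (hypos x hx)
      have hdc := (hc2 _ hQ).comp x (hq x hx)
      have hdu := (hu2 _ hQ).comp x (hq x hx)
      have hd := (hdc.div hdu (hu' _ hQ).ne').mul
        (hasDerivAt_rpow_const (p := σ - 1) (Or.inl hx.ne'))
      refine hd.congr_deriv ?_
      have huQ := huinv' _ (hypos x hx)
      simp only [Function.comp_apply, Pi.div_apply, hδ, huQ]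
      have hcQ := (hc' _ hQ).ne'
      have huQ' := (hu' _ hQ).ne'
      generalize uinv (x ^ σ / σ) = Q at *
      have e1 : x ^ (σ - 1) = x ^ (σ - 2) * x := by
        rw [← rpow_add_one hx.ne']; ring_nf
      have e2 : x ^ σ = x ^ (σ - 2) * x ^ 2 := by
        rw [← rpow_add_natCast hx.ne']; norm_num
      have e3 : σ - 1 - 1 = σ - 2 := by ring
      rw [e3, e1, e2]
      field_simp
      ring
    rw [convexOn_Ioi_iff_of_hasDerivAt h1 h2]
    have hfactor : ∀ x > (0:ℝ), 0 < deriv c (uinv (x ^ σ / σ)) / deriv u (uinv (x ^ σ / σ)) *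
        x ^ (σ - 2) * σ := by
      intro x hx
      have hQ := hinvpos _ (hypos x hx)
      exact mul_pos (mul_pos (div_pos (hc' _ hQ) (hu' _ hQ)) (rpow_pos_of_pos hx _)) hσ0
    constructor
    · intro h q hq
      have hσu : 0 < σ * u q := mul_pos hσ0 (hupos q hq)
      have hx := rpow_pos_of_pos hσu σ⁻¹
      have hxq : uinv (((σ * u q) ^ σ⁻¹) ^ σ / σ) = q := by
        rw [rpow_inv_rpow hσu.le hσ0.ne', mul_div_cancel_left₀ _ hσ0.ne', huinv q hq]
      have h := nonneg_of_mul_nonneg_right (h _ hx) (hfactor _ hx)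
      rw [hxq] at h
      linarith
    · intro h x hx
      exact mul_nonneg (hfactor x hx).le (sub_nonneg.2 (h _ (hinvpos _ (hypos x hx))))
  have hbdd : BddBelow {d | ∃ q > (0:ℝ), ∃ c ∈ C, d = δ q c} := by
    by_contra h
    rw [hδlow, Real.sInf_of_not_bddBelow h] at hδpos
    exact hδpos.false
  have hne : {d | ∃ q > (0:ℝ), ∃ c ∈ C, d = δ q c}.Nonempty := by
    by_contra h
    rw [hδlow, not_nonempty_iff_eq_empty.1 h, Real.sInf_empty] at hδpos
    exact hδpos.false
  have hσδ : 1 / (1 + δlow) ≤ σ ↔ 1 / σ - 1 ≤ δlow := by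
    rw [one_div_le (by linarith) hσ0, sub_le_iff_le_add']
  rw [hσδ, hδlow, le_csInf_iff hbdd hne]
  constructor
  · rintro h _ ⟨q, hq, c, hc, rfl⟩
    exact (hconv c hc).1 (h c hc) q hq
  · exact fun h c hc => (hconv c hc).2 fun q hq => h _ ⟨q, hq, c, hc, rfl⟩
end
end

section
/- Let u, c : (0,∞) → (0,∞) be twice differentiable and strictly increasing with u', c' > 0, and let h : (0,∞) → (0,∞) be twice differentiable and strictly increasing with h' > 0. Define ũ = u ∘ h and c̃ = c ∘ h, and define the curvature index δ(q,c) = (u(q)/(q u'(q))) · ( q c''(q)/c'(q) − q u''(q)/u'(q) ), with δ̃(x,c̃) defined analogously using ũ in place of u. Then δ̃(x,c̃) = δ(h(x),c) for every x > 0; that is, the curvature index δ is invariant under strictly increasing smooth changes of the quantity variable. -/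
open Real Set

noncomputable section

/-- The first two derivatives of a composition on the positive half-line. -/
theorem deriv_comp_and_deriv_deriv_comp_of_pos {f h : ℝ → ℝ}
    (hf1 : ∀ q > (0:ℝ), HasDerivAt f (deriv f q) q)
    (hf2 : ∀ q > (0:ℝ), HasDerivAt (deriv f) (deriv (deriv f) q) q)
    (hh1 : ∀ x > (0:ℝ), HasDerivAt h (deriv h x) x)
    (hh2 : ∀ x > (0:ℝ), HasDerivAt (deriv h) (deriv (deriv h) x) x)
    (hhpos : ∀ x > (0:ℝ), 0 < h x) {x : ℝ} (hx : 0 < x) :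
    deriv (f ∘ h) x = deriv f (h x) * deriv h x ∧
      deriv (deriv (f ∘ h)) x =
        deriv (deriv f) (h x) * deriv h x * deriv h x +
          deriv f (h x) * deriv (deriv h) x := by
  have h1 : ∀ y > (0:ℝ), deriv (f ∘ h) y = deriv f (h y) * deriv h y := fun y hy =>
    ((hf1 _ (hhpos y hy)).comp y (hh1 y hy)).deriv
  refine ⟨h1 x hx, ?_⟩
  have heq : deriv (f ∘ h) =ᶠ[nhds x] fun y => (deriv f ∘ h) y * deriv h y := by
    filter_upwards [Ioi_mem_nhds hx] with y hy using h1 y hy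
  rw [heq.deriv_eq]
  exact (((hf2 _ (hhpos x hx)).comp x (hh1 x hx)).mul (hh2 x hx)).deriv

/-- unit-invariance of the curvature index `δ`.
For twice differentiable strictly increasing `u, c` on `(0,∞)` with positive derivatives
and a twice differentiable strictly increasing change of variable `h` with `h' > 0`
mapping `(0,∞)` into `(0,∞)`, the curvature index
`δ(q,c) = (u(q)/(q u'(q)))·(q c''(q)/c'(q) − q u''(q)/u'(q))` satisfies
`δ̃(x, c∘h) = δ(h(x), c)` for every `x > 0`, where `δ̃` is defined with `ũ = u∘h` in
place of `u`. -/
theorem stmt_10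
    (u c h : ℝ → ℝ)
    (hu1 : ∀ q > (0:ℝ), HasDerivAt u (deriv u q) q)
    (hu2 : ∀ q > (0:ℝ), HasDerivAt (deriv u) (deriv (deriv u) q) q)
    (hu' : ∀ q > (0:ℝ), 0 < deriv u q)
    (hc1 : ∀ q > (0:ℝ), HasDerivAt c (deriv c q) q)
    (hc2 : ∀ q > (0:ℝ), HasDerivAt (deriv c) (deriv (deriv c) q) q)
    (hc' : ∀ q > (0:ℝ), 0 < deriv c q)
    (hh1 : ∀ x > (0:ℝ), HasDerivAt h (deriv h x) x)
    (hh2 : ∀ x > (0:ℝ), HasDerivAt (deriv h) (deriv (deriv h) x) x)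
    (hh' : ∀ x > (0:ℝ), 0 < deriv h x)
    (hhpos : ∀ x > (0:ℝ), 0 < h x)
    (δ : (ℝ → ℝ) → (ℝ → ℝ) → ℝ → ℝ)
    (hδ : ∀ f g q, δ f g q = (f q / (q * deriv f q)) *
      (q * deriv (deriv g) q / deriv g q - q * deriv (deriv f) q / deriv f q)) :
    ∀ x > (0:ℝ), δ (u ∘ h) (c ∘ h) x = δ u c (h x) := by
  intro x hx
  obtain ⟨hu₁, hu₂⟩ := deriv_comp_and_deriv_deriv_comp_of_pos hu1 hu2 hh1 hh2 hhpos hx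
  obtain ⟨hc₁, hc₂⟩ := deriv_comp_and_deriv_deriv_comp_of_pos hc1 hc2 hh1 hh2 hhpos hx
  have hu₀ := (hu' _ (hhpos x hx)).ne'
  have hc₀ := (hc' _ (hhpos x hx)).ne'
  have hh₀ := (hh' x hx).ne'
  have hhx := (hhpos x hx).ne'
  have hx₀ := hx.ne'
  rw [hδ, hδ, hu₁, hu₂, hc₁, hc₂, Function.comp_apply]
  field_simp
  ring
end
end
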